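/- Fix I ⊆ {1,…,n−1}, and let R^hom_{n,I} ⊆ Q[x_1,…,x_n] be the Q-span of the polynomials F^hom_{w,I} over all w ∈ S_n with Dsl(w) ⊆ I. Then: (i) R^hom_{n,I} is an S_n-subrepresentation and equals the direct sum, over partitions λ ⊢ n and standard Young tableaux S of shape λ with Dsi^c(S) ⊆ I, of the spaces V^S_{h(I,S)}, where h(I,S) is the 0/1 indicator vector of the set I∖Dsi^c(S); (ii) R^hom_{n,I} is isomorphic, as a representation of S_n, to the permutation representation Q[OP_{n,I}]; (iii) every polynomial in R^hom_{n,I} is homogeneous of degree Σ_{i∈I} i. -/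

import Mathlib

open MvPolynomial

noncomputable section

namespace HigherSpecht

open scoped Classical

/-- A tableau: a filling of the plane (row, column), `0`-indexed, with `0` outside the diagram. -/
abbrev Tab := ℕ × ℕ → ℕ

/-- A permutation of `ℕ` represents an element of `Sₙ` (acting on `{1, …, n}`)
when it fixes `0` and everything above `n`. -/
def SuppIn (n : ℕ) (w : Equiv.Perm ℕ) : Prop := ∀ i, i = 0 ∨ n < i → w i = i

/-- Descending locations of a permutation (one-line notation `w 1, …, w n`). -/
def DslSet (n : ℕ) (w : Equiv.Perm ℕ) : Finset ℕ :=
  (Finset.Ioo 0 n).filter fun i => w (i + 1) < w i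

/-- Ascending locations of a permutation. -/
def AslSet (n : ℕ) (w : Equiv.Perm ℕ) : Finset ℕ :=
  (Finset.Ioo 0 n).filter fun i => w i < w (i + 1)

/-- The row in which the entry `i` shows up in a tableau. -/
def rowIdx (T : Tab) (i : ℕ) : ℕ := sInf {r | ∃ c, T (r, c) = i}

/-- The column in which the entry `i` shows up in a tableau. -/
def colIdx (T : Tab) (i : ℕ) : ℕ := sInf {c | T (rowIdx T i, c) = i}

/-- The box containing the entry `i`. -/
def posOf (T : Tab) (i : ℕ) : ℕ × ℕ := (rowIdx T i, colIdx T i)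

/-- Descending indices of a (standard) tableau: `i` with the row of `i+1` strictly below
the row of `i`. -/
def DsiSet (n : ℕ) (T : Tab) : Finset ℕ :=
  (Finset.Ioo 0 n).filter fun i => rowIdx T i < rowIdx T (i + 1)

/-- `Dsi^c`, the complemented descent set `{n - i | i ∈ Dsi}`. -/
def Dsic (n : ℕ) (T : Tab) : Finset ℕ := (DsiSet n T).image fun i => n - i

/-- The entry of `ct_J(S)` at a box `c`: the number of elements of `J` smaller than the
entry of `S` at `c`. -/
def ctEntry (T : Tab) (J : Finset ℕ) (c : ℕ × ℕ) : ℕ := (J.filter fun j => j < T c).card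

/-- The cocharge tableau `ct(S)` of a standard tableau. -/
def ctTab (n : ℕ) (T : Tab) : Tab := fun c => ctEntry T (DsiSet n T) c

/-- The (total) cocharge `cc(S)`: the sum of the entries of `ct(S)`. -/
def ccStat (n : ℕ) (T : Tab) : ℕ :=
  ∑ i ∈ Finset.Icc 1 n, ctEntry T (DsiSet n T) (posOf T i)

/-- `T` is a bijective filling of the given set of cells by `1, …, n` (`n` the number of
cells), with `0` outside. -/
def IsFillingF (cells : Finset (ℕ × ℕ)) (T : Tab) : Prop :=
  (∀ c, c ∉ cells → T c = 0) ∧ Set.BijOn T ↑cells (Set.Icc 1 cells.card)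

/-- A bijective filling of a Young diagram. -/
def IsFilling (μ : YoungDiagram) (T : Tab) : Prop := IsFillingF μ.cells T

/-- A standard Young tableau of shape `μ`: entries strictly increase along rows and columns. -/
def IsStandard (μ : YoungDiagram) (T : Tab) : Prop :=
  IsFilling μ T ∧ ∀ c₁ ∈ μ.cells, ∀ c₂ ∈ μ.cells,
    c₁ ≠ c₂ → c₁.1 ≤ c₂.1 → c₁.2 ≤ c₂.2 → T c₁ < T c₂

/-! ### Robinson–Schensted -/

/-- Row insertion: insert `x` into a row, returning the new row and the bumped entry. -/
def rowInsert : ℕ → List ℕ → List ℕ × Option ℕ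
  | x, [] => ([x], none)
  | x, y :: ys =>
    if x < y then (x :: ys, some y)
    else
      let p := rowInsert x ys
      (y :: p.1, p.2)

/-- Insertion of an entry into a tableau, given as a list of rows. -/
def tabInsert : List (List ℕ) → ℕ → List (List ℕ)
  | [], x => [[x]]
  | r :: rs, x =>
    match rowInsert x r with
    | (r', none) => r' :: rs
    | (r', some y) => r' :: tabInsert rs y

/-- One-line notation of `w ∈ Sₙ`. -/
def oneLine (n : ℕ) (w : Equiv.Perm ℕ) : List ℕ := (List.range n).map fun i => w (i + 1)

/-- The insertion tableau of the first `m` letters of `w`, as a list of rows. -/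
def PtabListPart (n : ℕ) (w : Equiv.Perm ℕ) (m : ℕ) : List (List ℕ) :=
  ((oneLine n w).take m).foldl tabInsert []

/-- Entry of a list-of-rows tableau at a (0-indexed) cell. -/
def listEntry (t : List (List ℕ)) (c : ℕ × ℕ) : ℕ := (t.getD c.1 []).getD c.2 0

/-- The Robinson–Schensted insertion tableau `P(w)`. -/
def Ptab (n : ℕ) (w : Equiv.Perm ℕ) : Tab := fun c => listEntry (PtabListPart n w n) c

/-- The Robinson–Schensted recording tableau `Q(w)`: the entry of a cell is the step at
which the cell is added to the shape. -/
def Qtab (n : ℕ) (w : Equiv.Perm ℕ) : Tab := fun c =>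
  sInf {m | listEntry (PtabListPart n w m) c ≠ 0}

/-! ### Schützenberger evacuation -/

/-- One step of a jeu de taquin slide into the hole at `c`. -/
def slideOnce (T : Tab) (c : ℕ × ℕ) : Tab × (ℕ × ℕ) :=
  let rc : ℕ × ℕ := (c.1, c.2 + 1)
  let dc : ℕ × ℕ := (c.1 + 1, c.2)
  if T rc = 0 ∧ T dc = 0 then (T, c)
  else if T dc = 0 ∨ (T rc ≠ 0 ∧ T rc < T dc) then
    (Function.update (Function.update T c (T rc)) rc 0, rc)
  else
    (Function.update (Function.update T c (T dc)) dc 0, dc)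

/-- Jeu de taquin slide (with fuel). -/
def slide : ℕ → Tab → ℕ × ℕ → Tab × (ℕ × ℕ)
  | 0, T, c => (T, c)
  | k + 1, T, c =>
    let p := slideOnce T c
    if p.2 = c then (T, c) else slide k p.1 p.2

/-- The Schützenberger evacuation: repeatedly delete the minimal entry, slide into the hole,
decrement the remaining entries, and record the vacated cell. -/
def evacAux : ℕ → Tab → Tab
  | 0, _ => fun _ => 0
  | m + 1, T =>
    let c0 := posOf T 1
    let p := slide (m + 1) (Function.update T c0 0) c0
    Function.update (evacAux m fun c => p.1 c - 1) p.2 (m + 1)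

/-- The evacuation tableau `ev S` of a standard tableau with `n` boxes. -/
def evac (n : ℕ) (T : Tab) : Tab := evacAux n T

/-- `Q̃(w) := ev (Q w)`. -/
def Qt (n : ℕ) (w : Equiv.Perm ℕ) : Tab := evac n (Qtab n w)

/-! ### Row and column groups, higher Specht polynomials -/

/-- The identification of `Fin n` with `{1, …, n} ⊆ ℕ`. -/
def finShift (n : ℕ) : Fin n ≃ {i : ℕ // 1 ≤ i ∧ i ≤ n} where
  toFun j := ⟨(j : ℕ) + 1, by have := j.isLt; omega⟩
  invFun i := ⟨(i : ℕ) - 1, by have := i.2; omega⟩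
  left_inv j := by apply Fin.ext; simp
  right_inv i := by apply Subtype.ext; have := i.2; simp; omega

/-- Embedding of the permutations of `Fin n` into permutations of `ℕ` (acting on `{1, …, n}`). -/
def embedPerm (n : ℕ) (σ : Equiv.Perm (Fin n)) : Equiv.Perm ℕ :=
  σ.extendDomain (finShift n)

/-- The row group `R(T)` of a filling, as a finset of permutations of `Fin n`. -/
def rowFinset (n : ℕ) (T : Tab) : Finset (Equiv.Perm (Fin n)) :=
  Finset.univ.filter fun τ => ∀ i ∈ Finset.Icc 1 n, rowIdx T (embedPerm n τ i) = rowIdx T i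

/-- The column group `C(T)` of a filling, as a finset of permutations of `Fin n`. -/
def colFinset (n : ℕ) (T : Tab) : Finset (Equiv.Perm (Fin n)) :=
  Finset.univ.filter fun σ => ∀ i ∈ Finset.Icc 1 n, colIdx T (embedPerm n σ i) = colIdx T i

/-- The row group `R(T)` as a set of permutations of `ℕ`. -/
def rowGroupSet (n : ℕ) (T : Tab) : Set (Equiv.Perm ℕ) :=
  {w | SuppIn n w ∧ ∀ i ∈ Finset.Icc 1 n, rowIdx T (w i) = rowIdx T i}

/-- The column group `C(T)` as a set of permutations of `ℕ`. -/
def colGroupSet (n : ℕ) (T : Tab) : Set (Equiv.Perm ℕ) :=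
  {w | SuppIn n w ∧ ∀ i ∈ Finset.Icc 1 n, colIdx T (w i) = colIdx T i}

/-- The Young symmetrizer `ε_T = Σ_{σ ∈ C(T)} Σ_{τ ∈ R(T)} sgn(σ) σ τ` acting on polynomials
(permutations acting by permuting the variables). -/
def epsAct (n : ℕ) (T : Tab) (p : MvPolynomial ℕ ℚ) : MvPolynomial ℕ ℚ :=
  ∑ σ ∈ colFinset n T, ∑ τ ∈ rowFinset n T,
    (Equiv.Perm.sign σ : ℤ) • rename (⇑(embedPerm n σ * embedPerm n τ)) p

/-- The monomial `p_T^S = Π_i x_i^{h_i}`, where `h_i` is the entry of `ct S` in the box of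
`T` containing `i`. -/
def pTS (n : ℕ) (T S : Tab) : MvPolynomial ℕ ℚ :=
  ∏ i ∈ Finset.Icc 1 n, X i ^ ctEntry S (DsiSet n S) (posOf T i)

/-- `s_T^S`: the order of the stabilizer of `p_T^S` in `R(T)`. -/
def sTS (n : ℕ) (T S : Tab) : ℕ :=
  ((rowFinset n T).filter fun τ =>
    rename (⇑(embedPerm n τ)) (pTS n T S) = pTS n T S).card

/-- The higher Specht polynomial `F_T^S := ε_T p_T^S / s_T^S`. -/
def FTS (n : ℕ) (T S : Tab) : MvPolynomial ℕ ℚ :=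
  ((sTS n T S : ℚ)⁻¹) • epsAct n T (pTS n T S)

/-- The higher Specht polynomial `F_w := F_{P(w)}^{Q̃(w)}` of a permutation. -/
def Fw (n : ℕ) (w : Equiv.Perm ℕ) : MvPolynomial ℕ ℚ := FTS n (Ptab n w) (Qt n w)

/-- The elementary symmetric polynomial `e_r` in the variables `x_1, …, x_n`. -/
def esym (n r : ℕ) : MvPolynomial ℕ ℚ :=
  ∑ s ∈ (Finset.Icc 1 n).powersetCard r, ∏ i ∈ s, X i

/-- The representation `V^S`: the span of the higher Specht polynomials `F_T^S` over all
bijective fillings `T` of the given cells. -/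
def VS (n : ℕ) (cells : Finset (ℕ × ℕ)) (S : Tab) : Submodule ℚ (MvPolynomial ℕ ℚ) :=
  Submodule.span ℚ {p | ∃ T : Tab, IsFillingF cells T ∧ p = FTS n T S}

/-- Multiplication of a subspace of polynomials by a fixed polynomial. -/
def polyMul (q : MvPolynomial ℕ ℚ) (V : Submodule ℚ (MvPolynomial ℕ ℚ)) :
    Submodule ℚ (MvPolynomial ℕ ℚ) :=
  Submodule.map (LinearMap.mulLeft ℚ q) V

/-- The symmetric multiplier `Π_r e_r^{h_r}`. -/
def eProd (n : ℕ) (h : ℕ → ℕ) : MvPolynomial ℕ ℚ := ∏ r ∈ Finset.Icc 1 n, esym n r ^ h r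

/-- `V^S_h := (Π_r e_r^{h_r}) V^S`. -/
def VSh (n : ℕ) (cells : Finset (ℕ × ℕ)) (S : Tab) (h : ℕ → ℕ) :
    Submodule ℚ (MvPolynomial ℕ ℚ) :=
  polyMul (eProd n h) (VS n cells S)

/-! ### The representations `R_{n,I}` -/

/-- For `i ∈ I`, `r_i := #{j ∈ {1,…,n-1} \ I : j < i}`. -/
def rIdxI (n : ℕ) (I : Finset ℕ) (i : ℕ) : ℕ :=
  ((Finset.Ioo 0 n \ I).filter fun j => j < i).card

/-- The vector `h^S_I`, whose `r`-th entry (for `r ≥ 1`) is `#{i ∈ I \ Dsi^c(S) : r_i = r}`. -/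
def hSI (n : ℕ) (I : Finset ℕ) (S : Tab) : ℕ → ℕ := fun r =>
  if 1 ≤ r then ((I \ Dsic n S).filter fun i => rIdxI n I i = r).card else 0

/-- The indicator vector `h(I,S)` of the set `I \ Dsi^c(S)`. -/
def hInd (n : ℕ) (I : Finset ℕ) (S : Tab) : ℕ → ℕ := fun r =>
  if r ∈ I \ Dsic n S then 1 else 0

/-- `F_{w,I} := F_w · Π_{i ∈ I \ Dsl(w)} e_{r_i}`. -/
def FwI (n : ℕ) (I : Finset ℕ) (w : Equiv.Perm ℕ) : MvPolynomial ℕ ℚ :=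
  Fw n w * ∏ i ∈ I \ DslSet n w, esym n (rIdxI n I i)

/-- The homogeneous version `F^hom_{w,I} := F_w · Π_{i ∈ I \ Dsl(w)} e_i`. -/
def FwIhom (n : ℕ) (I : Finset ℕ) (w : Equiv.Perm ℕ) : MvPolynomial ℕ ℚ :=
  Fw n w * ∏ i ∈ I \ DslSet n w, esym n i

/-- The representation `R_{n,I}`: span of the `F_{w,I}` over `w` with `Dsl(w) ⊆ I`. -/
def RnI (n : ℕ) (I : Finset ℕ) : Submodule ℚ (MvPolynomial ℕ ℚ) :=
  Submodule.span ℚ {p | ∃ w : Equiv.Perm ℕ, SuppIn n w ∧ DslSet n w ⊆ I ∧ p = FwI n I w}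

/-- The homogeneous representation `R^hom_{n,I}`. -/
def RnIhom (n : ℕ) (I : Finset ℕ) : Submodule ℚ (MvPolynomial ℕ ℚ) :=
  Submodule.span ℚ {p | ∃ w : Equiv.Perm ℕ, SuppIn n w ∧ DslSet n w ⊆ I ∧ p = FwIhom n I w}

/-- The index type for the decomposition of `R_{n,I}`: pairs of a partition `λ ⊢ n` and a
standard Young tableau `S` of shape `λ` with `Dsi^c(S) ⊆ I`. -/
def SIdx (n : ℕ) (I : Finset ℕ) : Type :=
  {q : YoungDiagram × Tab // q.1.cells.card = n ∧ IsStandard q.1 q.2 ∧ Dsic n q.2 ⊆ I}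

/-! ### Ordered set partitions -/

/-- The cumulative values `j_h` attached to a subset `I ⊆ {1,…,n-1}` (`j_0 = 0`,
`j_h` the `h`-th smallest element, `j_{|I|+1} = n`). -/
def jval (n : ℕ) (I : Finset ℕ) (h : ℕ) : ℕ :=
  if h = 0 then 0 else if h ≤ I.card then (I.sort (· ≤ ·)).getD (h - 1) 0 else n

/-- The composition `comp_n I`, as a function of the index `0 ≤ h ≤ |I|`. -/
def compFun (n : ℕ) (I : Finset ℕ) (h : ℕ) : ℕ := jval n I (h + 1) - jval n I h

/-- The set `OP_{n,I}` of ordered set partitions of `{1,…,n}` into `|I| + 1` blocks whose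
sizes are given by `comp_n I` (blocks indexed by `ℕ`, empty from index `|I| + 1` on). -/
def OPset (n : ℕ) (I : Finset ℕ) : Set (ℕ → Finset ℕ) :=
  {B | (∀ h, I.card + 1 ≤ h → B h = ∅) ∧
       (∀ h₁ h₂, h₁ ≠ h₂ → Disjoint (B h₁) (B h₂)) ∧
       (∀ h ≤ I.card, (B h).card = compFun n I h) ∧
       Finset.Icc 1 n = (Finset.range (I.card + 1)).biUnion B}

/-- The natural action of a permutation on an ordered set partition. -/
def permOP (w : Equiv.Perm ℕ) (B : ℕ → Finset ℕ) : ℕ → Finset ℕ := fun h => (B h).image w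

/-! ### The quotient `R_{n,k}` -/

/-- Elementary symmetric polynomials in `Fin n` variables. -/
def esymFin (n r : ℕ) : MvPolynomial (Fin n) ℚ :=
  ∑ s ∈ (Finset.univ : Finset (Fin n)).powersetCard r, ∏ i ∈ s, X i

/-- The ideal defining `R_{n,k}`: generated by `x_i^k` and `e_r`, `n-k+1 ≤ r ≤ n`. -/
def Jnk (n k : ℕ) : Ideal (MvPolynomial (Fin n) ℚ) :=
  Ideal.span ((Set.range fun i : Fin n => (X i : MvPolynomial (Fin n) ℚ) ^ k) ∪
    {p | ∃ r, n - k + 1 ≤ r ∧ r ≤ n ∧ p = esymFin n r})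

/-- The map sending `x_i` (for `1 ≤ i ≤ n`) to the corresponding variable of
`ℚ[x_1, …, x_n]`, and all other variables to `0`. -/
def toFin (n : ℕ) : MvPolynomial ℕ ℚ →ₐ[ℚ] MvPolynomial (Fin n) ℚ :=
  aeval fun i => if h : 1 ≤ i ∧ i ≤ n then X (⟨i - 1, by omega⟩ : Fin n) else 0

/-- The quotient projection onto `R_{n,k}`. -/
def projNK (n k : ℕ) : MvPolynomial ℕ ℚ →ₐ[ℚ] (MvPolynomial (Fin n) ℚ ⧸ Jnk n k) :=
  (Ideal.Quotient.mkₐ ℚ (Jnk n k)).comp (toFin n)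

/-! ### Corners, insertions and the induction/extension operators -/

/-- `v` is an external corner of `μ`. -/
def IsCorner (μ : YoungDiagram) (v : ℕ × ℕ) : Prop :=
  v ∉ μ.cells ∧ ∃ ν : YoungDiagram, ν.cells = insert v μ.cells

/-- `S +̃ v := ev (ev S + v)`, where `+ v` places the entry `n + 1` in the box `v`. -/
def Sadd (n : ℕ) (S : Tab) (v : ℕ × ℕ) : Tab :=
  evac (n + 1) (Function.update (evac n S) v (n + 1))

/-- `δ^{S,v}`: `0` if `v` lies strictly below the row of `n` in `ev S`, and `1` otherwise. -/
def deltaSV (n : ℕ) (S : Tab) (v : ℕ × ℕ) : ℕ :=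
  if rowIdx (evac n S) n < v.1 then 0 else 1

/-- `h + δ·1_t`: add `δ` to the coordinate `t` of `h` when `t ≥ 1`; do nothing for `t = 0`. -/
def addAt (h : ℕ → ℕ) (t δ : ℕ) : ℕ → ℕ := fun r =>
  if r = t ∧ 1 ≤ t then h r + δ else h r

/-- The induction operator on a single summand:
`Ind_t V^S_h := ⊕_{v ∈ EC(λ)} V^{S +̃ v}_{h + δ^{S,v}·1_t}`. -/
def IndVSh (t n : ℕ) (μ : YoungDiagram) (S : Tab) (h : ℕ → ℕ) :
    Submodule ℚ (MvPolynomial ℕ ℚ) :=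
  ⨆ v : ℕ × ℕ, ⨆ _ : IsCorner μ v,
    VSh (n + 1) (insert v μ.cells) (Sadd n S v) (addAt h t (deltaSV n S v))

/-- The extension operator on a single summand:
`Ext V^S_h := ⊕_{v ∈ EC(λ), δ^{S,v} = 1} V^{S +̃ v}_h`. -/
def ExtVSh (n : ℕ) (μ : YoungDiagram) (S : Tab) (h : ℕ → ℕ) :
    Submodule ℚ (MvPolynomial ℕ ℚ) :=
  ⨆ v : ℕ × ℕ, ⨆ _ : IsCorner μ v ∧ deltaSV n S v = 1,
    VSh (n + 1) (insert v μ.cells) (Sadd n S v) h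

/-- `Ind_t R_{n,I}`, applied summand-by-summand to the decomposition of `R_{n,I}`. -/
def IndR (t n : ℕ) (I : Finset ℕ) : Submodule ℚ (MvPolynomial ℕ ℚ) :=
  ⨆ q : SIdx n I, IndVSh t n q.1.1 q.1.2 (hSI n I q.1.2)

/-- `Ext R_{n,I}`, applied summand-by-summand. -/
def ExtR (n : ℕ) (I : Finset ℕ) : Submodule ℚ (MvPolynomial ℕ ℚ) :=
  ⨆ q : SIdx n I, ExtVSh n q.1.1 q.1.2 (hSI n I q.1.2)

/-- `Ind_t R^hom_{n,I}`, applied summand-by-summand. -/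
def IndRhom (t n : ℕ) (I : Finset ℕ) : Submodule ℚ (MvPolynomial ℕ ℚ) :=
  ⨆ q : SIdx n I, IndVSh t n q.1.1 q.1.2 (hInd n I q.1.2)

/-- `Ext R^hom_{n,I}`, applied summand-by-summand. -/
def ExtRhom (n : ℕ) (I : Finset ℕ) : Submodule ℚ (MvPolynomial ℕ ℚ) :=
  ⨆ q : SIdx n I, ExtVSh n q.1.1 q.1.2 (hInd n I q.1.2)

/-- The lift `R̃_{n,k} = ⊕_{|I| = k-1} R_{n,I}` of the quotient `R_{n,k}`. -/
def Rtil (n k : ℕ) : Submodule ℚ (MvPolynomial ℕ ℚ) :=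
  ⨆ I : Finset ℕ, ⨆ _ : I ⊆ Finset.Ioo 0 n ∧ I.card + 1 = k, RnI n I

/-! ### The extended column group -/

/-- The length of column `c` of a tableau. -/
def colLenT (n : ℕ) (T : Tab) (c : ℕ) : ℕ :=
  ((Finset.range (n + 1)).filter fun r => T (r, c) ≠ 0).card

/-- `q_a`: the number of columns of length `> a` (columns of length `a` occupy the
`0`-indexed columns `q_a, …, q_a + t_a - 1`). -/
def qaT (n : ℕ) (T : Tab) (a : ℕ) : ℕ :=
  ((Finset.range (n + 1)).filter fun c => a < colLenT n T c).card

/-- `t_a`: the number of columns of length `a`. -/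
def taT (n : ℕ) (T : Tab) (a : ℕ) : ℕ :=
  ((Finset.range (n + 1)).filter fun c => colLenT n T c = a).card

/-- The function underlying the permutation `η_T`: the entry in row `j` of column `q_a + i`
is sent to the entry in row `j` of column `q_a + η(i)`; everything else is fixed. -/
def etaFun (n : ℕ) (T : Tab) (a : ℕ) (η : Equiv.Perm ℕ) : ℕ → ℕ := fun m =>
  let c := colIdx T m
  if 1 ≤ m ∧ m ≤ n ∧ qaT n T a ≤ c ∧ c < qaT n T a + taT n T a then
    T (rowIdx T m, qaT n T a + η (c - qaT n T a))
  else m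

/-- The set of the permutations `η_T` (over all `a ≥ 1` and all `η ∈ S_{t_a}`). -/
def etaSet (n : ℕ) (T : Tab) : Set (Equiv.Perm ℕ) :=
  {w | ∃ a, 1 ≤ a ∧ ∃ η : Equiv.Perm ℕ, (∀ i, taT n T a ≤ i → η i = i) ∧
    ⇑w = etaFun n T a η}

/-- The subgroup generated by the permutations `η_T` (a copy of `Π_a S_{t_a}`). -/
def etaSubgroup (n : ℕ) (T : Tab) : Subgroup (Equiv.Perm ℕ) :=
  Subgroup.closure (etaSet n T)

/-- The column group `C(T)` as a subgroup. -/
def colSubgroup (n : ℕ) (T : Tab) : Subgroup (Equiv.Perm ℕ) :=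
  Subgroup.closure (colGroupSet n T)

/-- The extended column group `C̃(T)`, generated by `C(T)` and the `η_T`. -/
def extColSubgroup (n : ℕ) (T : Tab) : Subgroup (Equiv.Perm ℕ) :=
  Subgroup.closure (colGroupSet n T ∪ etaSet n T)

/-- The sign of a permutation of `ℕ` supported on `{1, …, n}`. -/
def signOn (n : ℕ) (σ : Equiv.Perm ℕ) : ℤ :=
  if h : ∃ τ : Equiv.Perm (Fin n), embedPerm n τ = σ then
    (Equiv.Perm.sign h.choose : ℤ) else 0

/-! ### Semistandard tableaux, (generalized) cocharge tableaux -/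

/-- A semistandard filling of the given cells: rows weakly increase, columns strictly
increase (entries outside the cells are normalized to `0`). -/
def IsSSYTOn (cells : Finset (ℕ × ℕ)) (C : Tab) : Prop :=
  (∀ c ∉ cells, C c = 0) ∧
  (∀ c₁ ∈ cells, ∀ c₂ ∈ cells, c₁.1 = c₂.1 → c₁.2 ≤ c₂.2 → C c₁ ≤ C c₂) ∧
  (∀ c₁ ∈ cells, ∀ c₂ ∈ cells, c₁.2 = c₂.2 → c₁.1 < c₂.1 → C c₁ < C c₂)

/-- A generalized cocharge tableau with entries exactly `{0, …, k-1}`. -/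
def IsGCT (cells : Finset (ℕ × ℕ)) (C : Tab) (k : ℕ) : Prop :=
  IsSSYTOn cells C ∧ (∀ c ∈ cells, C c < k) ∧ ∀ h < k, ∃ c ∈ cells, C c = h

/-- The type of a generalized cocharge tableau: the set of cumulative multiplicities
`#{c : C c < h}` for `1 ≤ h ≤ k - 1`. -/
def gctType (cells : Finset (ℕ × ℕ)) (C : Tab) (k : ℕ) : Finset ℕ :=
  (Finset.Ico 1 k).image fun h => (cells.filter fun c => C c < h).card

/-- The standardization of a semistandard tableau: entries are replaced by `1, …, n`,
processing the values in increasing order and, for equal values, from left to right. -/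
def stdz (cells : Finset (ℕ × ℕ)) (C : Tab) : Tab := fun c =>
  if c ∈ cells then
    (cells.filter fun c' => C c' < C c ∨
      (C c' = C c ∧ (c'.2 < c.2 ∨ (c'.2 = c.2 ∧ c'.1 ≤ c.1)))).card
  else 0

/-- A cocharge tableau of shape `μ`: one of the form `ct S` for a standard `S`. -/
def IsCCT (μ : YoungDiagram) (C : Tab) : Prop :=
  ∃ S : Tab, IsStandard μ S ∧ ctTab μ.cells.card S = C

/-- `k` for a tableau: one more than the maximal entry. -/
def kOf (cells : Finset (ℕ × ℕ)) (C : Tab) : ℕ := cells.sup C + 1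

/-- `Dsp^c(C) := {n - i : i ∈ J}`, `J` the type of the cocharge tableau `C`. -/
def Dspc (n : ℕ) (cells : Finset (ℕ × ℕ)) (C : Tab) : Finset ℕ :=
  (gctType cells C (kOf cells C)).image fun i => n - i

/-- The entry sum `Σ(C)`. -/
def entrySum (cells : Finset (ℕ × ℕ)) (C : Tab) : ℕ := ∑ c ∈ cells, C c

/-- `C +̂ v := ct (ct⁻¹(C) +̃ v)`, where `ct⁻¹` is the standardization. -/
def Cadd (n : ℕ) (μ : YoungDiagram) (C : Tab) (v : ℕ × ℕ) : Tab :=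
  ctTab (n + 1) (Sadd n (stdz μ.cells C) v)

/-- The standard Young tableau `S⁰` of shape `μ` filling the rows consecutively. -/
def rowWordTab (μ : YoungDiagram) : Tab := fun c =>
  if c ∈ μ.cells then (∑ r ∈ Finset.range c.1, μ.rowLen r) + c.2 + 1 else 0

/-- The word of an ordered set partition: the blocks listed in order, each sorted
increasingly. -/
def opWord (k : ℕ) (B : ℕ → Finset ℕ) : List ℕ :=
  (List.range k).foldr (fun h acc => (B h).sort (· ≤ ·) ++ acc) []

/-- Renaming the variables of a power series along a permutation. -/
def permSeries (g : Equiv.Perm ℕ) (F : MvPowerSeries ℕ ℚ) : MvPowerSeries ℕ ℚ :=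
  fun m => F (Finsupp.mapDomain ⇑g⁻¹ m)


/-! ## Part A: abstract Young symmetrizers on functions on the symmetric group -/

abbrev FG (n : ℕ) := Equiv.Perm (Fin n) → ℚ

/-- Right translation action. -/
def actG {n : ℕ} (g : Equiv.Perm (Fin n)) : FG n →ₗ[ℚ] FG n where
  toFun f := fun z => f (z * g)
  map_add' _ _ := rfl
  map_smul' _ _ := rfl

def rowS {n : ℕ} (t : Fin n → ℕ × ℕ) : Finset (Equiv.Perm (Fin n)) :=
  Finset.univ.filter fun τ => ∀ i, (t (τ i)).1 = (t i).1

def colS {n : ℕ} (t : Fin n → ℕ × ℕ) : Finset (Equiv.Perm (Fin n)) :=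
  Finset.univ.filter fun τ => ∀ i, (t (τ i)).2 = (t i).2

def opA {n : ℕ} (t : Fin n → ℕ × ℕ) : FG n →ₗ[ℚ] FG n := ∑ τ ∈ rowS t, actG τ

def opB {n : ℕ} (t : Fin n → ℕ × ℕ) : FG n →ₗ[ℚ] FG n :=
  ∑ σ ∈ colS t, ((Equiv.Perm.sign σ : ℤ) : ℚ) • actG σ

def ip {n : ℕ} (f g : FG n) : ℚ := ∑ z, f z * g z

theorem actG_apply {n : ℕ} (g : Equiv.Perm (Fin n)) (f : FG n) (z) : actG g f z = f (z * g) := rfl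

theorem actG_mul {n : ℕ} (g h : Equiv.Perm (Fin n)) (f : FG n) :
    actG (g * h) f = actG g (actG h f) := by
  funext z; simp [actG_apply, mul_assoc]

theorem opA_apply {n : ℕ} (t : Fin n → ℕ × ℕ) (f : FG n) (z) :
    opA t f z = ∑ τ ∈ rowS t, f (z * τ) := by
  simp [opA, actG_apply]

theorem opB_apply {n : ℕ} (t : Fin n → ℕ × ℕ) (f : FG n) (z) :
    opB t f z = ∑ σ ∈ colS t, ((Equiv.Perm.sign σ : ℤ) : ℚ) * f (z * σ) := by
  simp [opB, actG_apply]

theorem mem_rowS {n : ℕ} {t : Fin n → ℕ × ℕ} {τ} : τ ∈ rowS t ↔ ∀ i, (t (τ i)).1 = (t i).1 := by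
  simp [rowS]

theorem mem_colS {n : ℕ} {t : Fin n → ℕ × ℕ} {τ} : τ ∈ colS t ↔ ∀ i, (t (τ i)).2 = (t i).2 := by
  simp [colS]

theorem rowS_one {n : ℕ} (t : Fin n → ℕ × ℕ) : 1 ∈ rowS t := by simp [mem_rowS]
theorem colS_one {n : ℕ} (t : Fin n → ℕ × ℕ) : 1 ∈ colS t := by simp [mem_colS]

theorem rowS_inv {n : ℕ} {t : Fin n → ℕ × ℕ} {τ} (h : τ ∈ rowS t) : τ⁻¹ ∈ rowS t := by
  rw [mem_rowS] at *; intro i; have := h (τ⁻¹ i); simp at this; exact this.symm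

theorem colS_inv {n : ℕ} {t : Fin n → ℕ × ℕ} {τ} (h : τ ∈ colS t) : τ⁻¹ ∈ colS t := by
  rw [mem_colS] at *; intro i; have := h (τ⁻¹ i); simp at this; exact this.symm

theorem rowS_mul {n : ℕ} {t : Fin n → ℕ × ℕ} {τ π} (h : τ ∈ rowS t) (h' : π ∈ rowS t) :
    τ * π ∈ rowS t := by
  rw [mem_rowS] at *; intro i; simp [h, h']

theorem colS_mul {n : ℕ} {t : Fin n → ℕ × ℕ} {τ π} (h : τ ∈ colS t) (h' : π ∈ colS t) :
    τ * π ∈ colS t := by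
  rw [mem_colS] at *; intro i; simp [h, h']

theorem opA_actG {n : ℕ} {t : Fin n → ℕ × ℕ} {τ} (h : τ ∈ rowS t) (f : FG n) :
    opA t (actG τ f) = opA t f := by
  funext z
  simp only [opA_apply, actG_apply]
  refine Finset.sum_bij' (fun π _ => π * τ) (fun π _ => π * τ⁻¹) ?_ ?_ ?_ ?_ ?_
  · intro π hπ; exact rowS_mul hπ h
  · intro π hπ; exact rowS_mul hπ (rowS_inv h)
  · intro π _; simp
  · intro π _; simp
  · intro π _; simp [mul_assoc]

theorem actG_opA {n : ℕ} {t : Fin n → ℕ × ℕ} {τ} (h : τ ∈ rowS t) (f : FG n) :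
    actG τ (opA t f) = opA t f := by
  funext z
  simp only [opA_apply, actG_apply]
  refine Finset.sum_bij' (fun π _ => τ * π) (fun π _ => τ⁻¹ * π) ?_ ?_ ?_ ?_ ?_
  · intro π hπ; exact rowS_mul h hπ
  · intro π hπ; exact rowS_mul (rowS_inv h) hπ
  · intro π _; simp
  · intro π _; simp
  · intro π _; simp [mul_assoc]

theorem sign_sq {n : ℕ} (σ : Equiv.Perm (Fin n)) :
    ((Equiv.Perm.sign σ : ℤ) : ℚ) * ((Equiv.Perm.sign σ : ℤ) : ℚ) = 1 := by
  rcases Int.units_eq_one_or (Equiv.Perm.sign σ) with h | h <;> simp [h]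

theorem actG_opB {n : ℕ} {t : Fin n → ℕ × ℕ} {σ} (h : σ ∈ colS t) (f : FG n) :
    actG σ (opB t f) = ((Equiv.Perm.sign σ : ℤ) : ℚ) • opB t f := by
  funext z
  simp only [opB_apply, actG_apply, Pi.smul_apply, smul_eq_mul, Finset.mul_sum]
  refine Finset.sum_bij' (fun π _ => σ * π) (fun π _ => σ⁻¹ * π) ?_ ?_ ?_ ?_ ?_
  · intro π hπ; exact colS_mul h hπ
  · intro π hπ; exact colS_mul (colS_inv h) hπ
  · intro π _; simp
  · intro π _; simp
  · intro π _
    simp only [map_mul, Units.val_mul, Int.cast_mul, mul_assoc]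
    rw [← mul_assoc, ← mul_assoc, sign_sq, one_mul]

theorem ip_actG {n : ℕ} (g : Equiv.Perm (Fin n)) (f h : FG n) :
    ip (actG g f) h = ip f (actG g⁻¹ h) := by
  simp only [ip, actG_apply]
  refine Finset.sum_bij' (fun z _ => z * g) (fun z _ => z * g⁻¹) ?_ ?_ ?_ ?_ ?_ <;> simp

theorem ip_add_left {n : ℕ} (f g h : FG n) : ip (f + g) h = ip f h + ip g h := by
  simp [ip, add_mul, Finset.sum_add_distrib]
theorem ip_smul_left {n : ℕ} (c : ℚ) (f h : FG n) : ip (c • f) h = c * ip f h := by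
  simp [ip, mul_assoc, Finset.mul_sum]
theorem ip_comm {n : ℕ} (f h : FG n) : ip f h = ip h f := by
  simp [ip, mul_comm]
theorem ip_zero_left {n : ℕ} (h : FG n) : ip 0 h = 0 := by simp [ip]

theorem ip_self {n : ℕ} {f : FG n} (h : ip f f = 0) : f = 0 := by
  funext z
  rw [ip, Finset.sum_eq_zero_iff_of_nonneg (fun z _ => mul_self_nonneg _)] at h
  simpa using h z (Finset.mem_univ _)

theorem ip_sum_left {n : ℕ} {ι : Type*} (s : Finset ι) (f : ι → FG n) (h : FG n) :
    ip (∑ i ∈ s, f i) h = ∑ i ∈ s, ip (f i) h := by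
  induction s using Finset.induction_on with
  | empty => simp [ip_zero_left]
  | insert a s ha ih => rw [Finset.sum_insert ha, Finset.sum_insert ha, ip_add_left, ih]

theorem ip_opA {n : ℕ} (t : Fin n → ℕ × ℕ) (f h : FG n) : ip (opA t f) h = ip f (opA t h) := by
  rw [opA, ip_comm f, LinearMap.sum_apply, LinearMap.sum_apply, ip_sum_left, ip_sum_left]
  refine Finset.sum_bij' (fun π _ => π⁻¹) (fun π _ => π⁻¹) ?_ ?_ ?_ ?_ ?_
  · intro π hπ; exact rowS_inv hπ
  · intro π hπ; exact rowS_inv hπ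
  · simp
  · simp
  · intro π _; rw [ip_actG, ip_comm]

theorem ip_opB {n : ℕ} (t : Fin n → ℕ × ℕ) (f h : FG n) : ip (opB t f) h = ip f (opB t h) := by
  rw [opB, ip_comm f, LinearMap.sum_apply, LinearMap.sum_apply, ip_sum_left, ip_sum_left]
  refine Finset.sum_bij' (fun π _ => π⁻¹) (fun π _ => π⁻¹) ?_ ?_ ?_ ?_ ?_
  · intro π hπ; exact colS_inv hπ
  · intro π hπ; exact colS_inv hπ
  · simp
  · simp
  · intro π _
    rw [LinearMap.smul_apply, LinearMap.smul_apply, ip_smul_left, ip_smul_left, ip_actG, ip_comm]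
    simp

theorem opB_opB {n : ℕ} (t : Fin n → ℕ × ℕ) (f : FG n) :
    opB t (opB t f) = ((colS t).card : ℚ) • opB t f := by
  conv_lhs => rw [opB]
  rw [LinearMap.sum_apply]
  rw [Finset.sum_congr rfl (g := fun _ => opB t f)]
  · simp [← Nat.cast_smul_eq_nsmul ℚ]
  · intro σ hσ
    rw [LinearMap.smul_apply, ← opB, actG_opB hσ, smul_smul, sign_sq, one_smul]

/-- positivity: `A B A y = 0 → B A y = 0`. -/
theorem opABA_zero {n : ℕ} (t : Fin n → ℕ × ℕ) (y : FG n) (h : opA t (opB t (opA t y)) = 0) :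
    opB t (opA t y) = 0 := by
  apply ip_self
  rw [ip_opB, opB_opB, ip_comm, ip_smul_left, ip_comm, ip_opA, h, ip_comm, ip_zero_left, mul_zero]

/-- killing: a pair in the same row of `t'` and the same column of `t`. -/
theorem opA_opB_zero {n : ℕ} (t' t : Fin n → ℕ × ℕ) (i j : Fin n) (hij : i ≠ j)
    (hr : (t' i).1 = (t' j).1) (hc : (t i).2 = (t j).2) (f : FG n) : opA t' (opB t f) = 0 := by
  have h1 : Equiv.swap i j ∈ rowS t' := by
    rw [mem_rowS]; intro k
    rw [Equiv.swap_apply_def]; split_ifs with h h'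
    · rw [h, hr]
    · rw [h', hr]
    · rfl
  have h2 : Equiv.swap i j ∈ colS t := by
    rw [mem_colS]; intro k
    rw [Equiv.swap_apply_def]; split_ifs with h h'
    · rw [h, hc]
    · rw [h', hc]
    · rfl
  have := opA_actG h1 (opB t f)
  rw [actG_opB h2, Equiv.Perm.sign_swap hij] at this
  simp only [Units.val_neg, Units.val_one, Int.cast_neg, Int.cast_one, neg_smul, one_smul,
    map_neg] at this
  exact self_eq_neg.mp this.symm

theorem rowS_comp {n : ℕ} (t : Fin n → ℕ × ℕ) (g τ : Equiv.Perm (Fin n)) :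
    τ ∈ rowS (t ∘ ⇑g⁻¹) ↔ g⁻¹ * τ * g ∈ rowS t := by
  simp only [mem_rowS, Function.comp, Equiv.Perm.mul_apply]
  constructor
  · intro h i; have := h (g i); simpa using this
  · intro h i; have := h (g⁻¹ i); simpa using this

theorem colS_comp {n : ℕ} (t : Fin n → ℕ × ℕ) (g τ : Equiv.Perm (Fin n)) :
    τ ∈ colS (t ∘ ⇑g⁻¹) ↔ g⁻¹ * τ * g ∈ colS t := by
  simp only [mem_colS, Function.comp, Equiv.Perm.mul_apply]
  constructor
  · intro h i; have := h (g i); simpa using this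
  · intro h i; have := h (g⁻¹ i); simpa using this

theorem actG_opA_conj {n : ℕ} (t : Fin n → ℕ × ℕ) (g : Equiv.Perm (Fin n)) (f : FG n) :
    actG g (opA t f) = opA (t ∘ ⇑g⁻¹) (actG g f) := by
  funext z
  simp only [opA_apply, actG_apply]
  refine Finset.sum_bij' (fun π _ => g * π * g⁻¹) (fun π _ => g⁻¹ * π * g) ?_ ?_ ?_ ?_ ?_
  · intro π hπ; rw [rowS_comp]; simpa [mul_assoc] using hπ
  · intro π hπ; rwa [rowS_comp] at hπ
  · intro π _; simp [mul_assoc]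
  · intro π _; simp [mul_assoc]
  · intro π _; simp [mul_assoc]

theorem actG_opB_conj {n : ℕ} (t : Fin n → ℕ × ℕ) (g : Equiv.Perm (Fin n)) (f : FG n) :
    actG g (opB t f) = opB (t ∘ ⇑g⁻¹) (actG g f) := by
  funext z
  simp only [opB_apply, actG_apply]
  refine Finset.sum_bij' (fun π _ => g * π * g⁻¹) (fun π _ => g⁻¹ * π * g) ?_ ?_ ?_ ?_ ?_
  · intro π hπ; rw [colS_comp]; simpa [mul_assoc] using hπ
  · intro π hπ; rwa [colS_comp] at hπ
  · intro π _; simp [mul_assoc]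
  · intro π _; simp [mul_assoc]
  · intro π _
    have := sign_sq g
    simp [mul_assoc]
    linear_combination (-((Equiv.Perm.sign π : ℤ) : ℚ) * f (z * (g * π))) * this

/-! ### fillings -/

def IsFill {n : ℕ} (μ : YoungDiagram) (t : Fin n → ℕ × ℕ) : Prop :=
  Function.Injective t ∧ ∀ c, c ∈ μ ↔ ∃ i, t i = c

theorem IsFill.comp {n : ℕ} {μ : YoungDiagram} {t : Fin n → ℕ × ℕ} (h : IsFill μ t)
    (g : Equiv.Perm (Fin n)) : IsFill μ (t ∘ ⇑g) := by
  refine ⟨h.1.comp g.injective, fun c => ?_⟩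
  rw [h.2]
  constructor
  · rintro ⟨i, rfl⟩; exact ⟨g⁻¹ i, by simp⟩
  · rintro ⟨i, rfl⟩; exact ⟨g i, rfl⟩

theorem IsFill.cells {n : ℕ} {μ : YoungDiagram} {t : Fin n → ℕ × ℕ} (h : IsFill μ t) :
    μ.cells = Finset.univ.map ⟨t, h.1⟩ := by
  ext c; rw [YoungDiagram.mem_cells, h.2]; simp

theorem IsFill.card {n : ℕ} {μ : YoungDiagram} {t : Fin n → ℕ × ℕ} (h : IsFill μ t) :
    μ.cells.card = n := by
  rw [h.cells]; simp

/-- two fillings of the same shape differ by a permutation -/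
theorem IsFill.exists_perm {n : ℕ} {μ : YoungDiagram} {t s : Fin n → ℕ × ℕ} (ht : IsFill μ t)
    (hs : IsFill μ s) : ∃ g : Equiv.Perm (Fin n), s = t ∘ ⇑g := by
  have h : ∀ i, ∃ j, t j = s i := fun i => (ht.2 _).1 ((hs.2 _).2 ⟨i, rfl⟩)
  choose f hf using h
  have hinj : Function.Injective f := by
    intro i j hij; apply hs.1; rw [← hf, ← hf, hij]
  refine ⟨Equiv.ofBijective f (Finite.injective_iff_bijective.1 hinj), ?_⟩
  funext i; simp [hf]

def nrow (μ : YoungDiagram) : ℕ := ∑ c ∈ μ.cells, c.1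

theorem IsFill.nrow {n : ℕ} {μ : YoungDiagram} {t : Fin n → ℕ × ℕ} (h : IsFill μ t) :
    nrow μ = ∑ i, (t i).1 := by
  rw [HigherSpecht.nrow, h.cells]; simp

/-- Von Neumann's combinatorial lemma. -/
theorem vn_sort {n : ℕ} {μ : YoungDiagram} {t t' : Fin n → ℕ × ℕ} (ht : IsFill μ t)
    (h : ∀ i j, (t' i).1 = (t' j).1 → (t i).2 = (t j).2 → i = j) :
    ∃ σ ∈ colS t, ∀ i, (t (σ⁻¹ i)).1 ≤ (t' i).1 := by
  let r : Fin n → ℕ := fun i =>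
    (Finset.univ.filter fun j => (t j).2 = (t i).2 ∧ (t' j).1 < (t' i).1).card
  let s : Fin n → ℕ × ℕ := fun i => (r i, (t i).2)
  have hmono : ∀ i j, (t i).2 = (t j).2 → (t' i).1 < (t' j).1 → r i < r j := by
    intro i j hc hlt
    apply Finset.card_lt_card
    rw [Finset.ssubset_iff_of_subset]
    · exact ⟨i, by simp [hc, hlt], by simp⟩
    · intro k; simp only [Finset.mem_filter, Finset.mem_univ, true_and]; intro hk
      exact ⟨hk.1.trans hc, hk.2.trans hlt⟩
  have hinj : Function.Injective s := by
    intro i j hij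
    simp only [s, Prod.mk.injEq] at hij
    apply h _ _ _ hij.2
    rcases lt_trichotomy (t' i).1 (t' j).1 with h1 | h1 | h1
    · have := hmono i j hij.2 h1; omega
    · exact h1
    · have := hmono j i hij.2.symm h1; omega
  have hmem : ∀ i, s i ∈ μ := by
    intro i
    rw [YoungDiagram.mem_iff_lt_colLen]
    have hc : (Finset.univ.filter fun j => (t j).2 = (t i).2).card = μ.colLen (t i).2 := by
      rw [YoungDiagram.colLen_eq_card, YoungDiagram.col, ht.cells, Finset.filter_map,
        Finset.card_map]
      rfl
    show r i < _
    rw [← hc]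
    apply Finset.card_lt_card
    rw [Finset.ssubset_iff_of_subset]
    · exact ⟨i, by simp, by simp⟩
    · intro k; simp only [Finset.mem_filter, Finset.mem_univ, true_and]; exact fun h => h.1
  have hr : ∀ i, r i ≤ (t' i).1 := by
    intro i
    have : r i ≤ (Finset.range (t' i).1).card := by
      apply Finset.card_le_card_of_injOn (fun j => (t' j).1)
      · intro j hj; simp at hj; simpa using hj.2
      · intro a ha b hb hab
        simp at ha hb
        exact h _ _ hab (ha.1.trans hb.1.symm)
    simpa using this
  have h' : ∀ i, ∃ j, t j = s i := fun i => (ht.2 _).1 (hmem i)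
  choose f hf using h'
  have hfi : Function.Injective f := by
    intro i j hij; apply hinj; rw [← hf, ← hf, hij]
  let g := Equiv.ofBijective f (Finite.injective_iff_bijective.1 hfi)
  have hg : ∀ i, t (g i) = s i := hf
  refine ⟨g⁻¹, colS_inv ?_, ?_⟩
  · rw [mem_colS]; intro i; rw [hg]
  · intro i; rw [inv_inv, hg]; exact hr i

theorem nrow_le_of {n : ℕ} {μ μ' : YoungDiagram} {t t' : Fin n → ℕ × ℕ} (ht : IsFill μ t)
    (ht' : IsFill μ' t') {σ : Equiv.Perm (Fin n)} (h : ∀ i, (t (σ⁻¹ i)).1 ≤ (t' i).1) :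
    nrow μ ≤ nrow μ' := by
  rw [(ht.comp σ⁻¹).nrow, ht'.nrow]
  exact Finset.sum_le_sum fun i _ => h i

theorem row_eq_of {n : ℕ} {μ μ' : YoungDiagram} {t t' : Fin n → ℕ × ℕ} (ht : IsFill μ t)
    (ht' : IsFill μ' t') {σ : Equiv.Perm (Fin n)} (h : ∀ i, (t (σ⁻¹ i)).1 ≤ (t' i).1)
    (he : nrow μ' ≤ nrow μ) : ∀ i, (t (σ⁻¹ i)).1 = (t' i).1 := by
  have h1 := le_antisymm (nrow_le_of ht ht' h) he
  rw [(ht.comp σ⁻¹).nrow, ht'.nrow] at h1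
  have := (Finset.sum_eq_sum_iff_of_le (fun i _ => h i)).1 h1
  exact fun i => this i (Finset.mem_univ _)

theorem shape_eq_of_rows {n : ℕ} {μ μ' : YoungDiagram} {t t' : Fin n → ℕ × ℕ} (ht : IsFill μ t)
    (ht' : IsFill μ' t') (h : ∀ i, (t i).1 = (t' i).1) : μ = μ' := by
  have hl : ∀ r, μ.rowLen r = μ'.rowLen r := by
    intro r
    rw [YoungDiagram.rowLen_eq_card, YoungDiagram.rowLen_eq_card, YoungDiagram.row,
      YoungDiagram.row, ht.cells, ht'.cells, Finset.filter_map, Finset.card_map,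
      Finset.filter_map, Finset.card_map]
    congr 1
    ext i; simp [h]
  apply YoungDiagram.ext
  ext ⟨a, b⟩
  rw [YoungDiagram.mem_cells, YoungDiagram.mem_cells, YoungDiagram.mem_iff_lt_rowLen,
    YoungDiagram.mem_iff_lt_rowLen, hl]

/-! ### standard fillings and the lexicographic order of row words -/

/-- standard filling, as a map from values (shifted by one) to cells -/
def IsStd {n : ℕ} (μ : YoungDiagram) (s : Fin n → ℕ × ℕ) : Prop :=
  IsFill μ s ∧ ∀ i j, (s i).1 ≤ (s j).1 → (s i).2 ≤ (s j).2 → i ≤ j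

def rword {n : ℕ} (s : Fin n → ℕ × ℕ) : Lex (Fin n → ℕ) := toLex fun v => (s v).1

theorem rword_lt {n : ℕ} {a b : Fin n → ℕ × ℕ} :
    rword a < rword b ↔ ∃ v, (∀ u < v, (a u).1 = (b u).1) ∧ (a v).1 < (b v).1 := Iff.rfl

theorem rword_eq {n : ℕ} {a b : Fin n → ℕ × ℕ} :
    rword a = rword b ↔ ∀ v, (a v).1 = (b v).1 := by
  rw [rword, rword, toLex_inj, funext_iff]

theorem exists_first_diff {n : ℕ} {a b : Fin n → ℕ} (h : a ≠ b) :
    ∃ v, (∀ u < v, a u = b u) ∧ a v ≠ b v := by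
  have h' : ∃ v, a v ≠ b v := by
    by_contra hc; push Not at hc; exact h (funext hc)
  obtain ⟨v, hv, hmin⟩ := WellFounded.has_min (wellFounded_lt (α := Fin n)) {v | a v ≠ b v} h'
  refine ⟨v, fun u hu => ?_, hv⟩
  by_contra hc; exact hmin u hc hu

theorem std_col_lex {n : ℕ} {μ : YoungDiagram} {s : Fin n → ℕ × ℕ} (hs : IsStd μ s)
    {σ : Equiv.Perm (Fin n)} (hσ : σ ∈ colS s) (h1 : σ ≠ 1) : rword s < rword (s ∘ ⇑σ⁻¹) := by
  have hσ' := mem_colS.1 (colS_inv hσ)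
  have hne : (fun v => (s v).1) ≠ (fun v => ((s ∘ ⇑σ⁻¹) v).1) := by
    intro h
    apply h1
    have : ∀ v, s (σ⁻¹ v) = s v := fun v => Prod.ext (congrFun h v).symm (hσ' v)
    have h2 : σ⁻¹ = 1 := Equiv.ext fun v => hs.1.1 (this v)
    simpa using h2
  obtain ⟨v, hv, hd⟩ := exists_first_diff hne
  rw [rword_lt]
  refine ⟨v, hv, ?_⟩
  by_contra hc
  have hlt : (s (σ⁻¹ v)).1 < (s v).1 := by
    simp only [Function.comp] at hc hd
    omega
  have h2 : s (σ⁻¹ v) ≠ s v := fun h => by rw [h] at hlt; omega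
  have h3 : σ⁻¹ v ≤ v := hs.2 _ _ hlt.le (hσ' v).le
  have h4 : σ⁻¹ v < v := lt_of_le_of_ne h3 fun h => h2 (by rw [h])
  have h5 := hv _ h4
  have h6 : s (σ⁻¹ (σ⁻¹ v)) = s (σ⁻¹ v) := Prod.ext h5.symm (hσ' _)
  have h7 := hs.1.1 h6
  exact h4.ne (σ⁻¹.injective h7)

theorem std_rows_eq {n : ℕ} {μ : YoungDiagram} {s s' : Fin n → ℕ × ℕ} (hs : IsStd μ s)
    (hs' : IsStd μ s') (h : ∀ v, (s v).1 = (s' v).1) : s = s' := by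
  funext v
  induction v using WellFoundedLT.induction with
  | ind v ih =>
    have key : ∀ {a b : Fin n → ℕ × ℕ}, IsStd μ a → IsStd μ b → (∀ v, (a v).1 = (b v).1) →
        (∀ u < v, a u = b u) → ¬ (a v).2 < (b v).2 := by
      intro a b ha hb hab ih hlt
      obtain ⟨u, hu⟩ := (hb.1.2 (a v)).1 ((ha.1.2 _).2 ⟨v, rfl⟩)
      have h1 : u ≤ v := hb.2 _ _ (by rw [hu, hab]) (by rw [hu]; exact hlt.le)
      have h2 : u < v := lt_of_le_of_ne h1 (by rintro rfl; rw [hu] at hlt; omega)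
      have h3 := ih u h2
      have h4 := ha.1.1 (h3.trans hu)
      exact h2.ne h4
    have k1 := key hs hs' h ih
    have k2 := key hs' hs (fun v => (h v).symm) (fun u hu => (ih u hu).symm)
    exact Prod.ext (h v) (by omega)

/-- number of elements of `J` less than `v` -/
def cnt (J : Finset ℕ) (v : ℕ) : ℕ := (J.filter fun j => j < v).card

theorem cnt_mono (J : Finset ℕ) : Monotone (cnt J) := by
  intro a b h
  apply Finset.card_le_card
  intro j; simp only [Finset.mem_filter]; intro hj; exact ⟨hj.1, by omega⟩

theorem cnt_succ_mem {J : Finset ℕ} {v : ℕ} (h : v ∈ J) : cnt J v < cnt J (v + 1) := by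
  apply Finset.card_lt_card
  rw [Finset.ssubset_iff_of_subset]
  · exact ⟨v, by simp [h], by simp⟩
  · intro j; simp only [Finset.mem_filter]; intro hj; exact ⟨hj.1, by omega⟩

/-- descent set of a standard filling -/
def dsS {n : ℕ} (s : Fin n → ℕ × ℕ) (J : Finset ℕ) : Prop :=
  ∀ u v : Fin n, (v : ℕ) = u + 1 → (s u).1 < (s v).1 → (v : ℕ) ∈ J

theorem block_anti {n : ℕ} {s : Fin n → ℕ × ℕ} {J : Finset ℕ} (hJ : dsS s J) :
    ∀ (d : ℕ) (u v : Fin n), (v : ℕ) = u + d → cnt J (u + 1) = cnt J (v + 1) →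
      (s v).1 ≤ (s u).1 := by
  intro d
  induction d with
  | zero => intro u v h _; have : u = v := Fin.ext (by omega); rw [this]
  | succ d ih =>
    intro u v h hc
    let w : Fin n := ⟨u + d, by have := v.2; omega⟩
    have h1 : cnt J (u + 1) ≤ cnt J (w + 1) := cnt_mono J (by simp [w])
    have h2 : cnt J (w + 1) ≤ cnt J (v + 1) := cnt_mono J (by simp [w]; omega)
    have h3 := ih u w rfl (by omega)
    refine le_trans ?_ h3
    by_contra hlt
    push Not at hlt
    have hv : (v : ℕ) = w + 1 := by simp [w]; omega
    have := cnt_succ_mem (hJ w v hv hlt)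
    rw [hv] at this
    rw [hv] at hc
    have h4 : cnt J (w + 1) ≤ cnt J (w + 1 + 1) := cnt_mono J (by omega)
    omega

theorem class_lex {n : ℕ} {t : Fin n → ℕ × ℕ} {z zS : Equiv.Perm (Fin n)} {J : Finset ℕ}
    (hJ : dsS (t ∘ ⇑zS⁻¹) J) (h : ∀ i, cnt J (z i + 1) = cnt J (zS i + 1)) :
    rword (t ∘ ⇑z⁻¹) ≤ rword (t ∘ ⇑zS⁻¹) := by
  by_contra hc
  obtain ⟨v, hv, hlt⟩ := rword_lt.1 (not_le.1 hc)
  set a := t ∘ ⇑zS⁻¹ with ha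
  set b := t ∘ ⇑z⁻¹ with hb
  set k := cnt J (v + 1)
  set r := (b v).1 with hr
  have hcard : ∀ y : Equiv.Perm (Fin n), (Finset.univ.filter fun u : Fin n =>
      cnt J (u + 1) = k ∧ ((t ∘ ⇑y⁻¹) u).1 = r).card =
      (Finset.univ.filter fun i : Fin n => cnt J (y i + 1) = k ∧ (t i).1 = r).card := by
    intro y
    apply Finset.card_bij' (fun u _ => y⁻¹ u) (fun i _ => y i) <;> simp
  have h1 : (Finset.univ.filter fun u : Fin n => cnt J (u + 1) = k ∧ (b u).1 = r).card =
      (Finset.univ.filter fun u : Fin n => cnt J (u + 1) = k ∧ (a u).1 = r).card := by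
    rw [ha, hb, hcard, hcard]; simp only [h]
  have h2 : (Finset.univ.filter fun u : Fin n => cnt J (u + 1) = k ∧ (a u).1 = r) ⊂
      (Finset.univ.filter fun u : Fin n => cnt J (u + 1) = k ∧ (b u).1 = r) := by
    rw [Finset.ssubset_iff_of_subset]
    · refine ⟨v, by simp [k, hr], ?_⟩
      simp only [Finset.mem_filter, Finset.mem_univ, true_and, not_and]
      intro _; exact hlt.ne
    · intro u
      simp only [Finset.mem_filter, Finset.mem_univ, true_and]
      rintro ⟨hu1, hu2⟩
      refine ⟨hu1, ?_⟩
      rcases lt_or_ge u v with huv | huv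
      · rw [← hv u huv, hu2]
      · exfalso
        have := block_anti hJ (u - v : ℕ) v u (by have : (v:ℕ) ≤ u := huv; omega) hu1.symm
        omega
  have := Finset.card_lt_card h2
  omega

/-- indicator function of the class of `S` -/
def iota {n : ℕ} (J : Finset ℕ) (S : Tab) (t : Fin n → ℕ × ℕ) : FG n := fun z =>
  if ∀ i, cnt J (z i + 1) = cnt J (S (t i)) then 1 else 0

theorem actG_iota {n : ℕ} (J : Finset ℕ) (S : Tab) (t : Fin n → ℕ × ℕ) (g : Equiv.Perm (Fin n)) :
    actG g (iota J S t) = iota J S (t ∘ ⇑g⁻¹) := by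
  funext z
  simp only [actG_apply, iota]
  congr 1
  apply propext
  constructor
  · intro h i; have := h (g⁻¹ i); simpa using this
  · intro h i; have := h (g i); simpa using this

/-- `S` is a standard tableau on `μ` with descents in `J`, in position form. -/
def StdOn (n : ℕ) (μ : YoungDiagram) (S : Tab) (J : Finset ℕ) : Prop :=
  ∃ s : Fin n → ℕ × ℕ, IsStd μ s ∧ (∀ v, S (s v) = v + 1) ∧ dsS s J

def uvec {n : ℕ} (J : Finset ℕ) (S : Tab) (t : Fin n → ℕ × ℕ) : FG n :=
  opB t (opA t (iota J S t))

theorem actG_uvec {n : ℕ} (J : Finset ℕ) (S : Tab) (t : Fin n → ℕ × ℕ) (g : Equiv.Perm (Fin n)) :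
    actG g (uvec J S t) = uvec J S (t ∘ ⇑g⁻¹) := by
  rw [uvec, actG_opB_conj, actG_opA_conj, actG_iota, uvec]

theorem StdOn.perm {n : ℕ} {μ : YoungDiagram} {S : Tab} {J : Finset ℕ} {s : Fin n → ℕ × ℕ}
    (hs : IsStd μ s) (hS : ∀ v, S (s v) = v + 1) {t : Fin n → ℕ × ℕ} (ht : IsFill μ t) :
    ∃ z : Equiv.Perm (Fin n), s = t ∘ ⇑z⁻¹ ∧ ∀ i, S (t i) = z i + 1 := by
  obtain ⟨g, hg⟩ := ht.exists_perm hs.1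
  refine ⟨g⁻¹, by simpa using hg, fun i => ?_⟩
  have := hS (g⁻¹ i)
  rw [hg] at this
  simpa using this

/-- Key independence of the semistandard-type vectors for fixed `t`. -/
theorem key_indep {n : ℕ} {μ : YoungDiagram} {t : Fin n → ℕ × ℕ} (ht : IsFill μ t) {ι : Type*}
    (F : Finset ι) (S : ι → Tab) (J : ι → Finset ℕ) (hS : ∀ q ∈ F, StdOn n μ (S q) (J q))
    (hinj : ∀ q ∈ F, ∀ q' ∈ F, (∀ c ∈ μ, S q c = S q' c) → q = q') (c : ι → ℚ)
    (h : opB t (opA t (∑ q ∈ F, c q • iota (J q) (S q) t)) = 0) : ∀ q ∈ F, c q = 0 := by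
  by_contra hne
  push Not at hne
  obtain ⟨q1, hq1, hc1⟩ := hne
  choose! s hs hSs hd using hS
  obtain ⟨q0, hq0, hmax⟩ := Finset.exists_max_image (F.filter fun q => c q ≠ 0)
    (fun q => rword (s q)) ⟨q1, by simp [hq1, hc1]⟩
  rw [Finset.mem_filter] at hq0
  obtain ⟨hq0, hc0⟩ := hq0
  obtain ⟨z0, hz0, hz0'⟩ := StdOn.perm (J := J q0) (hs q0 hq0) (hSs q0 hq0) ht
  have hterm : ∀ σ ∈ colS t, ∀ τ ∈ rowS t, ∀ q ∈ F, c q ≠ 0 →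
      iota (J q) (S q) t (z0 * σ * τ) ≠ 0 → σ = 1 ∧ q = q0 := by
    intro σ hσ τ hτ q hq hcq hi
    obtain ⟨zS, hzS, hzS'⟩ := StdOn.perm (J := J q) (hs q hq) (hSs q hq) ht
    have hi' : ∀ i, cnt (J q) ((z0 * σ * τ) i + 1) = cnt (J q) (zS i + 1) := by
      intro i
      simp only [iota, ne_eq, ite_eq_right_iff, one_ne_zero, imp_false, not_not] at hi
      rw [hi i, hzS']
    have h1 := class_lex (by rw [← hzS]; exact hd q hq) hi'
    rw [← hzS] at h1
    have h2 : rword (t ∘ ⇑(z0 * σ * τ)⁻¹) = rword (s q0 ∘ ⇑(z0 * σ * z0⁻¹)⁻¹) := by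
      rw [rword_eq]; intro v
      have := mem_rowS.1 (rowS_inv hτ) (σ⁻¹ (z0⁻¹ v))
      simpa [hz0] using this
    have h3 : z0 * σ * z0⁻¹ ∈ colS (s q0) := by
      rw [hz0, colS_comp]; simpa [mul_assoc] using hσ
    have h4 : rword (s q) ≤ rword (s q0) := hmax q (by simp [hq, hcq])
    rw [h2] at h1
    have h5 : σ = 1 := by
      by_contra h6
      have := std_col_lex (hs q0 hq0) h3 (by
        intro h7; apply h6
        have : σ = z0⁻¹ * (z0 * σ * z0⁻¹) * z0 := by simp [mul_assoc]
        rw [this, h7]; simp)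
      exact absurd (lt_of_lt_of_le this (h1.trans h4)) (lt_irrefl _)
    refine ⟨h5, ?_⟩
    rw [h5] at h1
    simp only [mul_one, mul_inv_cancel, inv_one, Equiv.Perm.coe_one, Function.comp_id] at h1
    have h8 := rword_eq.1 (le_antisymm h4 h1)
    have h9 := std_rows_eq (hs q hq) (hs q0 hq0) h8
    apply hinj q hq q0 hq0
    intro x hx
    obtain ⟨v, rfl⟩ := ((hs q hq).1.2 x).1 hx
    rw [hSs q hq, h9, hSs q0 hq0]
  have h0 := congrFun h z0
  simp only [opB_apply, opA_apply, Pi.zero_apply] at h0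
  rw [Finset.sum_eq_single_of_mem 1 (colS_one t)] at h0
  · simp only [Equiv.Perm.sign_one, Units.val_one, Int.cast_one, mul_one, one_mul,
      Finset.sum_apply, Pi.smul_apply, smul_eq_mul] at h0
    have h1 : ∀ τ ∈ rowS t, ∑ q ∈ F, c q * iota (J q) (S q) t (z0 * τ) =
        c q0 * iota (J q0) (S q0) t (z0 * τ) := by
      intro τ hτ
      apply Finset.sum_eq_single_of_mem q0 hq0
      intro q hq hqq
      by_contra hcc
      obtain ⟨hx, hy⟩ := mul_ne_zero_iff.1 hcc
      exact hqq (hterm 1 (colS_one t) τ hτ q hq hx (by simpa using hy)).2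
    rw [Finset.sum_congr rfl h1, ← Finset.mul_sum] at h0
    have h2 : (0 : ℚ) < ∑ τ ∈ rowS t, iota (J q0) (S q0) t (z0 * τ) := by
      apply Finset.sum_pos'
      · intro τ _; rw [iota]; split_ifs <;> norm_num
      · refine ⟨1, rowS_one t, ?_⟩
        rw [iota, if_pos]
        · norm_num
        · intro i; rw [hz0']; simp
    rcases mul_eq_zero.1 h0 with h3 | h3
    · exact hc0 h3
    · exact h2.ne' h3
  · intro σ hσ hσ1
    apply mul_eq_zero_of_right
    apply Finset.sum_eq_zero
    intro τ hτ
    simp only [Finset.sum_apply, Pi.smul_apply, smul_eq_mul]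
    apply Finset.sum_eq_zero
    intro q hq
    by_contra hcc
    obtain ⟨hx, hy⟩ := mul_ne_zero_iff.1 hcc
    exact hσ1 (hterm σ hσ τ hτ q hq hx hy).1

/-- Von Neumann, vector form. -/
theorem vn_vec {n : ℕ} {μ : YoungDiagram} {t t' : Fin n → ℕ × ℕ} (ht : IsFill μ t)
    (ht' : IsFill μ t') (J : Finset ℕ) (S : Tab) :
    ∃ k : ℚ, opA t' (uvec J S t) = k • opA t' (uvec J S t') := by
  by_cases hb : ∃ i j, i ≠ j ∧ (t' i).1 = (t' j).1 ∧ (t i).2 = (t j).2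
  · obtain ⟨i, j, hij, hr, hc⟩ := hb
    exact ⟨0, by rw [uvec, opA_opB_zero t' t i j hij hr hc, zero_smul]⟩
  · push Not at hb
    obtain ⟨σ, hσ, hle⟩ := vn_sort (t' := t') ht (fun i j h1 h2 => by
      by_contra h3; exact hb i j h3 h1 h2)
    have heq := row_eq_of ht ht' hle le_rfl
    have h1 : uvec J S (t ∘ ⇑σ⁻¹) = ((Equiv.Perm.sign σ : ℤ) : ℚ) • uvec J S t := by
      rw [← actG_uvec, uvec, actG_opB hσ]
    obtain ⟨g, hg⟩ := ht'.exists_perm (ht.comp σ⁻¹)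
    have hgr : g ∈ rowS t' := by
      rw [mem_rowS]; intro i
      have := congrFun hg i
      simp only [Function.comp] at this
      rw [← this, heq]
    have h2 : uvec J S (t ∘ ⇑σ⁻¹) = actG g⁻¹ (uvec J S t') := by
      rw [actG_uvec, hg, inv_inv]
    refine ⟨((Equiv.Perm.sign σ : ℤ) : ℚ), ?_⟩
    rw [← opA_actG (rowS_inv hgr) (uvec J S t'), ← h2, h1, map_smul, smul_smul, sign_sq, one_smul]

theorem vn_vec_ne {n : ℕ} {μ μ' : YoungDiagram} {t t' : Fin n → ℕ × ℕ} (ht : IsFill μ t)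
    (ht' : IsFill μ' t') (hle : nrow μ' ≤ nrow μ) (hne : μ ≠ μ') (f : FG n) :
    opA t' (opB t f) = 0 := by
  by_contra h0
  have hb : ∀ i j, (t' i).1 = (t' j).1 → (t i).2 = (t j).2 → i = j := by
    intro i j hr hc
    by_contra hij
    exact h0 (opA_opB_zero t' t i j hij hr hc f)
  obtain ⟨σ, hσ, hl⟩ := vn_sort ht hb
  exact hne (shape_eq_of_rows (ht.comp σ⁻¹) ht' (row_eq_of ht ht' hl hle))

def VV (n : ℕ) (μ : YoungDiagram) (J : Finset ℕ) (S : Tab) : Submodule ℚ (FG n) :=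
  Submodule.span ℚ {f | ∃ t : Fin n → ℕ × ℕ, IsFill μ t ∧ f = uvec J S t}

theorem VV_opA {n : ℕ} {μ : YoungDiagram} {J : Finset ℕ} {S : Tab} {t' : Fin n → ℕ × ℕ}
    (ht' : IsFill μ t') {v : FG n} (hv : v ∈ VV n μ J S) :
    ∃ k : ℚ, opA t' v = k • opA t' (uvec J S t') := by
  refine Submodule.span_induction ?_ ?_ ?_ ?_ hv
  · rintro f ⟨t, ht, rfl⟩; exact vn_vec ht ht' J S
  · exact ⟨0, by simp⟩
  · rintro x y _ _ ⟨a, ha⟩ ⟨b, hb⟩; exact ⟨a + b, by rw [map_add, ha, hb, add_smul]⟩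
  · rintro a x _ ⟨b, hb⟩; exact ⟨a * b, by rw [map_smul, hb, smul_smul]⟩

theorem VV_opA_ne {n : ℕ} {μ μ' : YoungDiagram} {J : Finset ℕ} {S : Tab} {t' : Fin n → ℕ × ℕ}
    (ht' : IsFill μ' t') (hle : nrow μ' ≤ nrow μ) (hne : μ ≠ μ') {v : FG n}
    (hv : v ∈ VV n μ J S) : opA t' v = 0 := by
  refine Submodule.span_induction ?_ ?_ ?_ ?_ hv
  · rintro f ⟨t, ht, rfl⟩; exact vn_vec_ne ht ht' hle hne _
  · simp
  · intro x y _ _ hx hy; rw [map_add, hx, hy, add_zero]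
  · intro a x _ hx; rw [map_smul, hx, smul_zero]

theorem VV_zero {n : ℕ} {μ : YoungDiagram} {J : Finset ℕ} {S : Tab} {v : FG n}
    (hv : v ∈ VV n μ J S) (h : ∀ t : Fin n → ℕ × ℕ, IsFill μ t → opA t v = 0) : v = 0 := by
  have key : ∀ f ∈ VV n μ J S, ip f v = 0 := by
    intro f hf
    refine Submodule.span_induction ?_ ?_ ?_ ?_ hf
    · rintro f ⟨t, ht, rfl⟩
      rw [uvec, ip_opB, ip_opA]
      have : opA t (opB t v) = 0 := by
        rw [opB, LinearMap.sum_apply, map_sum]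
        apply Finset.sum_eq_zero
        intro σ _
        rw [LinearMap.smul_apply, map_smul]
        have h2 := actG_opA_conj (t ∘ ⇑σ) σ v
        rw [h _ (ht.comp σ), map_zero] at h2
        have h3 : (t ∘ ⇑σ) ∘ ⇑σ⁻¹ = t := by funext i; simp
        rw [h3] at h2
        rw [← h2, smul_zero]
      rw [this, ip_comm, ip_zero_left]
    · exact ip_zero_left v
    · intro x y _ _ hx hy; rw [ip_add_left, hx, hy, add_zero]
    · intro a x _ hx; rw [ip_smul_left, hx, mul_zero]
  exact ip_self (key v hv)

/-- Main independence. -/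
theorem VV_indep {n : ℕ} {ι : Type*} (F : Finset ι) (μ : ι → YoungDiagram) (S : ι → Tab)
    (J : ι → Finset ℕ) (hS : ∀ q ∈ F, StdOn n (μ q) (S q) (J q))
    (hinj : ∀ q ∈ F, ∀ q' ∈ F, μ q = μ q' → (∀ c ∈ μ q, S q c = S q' c) → q = q')
    (v : ι → FG n) (hv : ∀ q ∈ F, v q ∈ VV n (μ q) (J q) (S q)) (h : ∑ q ∈ F, v q = 0) :
    ∀ q ∈ F, v q = 0 := by
  by_contra hne
  push Not at hne
  obtain ⟨q1, hq1, hc1⟩ := hne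
  obtain ⟨q0, hq0, hmin⟩ := Finset.exists_min_image (F.filter fun q => v q ≠ 0)
    (fun q => nrow (μ q)) ⟨q1, by simp [hq1, hc1]⟩
  rw [Finset.mem_filter] at hq0
  apply hq0.2
  apply VV_zero (hv q0 hq0.1)
  intro t' ht'
  have hk : ∀ q ∈ F.filter (fun q => μ q = μ q0), ∃ k : ℚ,
      opA t' (v q) = k • opA t' (uvec (J q) (S q) t') := by
    intro q hq
    rw [Finset.mem_filter] at hq
    apply VV_opA (μ := μ q) (by rw [hq.2]; exact ht') (hv q hq.1)
  choose! k hk using hk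
  have h1 : ∑ q ∈ F.filter (fun q => μ q = μ q0), opA t' (v q) = 0 := by
    rw [← map_zero (opA t'), ← h, map_sum]
    apply Finset.sum_subset (Finset.filter_subset _ _)
    intro q hq hq'
    have hne : μ q ≠ μ q0 := fun h => hq' (by simp [hq, h])
    by_cases hv0 : v q = 0
    · rw [hv0, map_zero]
    · exact VV_opA_ne ht' (hmin q (by simp [hq, hv0])) hne (hv q hq)
  rw [Finset.sum_congr rfl hk] at h1
  have h2 : opA t' (opB t' (opA t' (∑ q ∈ F.filter (fun q => μ q = μ q0),
      k q • iota (J q) (S q) t'))) = 0 := by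
    rw [← h1]; simp only [map_sum, map_smul, uvec]
  have h3 := key_indep ht' (F.filter (fun q => μ q = μ q0)) S J
    (fun q hq => by rw [Finset.mem_filter] at hq; rw [← hq.2]; exact hS q hq.1)
    (fun q hq q' hq' he => by
      rw [Finset.mem_filter] at hq hq'
      exact hinj q hq.1 q' hq'.1 (hq.2.trans hq'.2.symm) (by rw [hq.2]; exact he))
    k (opABA_zero _ _ h2)
  have hq0' : q0 ∈ F.filter (fun q => μ q = μ q0) := by simp [hq0.1]
  rw [hk q0 hq0', h3 q0 hq0', zero_smul]

/-- Independence of the standard generators, for fixed `S`. -/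
theorem std_indep {n : ℕ} {μ : YoungDiagram} {S : Tab} {J : Finset ℕ} (hS : StdOn n μ S J)
    {ι : Type*} (F : Finset ι) (t : ι → Fin n → ℕ × ℕ) (ht : ∀ a ∈ F, IsStd μ (t a))
    (hinj : ∀ a ∈ F, ∀ b ∈ F, t a = t b → a = b) (c : ι → ℚ)
    (h : ∑ a ∈ F, c a • uvec J S (t a) = 0) : ∀ a ∈ F, c a = 0 := by
  by_contra hne
  push Not at hne
  obtain ⟨q1, hq1, hc1⟩ := hne
  obtain ⟨q0, hq0, hmin⟩ := Finset.exists_min_image (F.filter fun q => c q ≠ 0)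
    (fun q => rword (t q)) ⟨q1, by simp [hq1, hc1]⟩
  rw [Finset.mem_filter] at hq0
  apply hq0.2
  have ht0 := ht q0 hq0.1
  have h1 : opA (t q0) (∑ a ∈ F, c a • uvec J S (t a)) = c q0 • opA (t q0) (uvec J S (t q0)) := by
    rw [map_sum]
    rw [Finset.sum_eq_single_of_mem q0 hq0.1]
    · rw [map_smul]
    · intro q hq hqq
      rw [map_smul]
      by_cases hcq : c q = 0
      · rw [hcq, zero_smul]
      · have : opA (t q0) (uvec J S (t q)) = 0 := by
          by_contra h0
          have hb : ∀ i j, (t q0 i).1 = (t q0 j).1 → (t q i).2 = (t q j).2 → i = j := by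
            intro i j hr hc
            by_contra hij
            exact h0 (opA_opB_zero _ _ i j hij hr hc _)
          obtain ⟨σ, hσ, hl⟩ := vn_sort (ht q hq).1 hb
          have heq := row_eq_of (ht q hq).1 ht0.1 hl le_rfl
          have h5 : rword (t q ∘ ⇑σ⁻¹) = rword (t q0) := rword_eq.2 heq
          have h6 : rword (t q0) ≤ rword (t q) := hmin q (by simp [hq, hcq])
          by_cases hs1 : σ = 1
          · rw [hs1] at heq
            exact hqq (hinj q hq q0 hq0.1 (std_rows_eq (ht q hq) ht0 heq))
          · have := std_col_lex (ht q hq) hσ hs1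
            rw [h5] at this
            exact absurd (lt_of_lt_of_le this h6) (lt_irrefl _)
        rw [this, smul_zero]
  rw [h, map_zero] at h1
  have h2 : opA (t q0) (opB (t q0) (opA (t q0)
      (∑ x ∈ ({()} : Finset Unit), c q0 • iota J S (t q0)))) = 0 := by
    rw [Finset.sum_singleton, map_smul, map_smul, map_smul, h1, uvec]
  exact key_indep ht0.1 ({()} : Finset Unit) (fun _ => S) (fun _ => J) (fun _ _ => hS)
    (fun _ _ _ _ _ => rfl) (fun _ => c q0) (opABA_zero _ _ h2) () (by simp)

/-! ### bridge between tableaux and fillings -/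

theorem rowIdx_of_unique {T : Tab} {c : ℕ × ℕ} (h : ∀ c', T c' = T c → c' = c) :
    rowIdx T (T c) = c.1 := by
  have : {r | ∃ c', T (r, c') = T c} = {c.1} := by
    ext r
    simp only [Set.mem_ofPred_eq, Set.mem_singleton_iff]
    constructor
    · rintro ⟨c', hc'⟩
      rw [← h _ hc']
    · rintro rfl
      exact ⟨c.2, rfl⟩
  rw [rowIdx, this]; simp

theorem posOf_of_unique {T : Tab} {c : ℕ × ℕ} (h : ∀ c', T c' = T c → c' = c) :
    posOf T (T c) = c := by
  have h1 := rowIdx_of_unique h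
  have : {c' | T (rowIdx T (T c), c') = T c} = {c.2} := by
    ext r
    simp only [Set.mem_ofPred_eq, Set.mem_singleton_iff]
    rw [h1]
    constructor
    · intro hc'
      rw [← h _ hc']
    · rintro rfl
      rfl
  rw [posOf, colIdx, this, h1]; simp

theorem IsFillingF.unique {C : Finset (ℕ × ℕ)} {T : Tab} (h : IsFillingF C T) {c : ℕ × ℕ}
    (hc : c ∈ C) : ∀ c', T c' = T c → c' = c := by
  intro c' hc'
  have h1 := h.2.mapsTo (Finset.mem_coe.2 hc)
  have h2 : c' ∈ C := by
    by_contra h3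
    have := h.1 _ h3
    simp only [Set.mem_Icc] at h1
    omega
  exact h.2.injOn (Finset.mem_coe.2 h2) (Finset.mem_coe.2 hc) hc'

theorem IsFillingF.posOf {C : Finset (ℕ × ℕ)} {T : Tab} (h : IsFillingF C T) {c : ℕ × ℕ}
    (hc : c ∈ C) : posOf T (T c) = c := posOf_of_unique (h.unique hc)

/-- position function of a tableau -/
def tT (n : ℕ) (T : Tab) : Fin n → ℕ × ℕ := fun i => posOf T (i + 1)

theorem IsFillingF.apply_tT {C : Finset (ℕ × ℕ)} {n : ℕ} (hn : C.card = n) {T : Tab}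
    (h : IsFillingF C T) (i : Fin n) : T (tT n T i) = i + 1 ∧ tT n T i ∈ C := by
  obtain ⟨c, hc, he⟩ := h.2.surjOn (show ((i : ℕ) + 1) ∈ Set.Icc 1 C.card by
    simp only [Set.mem_Icc]; have := i.2; omega)
  have : tT n T i = c := by
    rw [tT, ← he]; exact h.posOf hc
  rw [this]; exact ⟨he, hc⟩

theorem IsFillingF.tT_eq {C : Finset (ℕ × ℕ)} {n : ℕ} {T : Tab}
    (h : IsFillingF C T) {c : ℕ × ℕ} (hc : c ∈ C) (i : Fin n) (hi : T c = i + 1) :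
    tT n T i = c := by
  rw [tT, ← hi]; exact h.posOf hc

theorem IsFilling.isFill {μ : YoungDiagram} {n : ℕ} (hn : μ.cells.card = n) {T : Tab}
    (h : IsFilling μ T) : IsFill μ (tT n T) := by
  refine ⟨fun i j hij => ?_, fun c => ⟨fun hc => ?_, ?_⟩⟩
  · have h1 := (IsFillingF.apply_tT hn h i).1
    have h2 := (IsFillingF.apply_tT hn h j).1
    rw [hij] at h1
    ext; omega
  · have h1 := h.2.mapsTo (Finset.mem_coe.2 ((YoungDiagram.mem_cells _).2 hc))
    simp only [Set.mem_Icc] at h1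
    refine ⟨⟨T c - 1, by omega⟩, ?_⟩
    apply IsFillingF.tT_eq h ((YoungDiagram.mem_cells _).2 hc)
    simp; omega
  · rintro ⟨i, rfl⟩
    exact (YoungDiagram.mem_cells _).1 (IsFillingF.apply_tT hn h i).2

theorem IsFill.exists_filling {μ : YoungDiagram} {n : ℕ} (hn : μ.cells.card = n)
    {t : Fin n → ℕ × ℕ} (h : IsFill μ t) : ∃ T, IsFilling μ T ∧ tT n T = t := by
  let T : Tab := fun c => if hc : ∃ i, t i = c then ((hc.choose : Fin n) : ℕ) + 1 else 0
  have hT : ∀ i, T (t i) = i + 1 := by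
    intro i
    have hc : ∃ j, t j = t i := ⟨i, rfl⟩
    have : hc.choose = i := h.1 hc.choose_spec
    simp only [T, dif_pos hc, this]
  have hF : IsFilling μ T := by
    refine ⟨fun c hc => ?_, fun c hc => ?_, fun c hc d hd hcd => ?_, fun k hk => ?_⟩
    · have : ¬ ∃ i, t i = c := by rwa [← h.2, ← YoungDiagram.mem_cells]
      simp only [T, dif_neg this]
    · obtain ⟨i, rfl⟩ := (h.2 c).1 ((YoungDiagram.mem_cells _).1 (Finset.mem_coe.1 hc))
      rw [hT, hn]
      simp only [Set.mem_Icc]; have := i.2; omega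
    · obtain ⟨i, rfl⟩ := (h.2 c).1 ((YoungDiagram.mem_cells _).1 (Finset.mem_coe.1 hc))
      obtain ⟨j, rfl⟩ := (h.2 d).1 ((YoungDiagram.mem_cells _).1 (Finset.mem_coe.1 hd))
      rw [hT, hT] at hcd
      congr 1; ext; omega
    · rw [hn, Set.mem_Icc] at hk
      refine ⟨t ⟨k - 1, by omega⟩, Finset.mem_coe.2 ((YoungDiagram.mem_cells _).2 ((h.2 _).2 ⟨_, rfl⟩)), ?_⟩
      rw [hT]; simp; omega
  refine ⟨T, hF, ?_⟩
  funext i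
  exact IsFillingF.tT_eq hF ((YoungDiagram.mem_cells _).2 ((h.2 _).2 ⟨_, rfl⟩)) i (hT i)

theorem IsStandard.isStd {μ : YoungDiagram} {n : ℕ} (hn : μ.cells.card = n) {T : Tab}
    (h : IsStandard μ T) : IsStd μ (tT n T) := by
  refine ⟨h.1.isFill hn, fun i j h1 h2 => ?_⟩
  by_cases hij : i = j
  · exact hij.le
  · have hi := IsFillingF.apply_tT hn h.1 i
    have hj := IsFillingF.apply_tT hn h.1 j
    have := h.2 _ hi.2 _ hj.2 (fun he => hij ((h.1.isFill hn).1 he)) h1 h2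
    rw [hi.1, hj.1] at this
    rw [Fin.le_def]; omega

theorem IsStandard.stdOn {μ : YoungDiagram} {n : ℕ} (hn : μ.cells.card = n) {S : Tab}
    (h : IsStandard μ S) : StdOn n μ S (DsiSet n S) := by
  refine ⟨tT n S, h.isStd hn, fun v => (IsFillingF.apply_tT hn h.1 v).1, fun u v huv hlt => ?_⟩
  rw [DsiSet, Finset.mem_filter, Finset.mem_Ioo]
  refine ⟨⟨by omega, v.2⟩, ?_⟩
  simp only [tT, HigherSpecht.posOf] at hlt
  rw [← huv] at hlt
  exact hlt

theorem embedPerm_fin {n : ℕ} (g : Equiv.Perm (Fin n)) (i : Fin n) :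
    embedPerm n g ((i : ℕ) + 1) = (g i : ℕ) + 1 := by
  have := Equiv.Perm.extendDomain_apply_image g (finShift n) i
  simpa [embedPerm, finShift] using this

theorem embedPerm_out {n : ℕ} (g : Equiv.Perm (Fin n)) {k : ℕ} (hk : k = 0 ∨ n < k) :
    embedPerm n g k = k := by
  apply Equiv.Perm.extendDomain_apply_not_subtype
  omega

theorem embedPerm_mul {n : ℕ} (g h : Equiv.Perm (Fin n)) :
    embedPerm n g * embedPerm n h = embedPerm n (g * h) :=
  Equiv.Perm.extendDomain_mul _ _ _

theorem suppIn_embedPerm {n : ℕ} (g : Equiv.Perm (Fin n)) : SuppIn n (embedPerm n g) :=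
  fun _ hi => embedPerm_out g hi

theorem SuppIn.mem {n : ℕ} {w : Equiv.Perm ℕ} (h : SuppIn n w) {i : ℕ} (hi : 1 ≤ i ∧ i ≤ n) :
    1 ≤ w i ∧ w i ≤ n := by
  by_contra hc
  have h1 := h (w i) (by omega)
  have := w.injective h1
  omega

theorem SuppIn.exists_embed {n : ℕ} {w : Equiv.Perm ℕ} (h : SuppIn n w) :
    ∃ g, w = embedPerm n g := by
  have hinj : Function.Injective (fun i : Fin n => (⟨w (i + 1) - 1, by
      have := h.mem (i := i + 1) ⟨by omega, i.2⟩; omega⟩ : Fin n)) := by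
    intro i j hij
    simp only [Fin.mk.injEq] at hij
    have h1 := h.mem (i := i + 1) ⟨by omega, i.2⟩
    have h2 := h.mem (i := j + 1) ⟨by omega, j.2⟩
    have h3 : w (i + 1) = w (j + 1) := by omega
    have := w.injective h3
    ext; omega
  refine ⟨Equiv.ofBijective _ (Finite.injective_iff_bijective.1 hinj), ?_⟩
  ext k
  by_cases hk : k = 0 ∨ n < k
  · rw [h k hk, embedPerm_out _ hk]
  · have h1 := h.mem (i := k) (by omega)
    have : k = ((⟨k - 1, by omega⟩ : Fin n) : ℕ) + 1 := by simp; omega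
    conv_rhs => rw [this, embedPerm_fin]
    simp only [Equiv.ofBijective_apply]
    rw [show k - 1 + 1 = k by omega]
    omega

theorem embedPerm_injective {n : ℕ} : Function.Injective (embedPerm n) := by
  intro g h hgh
  ext i
  have := congrArg (fun w : Equiv.Perm ℕ => w ((i : ℕ) + 1)) hgh
  simp only [embedPerm_fin] at this
  omega

theorem forall_Icc {n : ℕ} {P : ℕ → Prop} :
    (∀ i ∈ Finset.Icc 1 n, P i) ↔ ∀ i : Fin n, P (i + 1) := by
  constructor
  · intro h i
    exact h _ (by rw [Finset.mem_Icc]; have := i.2; omega)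
  · intro h i hi
    rw [Finset.mem_Icc] at hi
    have := h ⟨i - 1, by omega⟩
    simpa [show i - 1 + 1 = i by omega] using this

theorem rowFinset_eq (n : ℕ) (T : Tab) : rowFinset n T = rowS (tT n T) := by
  ext τ
  have h : τ ∈ rowFinset n T ↔ ∀ i ∈ Finset.Icc 1 n, rowIdx T (embedPerm n τ i) = rowIdx T i :=
    (@Finset.mem_filter _ _ (fun _ => Classical.propDecidable _) _ _).trans
      (and_iff_right (Finset.mem_univ _))
  rw [mem_rowS]
  refine h.trans (forall_Icc.trans ?_)
  simp only [embedPerm_fin]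
  rfl

theorem colFinset_eq (n : ℕ) (T : Tab) : colFinset n T = colS (tT n T) := by
  ext τ
  have h : τ ∈ colFinset n T ↔ ∀ i ∈ Finset.Icc 1 n, colIdx T (embedPerm n τ i) = colIdx T i :=
    (@Finset.mem_filter _ _ (fun _ => Classical.propDecidable _) _ _).trans
      (and_iff_right (Finset.mem_univ _))
  rw [mem_colS]
  refine h.trans (forall_Icc.trans ?_)
  simp only [embedPerm_fin]
  rfl

/-! ### exponents -/

def ind (A : Finset ℕ) : ℕ →₀ ℕ := ∑ a ∈ A, Finsupp.single a 1

theorem ind_apply (A : Finset ℕ) (u : ℕ) : ind A u = if u ∈ A then 1 else 0 := by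
  simp [ind, Finsupp.single_apply]

theorem prod_X_eq (A : Finset ℕ) : (∏ i ∈ A, X i : MvPolynomial ℕ ℚ) = monomial (ind A) 1 := by
  rw [ind, monomial_sum_one]
  rfl

def Us (n : ℕ) (z : Equiv.Perm (Fin n)) (d : ℕ) : Finset ℕ :=
  (Finset.univ.filter fun k : Fin n => n ≤ d + z k).image fun k : Fin n => (k : ℕ) + 1

theorem mem_Us {n : ℕ} {z : Equiv.Perm (Fin n)} {d : ℕ} {k : Fin n} :
    (k : ℕ) + 1 ∈ Us n z d ↔ n ≤ d + z k := by
  simp only [Us, Finset.mem_image, Finset.mem_filter, Finset.mem_univ, true_and]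
  constructor
  · rintro ⟨j, hj, he⟩
    have : j = k := by ext; omega
    rwa [← this]
  · intro h; exact ⟨k, h, rfl⟩

theorem Us_sub {n : ℕ} {z : Equiv.Perm (Fin n)} {d : ℕ} : Us n z d ⊆ Finset.Icc 1 n := by
  intro u hu
  simp only [Us, Finset.mem_image, Finset.mem_filter, Finset.mem_univ, true_and] at hu
  obtain ⟨k, -, rfl⟩ := hu
  rw [Finset.mem_Icc]; have := k.2; omega

theorem Us_card {n : ℕ} (z : Equiv.Perm (Fin n)) {d : ℕ} (hd : d ≤ n) : (Us n z d).card = d := by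
  rw [Us, Finset.card_image_of_injective _ (fun i j h => by ext; simpa using h)]
  have : (Finset.univ.filter fun k : Fin n => n ≤ d + z k).card =
      (Finset.univ.filter fun k : Fin n => n ≤ d + k).card := by
    apply Finset.card_bij (fun k _ => z k)
    · intro a ha; simpa using ha
    · intro a _ b _ h; exact z.injective h
    · intro b hb; exact ⟨z.symm b, by simpa using hb, by simp⟩
  rw [this]
  have h2 : (Finset.univ.filter fun k : Fin n => n ≤ d + k).card = (Finset.Ico (n - d) n).card := by
    apply Finset.card_bij (fun (k : Fin n) _ => (k : ℕ))
    · intro a ha; simp at ha ⊢; omega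
    · intro a _ b _ h; ext; exact h
    · intro b hb; rw [Finset.mem_Ico] at hb; exact ⟨⟨b, hb.2⟩, by simp; omega, rfl⟩
  rw [h2, Nat.card_Ico]; omega

theorem Us_mono {n : ℕ} {z : Equiv.Perm (Fin n)} {d e : ℕ} (h : d ≤ e) : Us n z d ⊆ Us n z e := by
  rw [Us, Us]
  apply Finset.image_subset_image
  intro k hk
  simp at hk ⊢; omega

/-- exponent vector attached to `D` and a permutation -/
def xe (n : ℕ) (D : Finset ℕ) (z : Equiv.Perm (Fin n)) : ℕ →₀ ℕ := ∑ d ∈ D, ind (Us n z d)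

theorem xe_fin {n : ℕ} (D : Finset ℕ) (z : Equiv.Perm (Fin n)) (k : Fin n) :
    xe n D z (k + 1) = (D.filter fun d => n ≤ d + z k).card := by
  rw [xe, Finsupp.finsetSum_apply]
  simp only [ind_apply, mem_Us]
  rw [Finset.card_filter]

theorem xe_out {n : ℕ} (D : Finset ℕ) (z : Equiv.Perm (Fin n)) {k : ℕ} (hk : k = 0 ∨ n < k) :
    xe n D z k = 0 := by
  rw [xe, Finsupp.finsetSum_apply]
  apply Finset.sum_eq_zero
  intro d _
  rw [ind_apply, if_neg]
  intro h
  have := Us_sub h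
  rw [Finset.mem_Icc] at this; omega

theorem finsupp_ext_fin {n : ℕ} {a b : ℕ →₀ ℕ} (ha : ∀ k, k = 0 ∨ n < k → a k = 0)
    (hb : ∀ k, k = 0 ∨ n < k → b k = 0) (h : ∀ i : Fin n, a (i + 1) = b (i + 1)) : a = b := by
  ext k
  by_cases hk : k = 0 ∨ n < k
  · rw [ha k hk, hb k hk]
  · have := h ⟨k - 1, by omega⟩
    simpa [show k - 1 + 1 = k by omega] using this

theorem xe_perm {n : ℕ} (D : Finset ℕ) (z g : Equiv.Perm (Fin n)) :
    Finsupp.mapDomain (⇑(embedPerm n g)) (xe n D (z * g)) = xe n D z := by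
  have key : ∀ k, Finsupp.mapDomain (⇑(embedPerm n g)) (xe n D (z * g)) (embedPerm n g k)
      = xe n D (z * g) k := fun k => Finsupp.mapDomain_apply (embedPerm n g).injective _ _
  apply finsupp_ext_fin (n := n)
  · intro k hk
    have := key k
    rw [embedPerm_out g hk] at this
    rw [this, xe_out _ _ hk]
  · intro k hk; exact xe_out _ _ hk
  · intro i
    have := key ((g⁻¹ i : Fin n) + 1)
    rw [embedPerm_fin] at this
    have h2 : g (g⁻¹ i) = i := by simp
    rw [h2] at this
    rw [this, xe_fin, xe_fin, Equiv.Perm.mul_apply, h2]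

theorem sum_ind (U A : Finset ℕ) : ∑ u ∈ U, ind A u = (U ∩ A).card := by
  simp only [ind_apply]
  rw [← Finset.card_filter, Finset.filter_mem_eq_inter]

def Bdd (D : Finset ℕ) (p : MvPolynomial ℕ ℚ) : Prop :=
  ∀ m ∈ p.support, ∀ U : Finset ℕ, ∑ u ∈ U, m u ≤ ∑ d ∈ D, min d U.card

theorem sum_xe {n : ℕ} (D : Finset ℕ) (z : Equiv.Perm (Fin n)) (U : Finset ℕ) :
    ∑ u ∈ U, xe n D z u = ∑ d ∈ D, (U ∩ Us n z d).card := by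
  simp only [xe, Finsupp.finsetSum_apply]
  rw [Finset.sum_comm]
  exact Finset.sum_congr rfl fun d _ => sum_ind _ _

theorem Bdd_xe {n : ℕ} {D : Finset ℕ} (hD : ∀ d ∈ D, d ≤ n) (z : Equiv.Perm (Fin n)) (U : Finset ℕ) :
    ∑ u ∈ U, xe n D z u ≤ ∑ d ∈ D, min d U.card := by
  rw [sum_xe]
  apply Finset.sum_le_sum
  intro d hd
  apply le_min
  · exact (Finset.card_le_card Finset.inter_subset_right).trans (Us_card z (hD d hd)).le
  · exact Finset.card_le_card Finset.inter_subset_left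

theorem Bdd.add {D : Finset ℕ} {p q : MvPolynomial ℕ ℚ} (hp : Bdd D p) (hq : Bdd D q) :
    Bdd D (p + q) := by
  intro m hm U
  rcases Finset.mem_union.1 (MvPolynomial.support_add hm) with h | h
  · exact hp m h U
  · exact hq m h U

theorem Bdd.zero (D : Finset ℕ) : Bdd D 0 := by
  intro m hm; simp at hm

theorem Bdd.smul {D : Finset ℕ} {p : MvPolynomial ℕ ℚ} (c : ℚ) (hp : Bdd D p) :
    Bdd D (c • p) := fun m hm U => hp m (MvPolynomial.support_smul hm) U

theorem Bdd.sum {D : Finset ℕ} {ι : Type*} (F : Finset ι) (f : ι → MvPolynomial ℕ ℚ)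
    (h : ∀ i ∈ F, Bdd D (f i)) : Bdd D (∑ i ∈ F, f i) :=
  Finset.sum_induction _ _ (fun _ _ => Bdd.add) (Bdd.zero D) h

theorem Bdd.rename {D : Finset ℕ} {p : MvPolynomial ℕ ℚ} (w : Equiv.Perm ℕ) (hp : Bdd D p) :
    Bdd D (rename (⇑w) p) := by
  intro m hm U
  rw [MvPolynomial.support_rename_of_injective w.injective, Finset.mem_image] at hm
  obtain ⟨m', hm', rfl⟩ := hm
  have := hp m' hm' (U.map w.symm.toEmbedding)
  rw [Finset.sum_map, Finset.card_map] at this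
  refine le_trans (le_of_eq ?_) this
  apply Finset.sum_congr rfl
  intro u _
  have := Finsupp.mapDomain_apply w.injective m' (w.symm u)
  simpa using this

theorem Bdd.mul_esym {n : ℕ} {D : Finset ℕ} {p : MvPolynomial ℕ ℚ} {i : ℕ} (hi : i ∉ D)
    (hp : Bdd D p) : Bdd (insert i D) (p * esym n i) := by
  rw [esym, Finset.mul_sum]
  apply Bdd.sum
  intro A hA
  rw [Finset.mem_powersetCard] at hA
  rw [prod_X_eq]
  intro m hm U
  rw [mem_support_iff, coeff_mul_monomial'] at hm
  split_ifs at hm with hle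
  · rw [mul_one, ← mem_support_iff] at hm
    have h1 := hp _ hm U
    have h2 : m = (m - ind A) + ind A := (tsub_add_cancel_of_le hle).symm
    rw [h2]
    simp only [Finsupp.add_apply]
    rw [Finset.sum_add_distrib, Finset.sum_insert hi, sum_ind, add_comm]
    refine add_le_add (le_min ?_ (Finset.card_le_card Finset.inter_subset_left)) h1
    exact (Finset.card_le_card Finset.inter_subset_right).trans hA.2.le
  · exact absurd rfl hm

theorem coeff_mul_esym {n : ℕ} {D : Finset ℕ} {p : MvPolynomial ℕ ℚ} {i : ℕ} (hi : i ∉ D)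
    (hin : i ≤ n) (hD : ∀ d ∈ D, d ≤ n) (hp : Bdd D p) (z : Equiv.Perm (Fin n)) :
    coeff (xe n (insert i D) z) (p * esym n i) = coeff (xe n D z) p := by
  have hx : xe n (insert i D) z = xe n D z + ind (Us n z i) := by
    rw [xe, Finset.sum_insert hi, add_comm]; rfl
  rw [esym, Finset.mul_sum, coeff_sum, Finset.sum_eq_single (Us n z i)]
  · rw [prod_X_eq, hx, coeff_mul_monomial, mul_one]
  · intro A hA hne
    rw [Finset.mem_powersetCard] at hA
    rw [prod_X_eq, coeff_mul_monomial']
    split_ifs with hle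
    · rw [mul_one]
      by_contra hc
      rw [← ne_eq, ← mem_support_iff] at hc
      have h1 := hp _ hc (Us n z i)
      have h2 : ∑ u ∈ Us n z i, xe n (insert i D) z u =
          ∑ u ∈ Us n z i, (xe n (insert i D) z - ind A) u + ∑ u ∈ Us n z i, ind A u := by
        rw [← Finset.sum_add_distrib]
        apply Finset.sum_congr rfl
        intro u _
        rw [← Finsupp.add_apply, tsub_add_cancel_of_le hle]
      rw [sum_xe, Finset.sum_insert hi, sum_ind, Finset.inter_self] at h2
      have h3 : ∑ d ∈ D, (Us n z i ∩ Us n z d).card = ∑ d ∈ D, min d (Us n z i).card := by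
        apply Finset.sum_congr rfl
        intro d hd
        rw [Us_card z hin]
        rcases le_total i d with h | h
        · rw [Finset.inter_eq_left.2 (Us_mono h), Us_card z hin, min_eq_right h]
        · rw [Finset.inter_eq_right.2 (Us_mono h), Us_card z (hD d hd), min_eq_left h]
      rw [h3] at h2
      have h4 : (Us n z i).card ≤ (Us n z i ∩ A).card := by omega
      have h5 := Finset.eq_of_subset_of_card_le Finset.inter_subset_left h4
      have h6 : Us n z i ⊆ A := Finset.inter_eq_left.1 h5
      exact hne (Finset.eq_of_subset_of_card_le h6 (by rw [hA.2, Us_card z hin])).symm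
    · rfl
  · intro h
    exact absurd (Finset.mem_powersetCard.2 ⟨Us_sub, Us_card z hin⟩) h

theorem coeff_mul_prod_esym {n : ℕ} {D : Finset ℕ} {p : MvPolynomial ℕ ℚ}
    (hD : ∀ d ∈ D, d ≤ n) (hp : Bdd D p) (E : Finset ℕ) (hE : ∀ d ∈ E, d ≤ n) (hd : Disjoint E D) :
    Bdd (E ∪ D) (p * ∏ i ∈ E, esym n i) ∧
    ∀ z, coeff (xe n (E ∪ D) z) (p * ∏ i ∈ E, esym n i) = coeff (xe n D z) p := by
  induction E using Finset.induction_on with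
  | empty => simp [hp]
  | insert a E ha ih =>
    have hE' : ∀ d ∈ E, d ≤ n := fun d hd => hE d (Finset.mem_insert_of_mem hd)
    rw [Finset.disjoint_insert_left] at hd
    obtain ⟨h1, h2⟩ := ih hE' hd.2
    have h3 : a ∉ E ∪ D := by
      rw [Finset.mem_union]; tauto
    have h4 : ∀ d ∈ E ∪ D, d ≤ n := by
      intro d hd
      rcases Finset.mem_union.1 hd with h | h
      · exact hE' d h
      · exact hD d h
    rw [Finset.prod_insert ha, mul_comm (esym n a), ← mul_assoc, Finset.insert_union]
    refine ⟨h1.mul_esym h3, fun z => ?_⟩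
    rw [coeff_mul_esym h3 (hE a (Finset.mem_insert_self _ _)) h4 h1, h2]

/-! ### the coefficient map -/

def phi (n : ℕ) (D : Finset ℕ) : MvPolynomial ℕ ℚ →ₗ[ℚ] FG n where
  toFun p := fun z => coeff (xe n D z) p
  map_add' p q := by funext z; simp
  map_smul' c p := by funext z; simp

theorem phi_apply (n : ℕ) (D : Finset ℕ) (p : MvPolynomial ℕ ℚ) (z) :
    phi n D p z = coeff (xe n D z) p := rfl

theorem phi_rename {n : ℕ} (D : Finset ℕ) (g : Equiv.Perm (Fin n)) (p : MvPolynomial ℕ ℚ) :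
    phi n D (rename (⇑(embedPerm n g)) p) = actG g (phi n D p) := by
  funext z
  rw [phi_apply, actG_apply, phi_apply, ← xe_perm D z g,
    coeff_rename_mapDomain _ (embedPerm n g).injective]

def ee (n : ℕ) (T S : Tab) : ℕ →₀ ℕ :=
  ∑ i ∈ Finset.Icc 1 n, Finsupp.single i (ctEntry S (DsiSet n S) (posOf T i))

theorem pTS_eq (n : ℕ) (T S : Tab) : pTS n T S = monomial (ee n T S) 1 := by
  rw [pTS, ee, monomial_sum_one]
  apply Finset.prod_congr rfl
  intro i _
  rw [X_pow_eq_monomial]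

theorem ee_fin (n : ℕ) (T S : Tab) (i : Fin n) :
    ee n T S (i + 1) = cnt (DsiSet n S) (S (tT n T i)) := by
  rw [ee, Finsupp.finsetSum_apply]
  simp only [Finsupp.single_apply]
  rw [Finset.sum_ite_eq', if_pos]
  · rfl
  · rw [Finset.mem_Icc]; have := i.2; omega

theorem ee_out (n : ℕ) (T S : Tab) {k : ℕ} (hk : k = 0 ∨ n < k) : ee n T S k = 0 := by
  rw [ee, Finsupp.finsetSum_apply]
  simp only [Finsupp.single_apply]
  rw [Finset.sum_ite_eq', if_neg]
  rw [Finset.mem_Icc]; omega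

theorem xe_cnt {n : ℕ} (S : Tab) (z : Equiv.Perm (Fin n)) (k : Fin n) :
    xe n (Dsic n S) z (k + 1) = cnt (DsiSet n S) (z k + 1) := by
  rw [xe_fin, cnt]
  symm
  have hsub : ∀ j ∈ DsiSet n S, 0 < j ∧ j < n := by
    intro j hj
    exact Finset.mem_Ioo.1 (Finset.mem_filter.1 hj).1
  apply Finset.card_bij (fun j _ => n - j)
  · intro j hj
    rw [Finset.mem_filter] at hj ⊢
    have := hsub j hj.1
    exact ⟨Finset.mem_image_of_mem _ hj.1, by omega⟩
  · intro i hi j hj h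
    have h1 := hsub i (Finset.mem_filter.1 hi).1
    have h2 := hsub j (Finset.mem_filter.1 hj).1
    omega
  · intro d hd
    rw [Finset.mem_filter, Dsic, Finset.mem_image] at hd
    obtain ⟨⟨j, hj, rfl⟩, h⟩ := hd
    have := hsub j hj
    exact ⟨j, Finset.mem_filter.2 ⟨hj, by omega⟩, rfl⟩

theorem phi_pTS (n : ℕ) (T S : Tab) :
    phi n (Dsic n S) (pTS n T S) = iota (DsiSet n S) S (tT n T) := by
  funext z
  rw [phi_apply, pTS_eq, coeff_monomial, iota]
  congr 1
  apply propext
  constructor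
  · intro h i
    rw [← xe_cnt, ← h, ee_fin]
  · intro h
    apply finsupp_ext_fin (n := n)
    · intro k hk; exact ee_out _ _ _ hk
    · intro k hk; exact xe_out _ _ hk
    · intro i
      rw [ee_fin, xe_cnt, h]

theorem phi_FTS (n : ℕ) (T S : Tab) :
    phi n (Dsic n S) (FTS n T S) = ((sTS n T S : ℚ)⁻¹) • uvec (DsiSet n S) S (tT n T) := by
  rw [FTS, map_smul, epsAct]
  congr 1
  rw [uvec, opB, opA, map_sum, LinearMap.sum_apply, colFinset_eq]
  apply Finset.sum_congr rfl
  intro σ _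
  rw [map_sum, LinearMap.smul_apply, LinearMap.sum_apply, map_sum, Finset.smul_sum, rowFinset_eq]
  apply Finset.sum_congr rfl
  intro τ _
  rw [map_zsmul, embedPerm_mul, phi_rename, phi_pTS, actG_mul, Int.cast_smul_eq_zsmul]

theorem sTS_ne (n : ℕ) (T S : Tab) : (sTS n T S : ℚ) ≠ 0 := by
  rw [sTS, Nat.cast_ne_zero, Finset.card_ne_zero]
  refine ⟨1, Finset.mem_filter.2 ⟨?_, ?_⟩⟩
  · rw [rowFinset_eq]; exact rowS_one _
  · have : embedPerm n 1 = 1 := Equiv.Perm.extendDomain_one _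
    rw [this]
    simp

theorem Dsic_sub (n : ℕ) (S : Tab) : Dsic n S ⊆ Finset.Ioo 0 n := by
  intro d hd
  rw [Dsic, Finset.mem_image] at hd
  obtain ⟨j, hj, rfl⟩ := hd
  have := Finset.mem_Ioo.1 (Finset.mem_filter.1 hj).1
  rw [Finset.mem_Ioo]; omega

theorem ee_eq_xe {μ : YoungDiagram} {n : ℕ} (hn : μ.cells.card = n) {T S : Tab}
    (hT : IsFilling μ T) (hS : IsStandard μ S) : ∃ z, ee n T S = xe n (Dsic n S) z := by
  obtain ⟨z, -, hz⟩ := StdOn.perm (J := DsiSet n S) (hS.isStd hn)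
    (fun v => (IsFillingF.apply_tT hn hS.1 v).1) (hT.isFill hn)
  refine ⟨z, ?_⟩
  apply finsupp_ext_fin (n := n)
  · intro k hk; exact ee_out _ _ _ hk
  · intro k hk; exact xe_out _ _ hk
  · intro i
    rw [ee_fin, xe_cnt, hz]

theorem Bdd_FTS {μ : YoungDiagram} {n : ℕ} (hn : μ.cells.card = n) {T S : Tab}
    (hT : IsFilling μ T) (hS : IsStandard μ S) : Bdd (Dsic n S) (FTS n T S) := by
  rw [FTS, epsAct]
  apply Bdd.smul
  apply Bdd.sum
  intro σ _
  apply Bdd.sum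
  intro τ _
  rw [← Int.cast_smul_eq_zsmul ℚ]
  apply Bdd.smul
  apply Bdd.rename
  obtain ⟨z, hz⟩ := ee_eq_xe hn hT hS
  rw [pTS_eq, hz]
  intro m hm U
  rw [Finset.mem_singleton.1 (support_monomial_subset hm)]
  apply Bdd_xe
  intro d hd
  have := Finset.mem_Ioo.1 (Dsic_sub n S hd)
  omega

theorem phi_FTS_mul {μ : YoungDiagram} {n : ℕ} (hn : μ.cells.card = n) {T S : Tab}
    (hT : IsFilling μ T) (hS : IsStandard μ S) {I : Finset ℕ} (hI : I ⊆ Finset.Ioo 0 n)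
    (hD : Dsic n S ⊆ I) :
    phi n I (FTS n T S * ∏ i ∈ I \ Dsic n S, esym n i) =
      ((sTS n T S : ℚ)⁻¹) • uvec (DsiSet n S) S (tT n T) := by
  rw [← phi_FTS]
  funext z
  have hI' : ∀ d ∈ I, d ≤ n := fun d hd => (Finset.mem_Ioo.1 (hI hd)).2.le
  have := (coeff_mul_prod_esym (fun d hd => hI' d (hD hd)) (Bdd_FTS hn hT hS) (I \ Dsic n S)
    (fun d hd => hI' d (Finset.mem_sdiff.1 hd).1) Finset.sdiff_disjoint).2 z
  rwa [Finset.sdiff_union_of_subset hD] at this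

theorem eProd_hInd {n : ℕ} {I : Finset ℕ} (hI : I ⊆ Finset.Ioo 0 n) (S : Tab) :
    eProd n (hInd n I S) = ∏ i ∈ I \ Dsic n S, esym n i := by
  rw [eProd]
  have : I \ Dsic n S ⊆ Finset.Icc 1 n := by
    intro i hi
    have := Finset.mem_Ioo.1 (hI (Finset.mem_sdiff.1 hi).1)
    rw [Finset.mem_Icc]; omega
  rw [← Finset.prod_subset this]
  · apply Finset.prod_congr rfl
    intro i hi
    rw [hInd, if_pos hi, pow_one]
  · intro i _ hi
    rw [hInd, if_neg hi, pow_zero]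

/-! ### homogeneity -/

theorem esym_homog (n i : ℕ) : (esym n i).IsHomogeneous i := by
  rw [esym]
  apply IsHomogeneous.sum
  intro A hA
  have := IsHomogeneous.prod A (fun i => (X i : MvPolynomial ℕ ℚ)) (fun _ => 1)
    (fun i _ => isHomogeneous_X _ _)
  simpa [(Finset.mem_powersetCard.1 hA).2] using this

theorem FTS_homog {μ : YoungDiagram} {n : ℕ} (hn : μ.cells.card = n) {T S : Tab}
    (hT : IsFilling μ T) (hS : IsStandard μ S) :
    (FTS n T S).IsHomogeneous (∑ d ∈ Dsic n S, d) := by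
  have hp : (pTS n T S).IsHomogeneous (∑ d ∈ Dsic n S, d) := by
    obtain ⟨z, hz⟩ := ee_eq_xe hn hT hS
    rw [pTS_eq]
    apply isHomogeneous_monomial
    rw [hz, xe, map_sum]
    apply Finset.sum_congr rfl
    intro d hd
    rw [ind, map_sum]
    have := Finset.mem_Ioo.1 (Dsic_sub n S hd)
    simp [Us_card z this.2.le]
  rw [FTS, epsAct, smul_eq_C_mul]
  apply IsHomogeneous.C_mul
  apply IsHomogeneous.sum
  intro σ _
  apply IsHomogeneous.sum
  intro τ _
  rw [← Int.cast_smul_eq_zsmul ℚ, smul_eq_C_mul]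
  apply IsHomogeneous.C_mul
  exact hp.rename_isHomogeneous

theorem FTS_mul_homog {μ : YoungDiagram} {n : ℕ} (hn : μ.cells.card = n) {T S : Tab}
    (hT : IsFilling μ T) (hS : IsStandard μ S) {I : Finset ℕ} (hD : Dsic n S ⊆ I) :
    (FTS n T S * ∏ i ∈ I \ Dsic n S, esym n i).IsHomogeneous (∑ i ∈ I, i) := by
  have := (FTS_homog hn hT hS).mul (IsHomogeneous.prod (I \ Dsic n S) (fun i => esym n i)
    (fun i => i) (fun i _ => esym_homog n i))
  rwa [add_comm, Finset.sum_sdiff hD] at this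

/-! ### stability -/

theorem rename_pTS {n : ℕ} {T T' S : Tab} {g : Equiv.Perm (Fin n)} (h : tT n T' = tT n T ∘ ⇑g⁻¹) :
    rename (⇑(embedPerm n g)) (pTS n T S) = pTS n T' S := by
  rw [pTS_eq, pTS_eq, rename_monomial]
  congr 2
  have key : ∀ k, Finsupp.mapDomain (⇑(embedPerm n g)) (ee n T S) (embedPerm n g k)
      = ee n T S k := fun k => Finsupp.mapDomain_apply (embedPerm n g).injective _ _
  apply finsupp_ext_fin (n := n)
  · intro k hk
    have := key k
    rw [embedPerm_out g hk] at this
    rw [this, ee_out _ _ _ hk]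
  · intro k hk; exact ee_out _ _ _ hk
  · intro i
    have := key ((g⁻¹ i : Fin n) + 1)
    rw [embedPerm_fin] at this
    have h2 : g (g⁻¹ i) = i := by simp
    rw [h2] at this
    rw [this, ee_fin, ee_fin, h]
    rfl

theorem rename_epsAct {n : ℕ} {T T' S : Tab} {g : Equiv.Perm (Fin n)}
    (h : tT n T' = tT n T ∘ ⇑g⁻¹) :
    rename (⇑(embedPerm n g)) (epsAct n T (pTS n T S)) = epsAct n T' (pTS n T' S) := by
  rw [epsAct, epsAct, map_sum, colFinset_eq, colFinset_eq, rowFinset_eq, rowFinset_eq, h]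
  refine Finset.sum_bij' (fun π _ => g * π * g⁻¹) (fun π _ => g⁻¹ * π * g) ?_ ?_ ?_ ?_ ?_
  · intro π hπ; rw [colS_comp]; simpa [mul_assoc] using hπ
  · intro π hπ; rwa [colS_comp] at hπ
  · intro π _; simp [mul_assoc]
  · intro π _; simp [mul_assoc]
  · intro σ _
    rw [map_sum]
    refine Finset.sum_bij' (fun π _ => g * π * g⁻¹) (fun π _ => g⁻¹ * π * g) ?_ ?_ ?_ ?_ ?_
    · intro π hπ; rw [rowS_comp]; simpa [mul_assoc] using hπ
    · intro π hπ; rwa [rowS_comp] at hπ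
    · intro π _; simp [mul_assoc]
    · intro π _; simp [mul_assoc]
    · intro τ _
      have hs : Equiv.Perm.sign (g * σ * g⁻¹) = Equiv.Perm.sign σ := by
        rw [Equiv.Perm.sign_mul, Equiv.Perm.sign_mul, Equiv.Perm.sign_inv, mul_right_comm]
        simp
      rw [hs, map_zsmul, ← rename_pTS h, rename_rename, rename_rename]
      congr 3
      rw [← Equiv.Perm.coe_mul, ← Equiv.Perm.coe_mul]
      simp only [embedPerm_mul]
      congr 2
      simp [mul_assoc]

theorem rename_FTS_mem {μ : YoungDiagram} {n : ℕ} (hn : μ.cells.card = n) {T S : Tab}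
    (hT : IsFilling μ T) (g : Equiv.Perm (Fin n)) :
    rename (⇑(embedPerm n g)) (FTS n T S) ∈ VS n μ.cells S := by
  obtain ⟨T', hT', ht⟩ := IsFill.exists_filling hn ((hT.isFill hn).comp g⁻¹)
  rw [FTS, map_smul, rename_epsAct ht]
  have : epsAct n T' (pTS n T' S) = (sTS n T' S : ℚ) • FTS n T' S := by
    rw [FTS, smul_smul, mul_inv_cancel₀ (sTS_ne _ _ _), one_smul]
  rw [this]
  exact Submodule.smul_mem _ _ (Submodule.smul_mem _ _ (Submodule.subset_span ⟨T', hT', rfl⟩))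

theorem rename_esym {n : ℕ} (g : Equiv.Perm (Fin n)) (i : ℕ) :
    rename (⇑(embedPerm n g)) (esym n i) = esym n i := by
  have hmap : (Finset.Icc 1 n).map (embedPerm n g).toEmbedding = Finset.Icc 1 n := by
    apply Finset.eq_of_subset_of_card_le
    · intro k hk
      rw [Finset.mem_map] at hk
      obtain ⟨j, hj, rfl⟩ := hk
      rw [Finset.mem_Icc] at hj ⊢
      exact (suppIn_embedPerm g).mem hj
    · rw [Finset.card_map]
  rw [esym, map_sum]
  conv_rhs => rw [← hmap, Finset.powersetCard_map, Finset.sum_map]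
  apply Finset.sum_congr rfl
  intro A _
  rw [map_prod]
  simp [Finset.prod_map]

theorem rename_VSh {μ : YoungDiagram} {n : ℕ} (hn : μ.cells.card = n) {S : Tab} (h : ℕ → ℕ)
    (g : Equiv.Perm (Fin n)) {p : MvPolynomial ℕ ℚ} (hp : p ∈ VSh n μ.cells S h) :
    rename (⇑(embedPerm n g)) p ∈ VSh n μ.cells S h := by
  rw [VSh, polyMul, Submodule.mem_map] at hp ⊢
  obtain ⟨q, hq, rfl⟩ := hp
  refine ⟨rename (⇑(embedPerm n g)) q, ?_, ?_⟩
  · rw [VS] at hq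
    induction hq using Submodule.span_induction with
    | mem x hx =>
      obtain ⟨T, hT, rfl⟩ := hx
      exact rename_FTS_mem hn hT g
    | zero => simp
    | add x y _ _ hx hy => rw [map_add]; exact add_mem hx hy
    | smul c x _ hx => rw [map_smul]; exact Submodule.smul_mem _ _ hx
  · simp only [LinearMap.mulLeft_apply, map_mul]
    congr 1
    rw [eProd, map_prod]
    simp only [map_pow, rename_esym]

/-- every element of `V^S_h` has coefficients in `VV`, is determined by them, and is homogeneous -/
theorem VSh_spec {μ : YoungDiagram} {n : ℕ} (hn : μ.cells.card = n) {S : Tab}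
    (hS : IsStandard μ S) {I : Finset ℕ} (hI : I ⊆ Finset.Ioo 0 n)
    (hD : Dsic n S ⊆ I) {p : MvPolynomial ℕ ℚ} (hp : p ∈ VSh n μ.cells S (hInd n I S)) :
    phi n I p ∈ VV n μ (DsiSet n S) S ∧ p.IsHomogeneous (∑ i ∈ I, i) := by
  rw [VSh, polyMul, Submodule.mem_map] at hp
  obtain ⟨q, hq, rfl⟩ := hp
  rw [LinearMap.mulLeft_apply, eProd_hInd hI, mul_comm]
  rw [VS] at hq
  induction hq using Submodule.span_induction with
  | mem x hx =>
    obtain ⟨T, hT, rfl⟩ := hx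
    refine ⟨?_, FTS_mul_homog hn hT hS hD⟩
    rw [phi_FTS_mul hn hT hS hI hD]
    exact Submodule.smul_mem _ _ (Submodule.subset_span ⟨_, IsFilling.isFill hn hT, rfl⟩)
  | zero => simp [isHomogeneous_zero]
  | add x y _ _ hx hy =>
    rw [add_mul, map_add]; exact ⟨add_mem hx.1 hy.1, hx.2.add hy.2⟩
  | smul c x _ hx =>
    rw [smul_mul_assoc, map_smul, smul_eq_C_mul]
    exact ⟨Submodule.smul_mem _ _ hx.1, hx.2.C_mul _⟩

def XS (n : ℕ) (D : Finset ℕ) (p : MvPolynomial ℕ ℚ) : Prop := ∀ m ∈ p.support, ∃ z, m = xe n D z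

theorem XS.add {n : ℕ} {D : Finset ℕ} {p q : MvPolynomial ℕ ℚ} (hp : XS n D p) (hq : XS n D q) :
    XS n D (p + q) := by
  intro m hm
  rcases Finset.mem_union.1 (MvPolynomial.support_add hm) with h | h
  · exact hp m h
  · exact hq m h

theorem XS.zero (n : ℕ) (D : Finset ℕ) : XS n D 0 := by
  intro m hm; simp at hm

theorem XS.smul {n : ℕ} {D : Finset ℕ} {p : MvPolynomial ℕ ℚ} (c : ℚ) (hp : XS n D p) :
    XS n D (c • p) := fun m hm => hp m (MvPolynomial.support_smul hm)

theorem XS.sum {n : ℕ} {D : Finset ℕ} {ι : Type*} (F : Finset ι) (f : ι → MvPolynomial ℕ ℚ)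
    (h : ∀ i ∈ F, XS n D (f i)) : XS n D (∑ i ∈ F, f i) :=
  Finset.sum_induction _ _ (fun _ _ => XS.add) (XS.zero n D) h

theorem XS_FTS {μ : YoungDiagram} {n : ℕ} (hn : μ.cells.card = n) {T S : Tab}
    (hT : IsFilling μ T) (hS : IsStandard μ S) : XS n (Dsic n S) (FTS n T S) := by
  rw [FTS, epsAct]
  apply XS.smul
  apply XS.sum
  intro σ _
  apply XS.sum
  intro τ _
  rw [← Int.cast_smul_eq_zsmul ℚ]
  apply XS.smul
  obtain ⟨z, hz⟩ := ee_eq_xe hn hT hS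
  rw [pTS_eq, hz, embedPerm_mul, rename_monomial]
  intro m hm
  rw [Finset.mem_singleton.1 (support_monomial_subset hm)]
  refine ⟨z * (σ * τ)⁻¹, ?_⟩
  have := xe_perm (Dsic n S) (z * (σ * τ)⁻¹) (σ * τ)
  rwa [inv_mul_cancel_right] at this

theorem VSh_inj {μ : YoungDiagram} {n : ℕ} (hn : μ.cells.card = n) {S : Tab}
    (hS : IsStandard μ S) {I : Finset ℕ} (hI : I ⊆ Finset.Ioo 0 n)
    (hD : Dsic n S ⊆ I) {p : MvPolynomial ℕ ℚ} (hp : p ∈ VSh n μ.cells S (hInd n I S))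
    (h0 : phi n I p = 0) : p = 0 := by
  rw [VSh, polyMul, Submodule.mem_map] at hp
  obtain ⟨q, hq, rfl⟩ := hp
  rw [LinearMap.mulLeft_apply, eProd_hInd hI, mul_comm] at h0 ⊢
  have key : XS n (Dsic n S) q ∧ phi n I (q * ∏ i ∈ I \ Dsic n S, esym n i) =
      phi n (Dsic n S) q := by
    clear h0
    rw [VS] at hq
    induction hq using Submodule.span_induction with
    | mem x hx =>
      obtain ⟨T, hT, rfl⟩ := hx
      exact ⟨XS_FTS hn hT hS, by rw [phi_FTS_mul hn hT hS hI hD, phi_FTS]⟩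
    | zero => exact ⟨XS.zero _ _, by simp⟩
    | add x y _ _ hx hy =>
      rw [add_mul, map_add, map_add, hx.2, hy.2]; exact ⟨hx.1.add hy.1, rfl⟩
    | smul c x _ hx =>
      rw [smul_mul_assoc, map_smul, map_smul, hx.2]
      exact ⟨hx.1.smul _, rfl⟩
  have : q = 0 := by
    rw [← MvPolynomial.support_eq_empty]
    by_contra hne
    obtain ⟨m, hm⟩ := Finset.nonempty_iff_ne_empty.2 hne
    obtain ⟨z, rfl⟩ := key.1 m hm
    rw [key.2] at h0
    exact (mem_support_iff.1 hm) (congrFun h0 z)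
  rw [this, zero_mul]

/-! ### Robinson–Schensted insertion -/

def ridx (x : ℕ) : List ℕ → ℕ
  | [] => 0
  | y :: ys => if x < y then 0 else ridx x ys + 1

def rIns (x : ℕ) (r : List ℕ) : List ℕ := (rowInsert x r).1

theorem ridx_le (x : ℕ) (r : List ℕ) : ridx x r ≤ r.length := by
  induction r with
  | nil => simp [ridx]
  | cons y ys ih =>
    simp only [ridx, List.length_cons]
    split_ifs <;> omega

theorem ridx_lt (x : ℕ) (r : List ℕ) (j : ℕ) (hj : j < ridx x r) : r.getD j 0 ≤ x := by
  induction r generalizing j with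
  | nil => simp [ridx] at hj
  | cons y ys ih =>
    simp only [ridx] at hj
    split_ifs at hj with h
    · omega
    · cases j with
      | zero => simp; omega
      | succ j => simpa using ih j (by omega)

theorem ridx_get (x : ℕ) (r : List ℕ) (h : ridx x r < r.length) : x < r.getD (ridx x r) 0 := by
  induction r with
  | nil => simp at h
  | cons y ys ih =>
    simp only [ridx] at h ⊢
    split_ifs at h ⊢ with h1
    · simpa using h1
    · simpa using ih (by simpa using h)

theorem rIns_length (x : ℕ) (r : List ℕ) : (rIns x r).length = max r.length (ridx x r + 1) := by
  induction r with
  | nil => simp [rIns, rowInsert, ridx]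
  | cons y ys ih =>
    simp only [rIns, rowInsert, ridx] at ih ⊢
    split_ifs with h1
    · simp
    · simp [ih]

theorem rIns_getD (x : ℕ) (r : List ℕ) (j : ℕ) :
    (rIns x r).getD j 0 = if j = ridx x r then x else r.getD j 0 := by
  induction r generalizing j with
  | nil => cases j <;> simp [rIns, rowInsert, ridx]
  | cons y ys ih =>
    simp only [rIns, rowInsert, ridx] at ih ⊢
    split_ifs with h1 h2 h2
    · subst h2; simp
    · cases j with
      | zero => simp at h2
      | succ j => simp
    · subst h2; simpa using ih (ridx x ys)
    · cases j with
      | zero => simp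
      | succ j => simpa [show j ≠ ridx x ys by omega] using ih j

theorem rowInsert_snd (x : ℕ) (r : List ℕ) : (rowInsert x r).2 =
    if ridx x r < r.length then some (r.getD (ridx x r) 0) else none := by
  induction r with
  | nil => simp [rowInsert, ridx]
  | cons y ys ih =>
    simp only [rowInsert, ridx] at ih ⊢
    split_ifs with h1 h2 h2 h2
    · simp
    · simp at h2
    · simp only [List.length_cons, add_lt_add_iff_right] at h2
      simp [ih, h2]
    · simp only [List.length_cons, add_lt_add_iff_right] at h2
      simp [ih, h2]

theorem tabInsert_cons (r : List ℕ) (rs : List (List ℕ)) (x : ℕ) :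
    tabInsert (r :: rs) x = rIns x r ::
      (if ridx x r < r.length then tabInsert rs (r.getD (ridx x r) 0) else rs) := by
  have h := rowInsert_snd x r
  rw [tabInsert]
  rcases hp : rowInsert x r with ⟨r', o⟩
  rw [hp] at h
  simp only at h
  split_ifs at h ⊢ with h1
  · subst h; simp [rIns, hp]
  · subst h; simp [rIns, hp]

def newCell : List (List ℕ) → ℕ → ℕ × ℕ
  | [], _ => (0, 0)
  | r :: rs, x => if ridx x r < r.length then
      ((newCell rs (r.getD (ridx x r) 0)).1 + 1, (newCell rs (r.getD (ridx x r) 0)).2)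
    else (0, r.length)

def RowOK (r : List ℕ) : Prop := (∀ j < r.length, 0 < r.getD j 0) ∧
  ∀ i j, i ≤ j → j < r.length → r.getD i 0 ≤ r.getD j 0

def Dom (r s : List ℕ) : Prop := s.length ≤ r.length ∧ ∀ j < s.length, r.getD j 0 < s.getD j 0

def Good : List (List ℕ) → Prop
  | [] => True
  | r :: rs => r ≠ [] ∧ RowOK r ∧ Dom r (rs.headD []) ∧ Good rs

theorem rIns_rowOK {x : ℕ} (hx : 0 < x) {r : List ℕ} (h : RowOK r) : RowOK (rIns x r) := by
  have h1 := ridx_le x r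
  have h2 := ridx_lt x r
  have h3 := ridx_get x r
  refine ⟨fun j hj => ?_, fun i j hij hj => ?_⟩
  · rw [rIns_length] at hj
    rw [rIns_getD]
    split_ifs with h4
    · exact hx
    · exact h.1 j (by omega)
  · rw [rIns_length] at hj
    rw [rIns_getD, rIns_getD]
    split_ifs with h4 h5 h5
    · exact le_rfl
    · have := h3 (by omega)
      have := h.2 (ridx x r) j (by omega) (by omega)
      omega
    · exact h2 i (by omega)
    · exact h.2 i j hij (by omega)

theorem rIns_ne (x : ℕ) (r : List ℕ) : rIns x r ≠ [] := by
  intro h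
  have := rIns_length x r
  rw [h, List.length_nil] at this
  omega

theorem Dom.ins {x : ℕ} {r s : List ℕ} (h : Dom r s) (hk : ridx x r < r.length) :
    Dom (rIns x r) (rIns (r.getD (ridx x r) 0) s) := by
  have h1 := ridx_le x r
  have h2 := ridx_lt x r
  have h3 := ridx_get x r hk
  set y := r.getD (ridx x r) 0 with hy
  set k := ridx x r with hk'
  have g1 := ridx_le y s
  have g2 := ridx_lt y s
  have g3 := ridx_get y s
  set l := ridx y s with hl
  have hlk : l ≤ k := by
    by_contra hc
    have := g2 k (by omega)
    have := h.2 k (by omega)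
    omega
  refine ⟨?_, fun j hj => ?_⟩
  · rw [rIns_length, rIns_length]
    have := h.1
    omega
  · rw [rIns_length, ← hl] at hj
    rw [rIns_getD, rIns_getD, ← hk', ← hl]
    split_ifs with h4 h5 h5
    · exact h3
    · have := h.2 j (by omega)
      rw [h4] at this ⊢
      omega
    · have := h2 j (by omega)
      omega
    · exact h.2 j (by omega)

theorem Dom.ins_left {x : ℕ} {r s : List ℕ} (h : Dom r s) (hk : ¬ ridx x r < r.length) :
    Dom (rIns x r) s := by
  refine ⟨?_, fun j hj => ?_⟩
  · rw [rIns_length]; have := h.1; omega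
  · rw [rIns_getD, if_neg]
    · exact h.2 j hj
    · have := h.1; omega

theorem tabInsert_headD (t : List (List ℕ)) (y : ℕ) :
    (tabInsert t y).headD [] = rIns y (t.headD []) := by
  cases t with
  | nil => simp [tabInsert, rIns, rowInsert]
  | cons r rs => simp [tabInsert_cons]

theorem Good.tabInsert {t : List (List ℕ)} (h : Good t) {x : ℕ} (hx : 0 < x) :
    Good (tabInsert t x) := by
  induction t generalizing x with
  | nil =>
    rw [HigherSpecht.tabInsert, Good]
    refine ⟨by simp, ⟨?_, ?_⟩, ?_, trivial⟩
    · intro j hj; simp at hj; subst hj; simpa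
    · intro i j hij hj; simp at hj; subst hj; simp at hij; subst hij; simp
    · exact ⟨by simp, by simp⟩
  | cons r rs ih =>
    obtain ⟨h1, h2, h3, h4⟩ := h
    rw [tabInsert_cons, Good]
    refine ⟨rIns_ne x r, rIns_rowOK hx h2, ?_, ?_⟩
    · split_ifs with hk
      · rw [tabInsert_headD]; exact h3.ins hk
      · exact h3.ins_left hk
    · split_ifs with hk
      · exact ih h4 (h2.1 _ hk)
      · exact h4

theorem listEntry_cons_zero (r : List ℕ) (rs : List (List ℕ)) (j : ℕ) :
    listEntry (r :: rs) (0, j) = r.getD j 0 := rfl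

theorem listEntry_cons_succ (r : List ℕ) (rs : List (List ℕ)) (i j : ℕ) :
    listEntry (r :: rs) (i + 1, j) = listEntry rs (i, j) := by
  simp [listEntry]

theorem listEntry_nil (c : ℕ × ℕ) : listEntry [] c = 0 := by
  simp [listEntry]

theorem RowOK.ne_zero {r : List ℕ} (h : RowOK r) (j : ℕ) : r.getD j 0 ≠ 0 ↔ j < r.length := by
  constructor
  · intro h1
    by_contra h2
    exact h1 (List.getD_eq_default _ _ (by omega))
  · intro h1
    have := h.1 j h1
    omega

/-- the support grows by the new cell -/
theorem supp_tabInsert {t : List (List ℕ)} (h : Good t) {x : ℕ} (hx : 0 < x) (c : ℕ × ℕ) :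
    listEntry (tabInsert t x) c ≠ 0 ↔ listEntry t c ≠ 0 ∨ c = newCell t x := by
  induction t generalizing x c with
  | nil =>
    obtain ⟨i, j⟩ := c
    rw [tabInsert, newCell, listEntry_nil]
    cases i with
    | zero =>
      cases j with
      | zero => simp [listEntry]; omega
      | succ j => simp [listEntry]
    | succ i => simp [listEntry]
  | cons r rs ih =>
    obtain ⟨h1, h2, h3, h4⟩ := h
    obtain ⟨i, j⟩ := c
    rw [tabInsert_cons, newCell]
    have g1 := ridx_le x r
    cases i with
    | zero =>
      rw [listEntry_cons_zero, listEntry_cons_zero, (rIns_rowOK hx h2).ne_zero, h2.ne_zero, rIns_length]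
      split_ifs with hk
      · simp; omega
      · simp; omega
    | succ i =>
      rw [listEntry_cons_succ, listEntry_cons_succ]
      split_ifs with hk
      · rw [ih h4 (h2.1 _ hk)]
        simp [Prod.ext_iff]
      · simp

theorem newCell_not {t : List (List ℕ)} (x : ℕ) : listEntry t (newCell t x) = 0 := by
  induction t generalizing x with
  | nil => exact listEntry_nil _
  | cons r rs ih =>
    rw [newCell]
    split_ifs with hk
    · rw [listEntry_cons_succ]; exact ih _
    · rw [listEntry_cons_zero]; simp

/-- values -/
theorem vals_tabInsert {t : List (List ℕ)} (h : Good t) {x : ℕ} (hx : 0 < x) (v : ℕ) (hv : v ≠ 0) :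
    (∃ c, listEntry (tabInsert t x) c = v) ↔ v = x ∨ ∃ c, listEntry t c = v := by
  induction t generalizing x with
  | nil =>
    rw [tabInsert]
    constructor
    · rintro ⟨⟨i, j⟩, hc⟩
      left
      cases i with
      | zero =>
        cases j with
        | zero => simpa [listEntry] using hc.symm
        | succ j => simp [listEntry] at hc; omega
      | succ i => simp [listEntry] at hc; omega
    · rintro (rfl | ⟨c, hc⟩)
      · exact ⟨(0, 0), rfl⟩
      · rw [listEntry_nil] at hc; omega
  | cons r rs ih =>
    obtain ⟨h1, h2, h3, h4⟩ := h
    rw [tabInsert_cons]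
    have g1 := ridx_le x r
    constructor
    · rintro ⟨⟨i, j⟩, hc⟩
      cases i with
      | zero =>
        rw [listEntry_cons_zero, rIns_getD] at hc
        split_ifs at hc with h5
        · exact Or.inl hc.symm
        · exact Or.inr ⟨(0, j), hc⟩
      | succ i =>
        rw [listEntry_cons_succ] at hc
        split_ifs at hc with hk
        · rcases (ih h4 (h2.1 _ hk)).1 ⟨_, hc⟩ with h6 | ⟨⟨i', j'⟩, h6⟩
          · exact Or.inr ⟨(0, ridx x r), h6.symm⟩
          · exact Or.inr ⟨(i' + 1, j'), by rw [listEntry_cons_succ]; exact h6⟩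
        · exact Or.inr ⟨(i + 1, j), by rw [listEntry_cons_succ]; exact hc⟩
    · rintro (rfl | ⟨⟨i, j⟩, hc⟩)
      · exact ⟨(0, ridx v r), by rw [listEntry_cons_zero, rIns_getD, if_pos rfl]⟩
      · cases i with
        | zero =>
          rw [listEntry_cons_zero] at hc
          by_cases hj : j = ridx x r
          · have hk : ridx x r < r.length := by
              rw [← hj, ← h2.ne_zero, hc]; exact hv
            rw [if_pos hk]
            obtain ⟨⟨i', j'⟩, h6⟩ := (ih h4 (h2.1 _ hk)).2 (Or.inl (by rw [← hj, hc]))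
            exact ⟨(i' + 1, j'), by rw [listEntry_cons_succ]; exact h6⟩
          · exact ⟨(0, j), by rw [listEntry_cons_zero, rIns_getD, if_neg hj]; exact hc⟩
        | succ i =>
          rw [listEntry_cons_succ] at hc
          split_ifs with hk
          · obtain ⟨⟨i', j'⟩, h6⟩ := (ih h4 (h2.1 _ hk)).2 (Or.inr ⟨_, hc⟩)
            exact ⟨(i' + 1, j'), by rw [listEntry_cons_succ]; exact h6⟩
          · exact ⟨(i + 1, j), by rw [listEntry_cons_succ]; exact hc⟩

/-- row bumping, weak -/
theorem bump_le {t : List (List ℕ)} (h : Good t) {x x' : ℕ} (hxx : x ≤ x') :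
    (newCell (tabInsert t x) x').1 ≤ (newCell t x).1 := by
  induction t generalizing x x' with
  | nil =>
    simp [tabInsert, newCell, ridx, hxx]
  | cons r rs ih =>
    obtain ⟨h1, h2, h3, h4⟩ := h
    rw [tabInsert_cons]
    have g1 := ridx_le x r
    have g2 := ridx_lt x r
    have g3 := ridx_get x r
    have e1 := ridx_le x' (rIns x r)
    have e3 := ridx_get x' (rIns x r)
    have hlt : ridx x r < ridx x' (rIns x r) := by
      by_contra hc
      have := e3 (by rw [rIns_length]; omega)
      rw [rIns_getD] at this
      split_ifs at this with h5
      · omega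
      · have := g2 (ridx x' (rIns x r)) (by omega); omega
    rw [newCell, newCell]
    rw [rIns_length] at *
    by_cases hk : ridx x r < r.length
    · rw [if_pos hk, if_pos hk]
      split_ifs with hk2
      · simp only [add_le_add_iff_right]
        apply ih h4
        rw [rIns_getD, if_neg (by omega)]
        exact h2.2 _ _ hlt.le (by omega)
      · exact Nat.zero_le _
    · rw [if_neg (by omega)]; exact Nat.zero_le _

theorem bump_lt {t : List (List ℕ)} (h : Good t) {x x' : ℕ} (hxx : x' < x) :
    (newCell t x).1 < (newCell (tabInsert t x) x').1 := by
  induction t generalizing x x' with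
  | nil =>
    simp [tabInsert, newCell, ridx, hxx]
  | cons r rs ih =>
    obtain ⟨h1, h2, h3, h4⟩ := h
    rw [tabInsert_cons]
    have g1 := ridx_le x r
    have g2 := ridx_lt x r
    have g3 := ridx_get x r
    have e1 := ridx_le x' (rIns x r)
    have e2 := ridx_lt x' (rIns x r)
    have hle : ridx x' (rIns x r) ≤ ridx x r := by
      by_contra hc
      have := e2 (ridx x r) (by omega)
      rw [rIns_getD, if_pos rfl] at this
      omega
    rw [newCell, newCell]
    rw [rIns_length] at *
    rw [if_pos (show ridx x' (rIns x r) < max r.length (ridx x r + 1) by omega)]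
    by_cases hk : ridx x r < r.length
    · rw [if_pos hk, if_pos hk]
      simp only [add_lt_add_iff_right]
      apply ih h4
      have := g3 hk
      rw [rIns_getD]
      split_ifs with h5
      · exact this
      · have := g2 (ridx x' (rIns x r)) (by omega); omega
    · rw [if_neg hk]; exact Nat.succ_pos _

/-- injectivity -/
theorem row_ext {r s : List ℕ} (hl : r.length = s.length) (h : ∀ j, r.getD j 0 = s.getD j 0) :
    r = s := by
  apply List.ext_getElem hl
  intro j h1 h2
  have := h j
  rwa [List.getD_eq_getElem _ _ h1, List.getD_eq_getElem _ _ h2] at this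

theorem tabInsert_inj {t u : List (List ℕ)} (ht : Good t) (hu : Good u) {x y : ℕ}
    (h : tabInsert t x = tabInsert u y) (hc : newCell t x = newCell u y) : t = u ∧ x = y := by
  induction t generalizing u x y with
  | nil =>
    cases u with
    | nil => simpa [tabInsert] using h
    | cons s ss =>
      exfalso
      rw [newCell, newCell] at hc
      split_ifs at hc with h1
      · simp at hc
      · simp only [Prod.mk.injEq, true_and] at hc
        exact hu.1 (List.length_eq_zero_iff.1 hc.symm)
  | cons r rs ih =>
    obtain ⟨h1, h2, h3, h4⟩ := ht
    cases u with
    | nil =>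
      exfalso
      rw [newCell, newCell] at hc
      split_ifs at hc with h5
      · simp at hc
      · simp only [Prod.mk.injEq, true_and] at hc
        exact h1 (List.length_eq_zero_iff.1 hc)
    | cons s ss =>
      obtain ⟨u1, u2, u3, u4⟩ := hu
      rw [tabInsert_cons, tabInsert_cons, List.cons.injEq] at h
      rw [newCell, newCell] at hc
      have hlen : (rIns x r).length = (rIns y s).length := by rw [h.1]
      have hget : ∀ j, (rIns x r).getD j 0 = (rIns y s).getD j 0 := by rw [h.1]; simp
      rw [rIns_length, rIns_length] at hlen
      simp only [rIns_getD] at hget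
      have a1 := ridx_le x r
      have b1 := ridx_le y s
      have a3 := ridx_get x r
      have b3 := ridx_get y s
      split_ifs at hc with hk hl hl
      · rw [if_pos hk, if_pos hl] at h
        have hcc : newCell rs (r.getD (ridx x r) 0) = newCell ss (s.getD (ridx y s) 0) := by
          simp only [Prod.mk.injEq, add_left_inj] at hc
          exact Prod.ext hc.1 hc.2
        obtain ⟨i1, i2⟩ := ih h4 u4 h.2 hcc
        have a3 := a3 hk
        have b3 := b3 hl
        have hkl : ridx x r = ridx y s := by
          rcases lt_trichotomy (ridx x r) (ridx y s) with hlt | heq | hgt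
          · exfalso
            have e := hget (ridx y s)
            rw [if_neg (by omega), if_pos rfl] at e
            have := h2.2 (ridx x r) (ridx y s) hlt.le (by omega)
            omega
          · exact heq
          · exfalso
            have e := hget (ridx x r)
            rw [if_pos rfl, if_neg (by omega)] at e
            have := u2.2 (ridx y s) (ridx x r) hgt.le (by omega)
            omega
        have hxy : x = y := by
          have e := hget (ridx x r)
          rwa [if_pos rfl, if_pos hkl] at e
        refine ⟨?_, hxy⟩
        rw [i1]
        congr 1
        apply row_ext (by omega)
        intro j
        by_cases hj : j = ridx x r
        · subst hj
          rw [i2, hkl]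
        · have e := hget j
          rwa [if_neg hj, if_neg (by omega)] at e
      · simp at hc
      · simp at hc
      · rw [if_neg hk, if_neg hl] at h
        simp only [Prod.mk.injEq, true_and] at hc
        have hxy : x = y := by
          have e := hget (ridx x r)
          rwa [if_pos rfl, if_pos (by omega)] at e
        refine ⟨?_, hxy⟩
        rw [h.2]
        congr 1
        apply row_ext hc
        intro j
        by_cases hj : j = r.length
        · rw [List.getD_eq_default _ _ (by omega), List.getD_eq_default _ _ (by omega)]
        · have e := hget j
          rwa [if_neg (by omega), if_neg (by omega)] at e

theorem Good.ext {t u : List (List ℕ)} (ht : Good t) (hu : Good u)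
    (h : ∀ c, listEntry t c = listEntry u c) : t = u := by
  induction t generalizing u with
  | nil =>
    cases u with
    | nil => rfl
    | cons s ss =>
      exfalso
      have := h (0, 0)
      rw [listEntry_nil, listEntry_cons_zero] at this
      have h2 := hu.2.1.1 0 (List.length_pos_iff.2 hu.1)
      omega
  | cons r rs ih =>
    cases u with
    | nil =>
      exfalso
      have := h (0, 0)
      rw [listEntry_nil, listEntry_cons_zero] at this
      have h2 := ht.2.1.1 0 (List.length_pos_iff.2 ht.1)
      omega
    | cons s ss =>
      have e1 : rs = ss := ih ht.2.2.2 hu.2.2.2 (fun c => by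
        have := h (c.1 + 1, c.2)
        rwa [listEntry_cons_succ, listEntry_cons_succ] at this)
      have e2 : ∀ j, r.getD j 0 = s.getD j 0 := fun j => h (0, j)
      have e3 : r.length = s.length := by
        have k1 := ht.2.1.ne_zero
        have k2 := hu.2.1.ne_zero
        by_contra hne
        rcases lt_or_gt_of_ne hne with hlt | hlt
        · have := (k2 r.length).2 hlt
          rw [← e2] at this
          exact absurd ((k1 _).1 this) (by omega)
        · have := (k1 s.length).2 hlt
          rw [e2] at this
          exact absurd ((k2 _).1 this) (by omega)
      rw [e1, row_ext e3 e2]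

/-- entries of a good tableau -/
theorem Good.col {t : List (List ℕ)} (h : Good t) (i j : ℕ) (hc : listEntry t (i + 1, j) ≠ 0) :
    listEntry t (i, j) ≠ 0 ∧ listEntry t (i, j) < listEntry t (i + 1, j) := by
  induction t generalizing i with
  | nil => exact absurd (listEntry_nil _) hc
  | cons r rs ih =>
    obtain ⟨h1, h2, h3, h4⟩ := h
    rw [listEntry_cons_succ] at hc ⊢
    cases i with
    | zero =>
      rw [listEntry_cons_zero]
      cases rs with
      | nil => exact absurd (listEntry_nil _) hc
      | cons s ss =>
        rw [listEntry_cons_zero] at hc ⊢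
        have h5 := (h4.2.1.ne_zero j).1 hc
        have h6 := h3.2 j h5
        have h7 := h3.1
        simp only [List.headD_cons] at h6 h7
        exact ⟨(h2.ne_zero j).2 (by omega), h6⟩
    | succ i =>
      rw [listEntry_cons_succ]
      exact ih h4 i hc

theorem Good.row {t : List (List ℕ)} (h : Good t) (i j : ℕ) (hc : listEntry t (i, j + 1) ≠ 0) :
    listEntry t (i, j) ≠ 0 ∧ listEntry t (i, j) ≤ listEntry t (i, j + 1) := by
  induction t generalizing i with
  | nil => exact absurd (listEntry_nil _) hc
  | cons r rs ih =>
    obtain ⟨h1, h2, h3, h4⟩ := h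
    cases i with
    | zero =>
      rw [listEntry_cons_zero] at hc ⊢
      have h5 := (h2.ne_zero _).1 hc
      exact ⟨(h2.ne_zero _).2 (by omega), h2.2 _ _ (by omega) h5⟩
    | succ i =>
      rw [listEntry_cons_succ] at hc ⊢
      rw [listEntry_cons_succ]
      exact ih h4 i hc

theorem Good.mono {t : List (List ℕ)} (h : Good t) {c c' : ℕ × ℕ} (h1 : c.1 ≤ c'.1) (h2 : c.2 ≤ c'.2)
    (hc : listEntry t c' ≠ 0) : listEntry t c ≠ 0 ∧ listEntry t c ≤ listEntry t c' := by
  obtain ⟨a, b⟩ := c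
  obtain ⟨a', b'⟩ := c'
  simp only at h1 h2
  obtain ⟨d, rfl⟩ := Nat.exists_eq_add_of_le h1
  obtain ⟨e, rfl⟩ := Nat.exists_eq_add_of_le h2
  clear h1 h2
  induction d with
  | zero =>
    induction e with
    | zero => exact ⟨hc, le_rfl⟩
    | succ e ih =>
      have := h.row _ _ hc
      have h3 := ih this.1
      exact ⟨h3.1, h3.2.trans this.2⟩
  | succ d ih =>
    have := h.col _ _ hc
    have h3 := ih this.1
    exact ⟨h3.1, h3.2.trans this.2.le⟩

theorem PP_zero (n : ℕ) (w : Equiv.Perm ℕ) : PtabListPart n w 0 = [] := by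
  simp [PtabListPart]

theorem PP_succ {n : ℕ} (w : Equiv.Perm ℕ) {m : ℕ} (hm : m < n) :
    PtabListPart n w (m + 1) = tabInsert (PtabListPart n w m) (w (m + 1)) := by
  have hl : m < (oneLine n w).length := by simpa [oneLine] using hm
  rw [PtabListPart, PtabListPart, ← List.take_concat_get' _ _ hl, List.foldl_append]
  simp [oneLine]

theorem PP_ge {n : ℕ} (w : Equiv.Perm ℕ) {m : ℕ} (hm : n ≤ m) :
    PtabListPart n w m = PtabListPart n w n := by
  have hl : (oneLine n w).length = n := by simp [oneLine]
  rw [PtabListPart, PtabListPart, List.take_of_length_le (by omega), List.take_of_length_le (by omega)]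

theorem PP_good {n : ℕ} {w : Equiv.Perm ℕ} (hw : SuppIn n w) {m : ℕ} (hm : m ≤ n) :
    Good (PtabListPart n w m) := by
  induction m with
  | zero => rw [PP_zero]; trivial
  | succ m ih =>
    rw [PP_succ w (by omega)]
    exact (ih (by omega)).tabInsert (by have := hw.mem (i := m + 1) (by omega); omega)

/-- the cell added at step `m + 1` -/
def cc (n : ℕ) (w : Equiv.Perm ℕ) (m : ℕ) : ℕ × ℕ := newCell (PtabListPart n w m) (w (m + 1))

theorem PP_supp {n : ℕ} {w : Equiv.Perm ℕ} (hw : SuppIn n w) {m : ℕ} (hm : m ≤ n) (c : ℕ × ℕ) :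
    listEntry (PtabListPart n w m) c ≠ 0 ↔ ∃ k < m, c = cc n w k := by
  induction m with
  | zero => rw [PP_zero, listEntry_nil]; simp
  | succ m ih =>
    rw [PP_succ w (by omega), supp_tabInsert (PP_good hw (by omega))
      (by have := hw.mem (i := m + 1) (by omega); omega), ih (by omega)]
    constructor
    · rintro (⟨k, hk, h⟩ | h)
      · exact ⟨k, by omega, h⟩
      · exact ⟨m, by omega, h⟩
    · rintro ⟨k, hk, h⟩
      by_cases hkm : k = m
      · right; rw [h, hkm]; rfl
      · exact Or.inl ⟨k, by omega, h⟩

theorem PP_vals {n : ℕ} {w : Equiv.Perm ℕ} (hw : SuppIn n w) {m : ℕ} (hm : m ≤ n) (v : ℕ)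
    (hv : v ≠ 0) : (∃ c, listEntry (PtabListPart n w m) c = v) ↔ ∃ k < m, v = w (k + 1) := by
  induction m with
  | zero =>
    rw [PP_zero]; simp only [listEntry_nil]
    simp [hv.symm]
  | succ m ih =>
    rw [PP_succ w (by omega), vals_tabInsert (PP_good hw (by omega))
      (by have := hw.mem (i := m + 1) (by omega); omega) v hv, ih (by omega)]
    constructor
    · rintro (h | ⟨k, hk, h⟩)
      · exact ⟨m, by omega, h⟩
      · exact ⟨k, by omega, h⟩
    · rintro ⟨k, hk, h⟩
      by_cases hkm : k = m
      · left; rw [h, hkm]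
      · exact Or.inr ⟨k, by omega, h⟩

theorem cc_inj {n : ℕ} {w : Equiv.Perm ℕ} (hw : SuppIn n w) {k l : ℕ} (hk : k < n) (hl : l < n)
    (h : cc n w k = cc n w l) : k = l := by
  have key : ∀ a b, a < b → b < n → cc n w a ≠ cc n w b := by
    intro a b hab hb he
    have := (PP_supp hw hb.le (cc n w a)).2 ⟨a, hab, rfl⟩
    rw [he] at this
    exact this (newCell_not _)
  rcases lt_trichotomy k l with h1 | h1 | h1
  · exact absurd h (key _ _ h1 hl)
  · exact h1
  · exact absurd h.symm (key _ _ h1 hk)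

/-- the common shape -/
def RSshape (n : ℕ) (w : Equiv.Perm ℕ) (hw : SuppIn n w) : YoungDiagram where
  cells := (Finset.range n).image (cc n w)
  isLowerSet := by
    intro a b hab ha
    simp only [Finset.coe_image, Set.mem_image, Finset.coe_range, Set.mem_Iio] at ha ⊢
    obtain ⟨k, hk, rfl⟩ := ha
    have h1 := (PP_supp hw le_rfl (cc n w k)).2 ⟨k, hk, rfl⟩
    have h2 := ((PP_good hw le_rfl).mono (c := b) hab.1 hab.2 h1).1
    obtain ⟨l, hl, h3⟩ := (PP_supp hw le_rfl b).1 h2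
    exact ⟨l, hl, h3.symm⟩

theorem mem_RSshape {n : ℕ} {w : Equiv.Perm ℕ} (hw : SuppIn n w) (c : ℕ × ℕ) :
    c ∈ (RSshape n w hw).cells ↔ ∃ k < n, c = cc n w k := by
  simp only [RSshape, Finset.mem_image, Finset.mem_range]
  constructor <;> rintro ⟨k, hk, h⟩ <;> exact ⟨k, hk, h.symm⟩

theorem RSshape_card {n : ℕ} {w : Equiv.Perm ℕ} (hw : SuppIn n w) :
    (RSshape n w hw).cells.card = n := by
  have : (RSshape n w hw).cells = (Finset.range n).image (cc n w) := rfl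
  rw [this, Finset.card_image_of_injOn, Finset.card_range]
  intro a ha b hb h
  simp at ha hb
  exact cc_inj hw ha hb h

theorem Ptab_std {n : ℕ} {w : Equiv.Perm ℕ} (hw : SuppIn n w) :
    IsStandard (RSshape n w hw) (Ptab n w) := by
  have hsupp : ∀ c, Ptab n w c ≠ 0 ↔ c ∈ (RSshape n w hw).cells := by
    intro c
    rw [mem_RSshape, Ptab, PP_supp hw le_rfl]
  have hmaps : Set.MapsTo (Ptab n w) ↑(RSshape n w hw).cells ↑(Finset.Icc 1 n) := by
    intro c hc
    have h0 := (hsupp c).2 hc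
    obtain ⟨k, hk, h⟩ := (PP_vals hw le_rfl _ h0).1 ⟨c, rfl⟩
    rw [h, Finset.mem_coe, Finset.mem_Icc]
    exact hw.mem (by omega)
  have hsurj : Set.SurjOn (Ptab n w) ↑(RSshape n w hw).cells ↑(Finset.Icc 1 n) := by
    intro v hv
    rw [Finset.mem_coe, Finset.mem_Icc] at hv
    obtain ⟨g, hg⟩ := hw.exists_embed
    have h1 : ∃ k < n, v = w (k + 1) := by
      obtain ⟨u, rfl⟩ := w.surjective v
      have : 1 ≤ u ∧ u ≤ n := by
        by_contra hc
        have := hw u (by omega)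
        omega
      exact ⟨u - 1, by omega, by rw [show u - 1 + 1 = u by omega]⟩
    obtain ⟨c, hc⟩ := (PP_vals hw le_rfl v (by omega)).2 h1
    refine ⟨c, ?_, hc⟩
    rw [Finset.mem_coe, ← hsupp]
    intro h0
    have : Ptab n w c = v := hc
    omega
  have hinj := Finset.injOn_of_surjOn_of_card_le (Ptab n w) hmaps hsurj
    (by rw [RSshape_card, Nat.card_Icc]; omega)
  refine ⟨⟨fun c hc => ?_, ?_⟩, ?_⟩
  · by_contra h0
    exact hc ((hsupp c).1 h0)
  · rw [RSshape_card, ← Finset.coe_Icc]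
    exact ⟨hmaps, hinj, hsurj⟩
  · intro c1 h1 c2 h2 hne ha hb
    have := ((PP_good hw le_rfl).mono ha hb ((hsupp c2).2 h2)).2
    refine lt_of_le_of_ne this fun he => hne (hinj h1 h2 he)

theorem Qtab_cc {n : ℕ} {w : Equiv.Perm ℕ} (hw : SuppIn n w) {k : ℕ} (hk : k < n) :
    Qtab n w (cc n w k) = k + 1 := by
  have : {m | listEntry (PtabListPart n w m) (cc n w k) ≠ 0} = Set.Ici (k + 1) := by
    ext m
    simp only [Set.mem_ofPred_eq, Set.mem_Ici]
    rcases le_total m n with hm | hm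
    · rw [PP_supp hw hm]
      constructor
      · rintro ⟨l, hl, h⟩
        have := cc_inj hw hk (by omega) h
        omega
      · intro h; exact ⟨k, by omega, rfl⟩
    · rw [PP_ge w hm, PP_supp hw le_rfl]
      constructor
      · intro _; omega
      · intro _; exact ⟨k, hk, rfl⟩
  rw [Qtab, this, csInf_Ici]

theorem Qtab_out {n : ℕ} {w : Equiv.Perm ℕ} (hw : SuppIn n w) {c : ℕ × ℕ}
    (hc : c ∉ (RSshape n w hw).cells) : Qtab n w c = 0 := by
  have : {m | listEntry (PtabListPart n w m) c ≠ 0} = ∅ := by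
    ext m
    simp only [Set.mem_ofPred_eq, Set.mem_empty_iff_false, iff_false, not_not]
    by_contra h
    apply hc
    rw [mem_RSshape]
    rcases le_total m n with hm | hm
    · obtain ⟨l, hl, h⟩ := (PP_supp hw hm c).1 h
      exact ⟨l, by omega, h⟩
    · rw [PP_ge w hm] at h
      exact (PP_supp hw le_rfl c).1 h
  rw [Qtab, this, Nat.sInf_empty]

theorem Qtab_std {n : ℕ} {w : Equiv.Perm ℕ} (hw : SuppIn n w) :
    IsStandard (RSshape n w hw) (Qtab n w) := by
  refine ⟨⟨fun c hc => Qtab_out hw hc, ?_, ?_, ?_⟩, ?_⟩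
  · intro c hc
    obtain ⟨k, hk, rfl⟩ := (mem_RSshape hw c).1 hc
    rw [Qtab_cc hw hk, RSshape_card, Set.mem_Icc]; omega
  · intro c hc d hd h
    obtain ⟨k, hk, rfl⟩ := (mem_RSshape hw c).1 hc
    obtain ⟨l, hl, rfl⟩ := (mem_RSshape hw d).1 hd
    rw [Qtab_cc hw hk, Qtab_cc hw hl] at h
    rw [show k = l by omega]
  · intro v hv
    rw [RSshape_card, Set.mem_Icc] at hv
    exact ⟨cc n w (v - 1), (mem_RSshape hw _).2 ⟨v - 1, by omega, rfl⟩, by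
      rw [Qtab_cc hw (by omega)]; omega⟩
  · intro c hc d hd hne ha hb
    obtain ⟨k, hk, rfl⟩ := (mem_RSshape hw c).1 hc
    obtain ⟨l, hl, rfl⟩ := (mem_RSshape hw d).1 hd
    rw [Qtab_cc hw hk, Qtab_cc hw hl]
    have h1 := (PP_supp hw (show l + 1 ≤ n by omega) (cc n w l)).2 ⟨l, by omega, rfl⟩
    have h2 := ((PP_good hw (show l + 1 ≤ n by omega)).mono ha hb h1).1
    obtain ⟨k', hk', h3⟩ := (PP_supp hw (show l + 1 ≤ n by omega) _).1 h2
    have h4 := cc_inj hw hk (by omega) h3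
    have h5 : k ≠ l := fun h => hne (by rw [h])
    omega

theorem Qtab_des {n : ℕ} {w : Equiv.Perm ℕ} (hw : SuppIn n w) :
    DsiSet n (Qtab n w) = DslSet n w := by
  have hrow : ∀ k < n, rowIdx (Qtab n w) (k + 1) = (cc n w k).1 := by
    intro k hk
    rw [← Qtab_cc hw hk]
    exact rowIdx_of_unique ((Qtab_std hw).1.unique ((mem_RSshape hw _).2 ⟨k, hk, rfl⟩))
  rw [DsiSet, DslSet]
  apply Finset.filter_congr
  intro i hi
  rw [Finset.mem_Ioo] at hi
  obtain ⟨k, rfl⟩ : ∃ k, i = k + 1 := ⟨i - 1, by omega⟩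
  rw [hrow k (by omega), hrow (k + 1) (by omega), cc, cc, PP_succ w (show k < n by omega)]
  constructor
  · intro h
    by_contra hc
    have := bump_le (PP_good hw (show k ≤ n by omega)) (not_lt.1 hc)
    omega
  · intro h
    exact bump_lt (PP_good hw (show k ≤ n by omega)) h

theorem RS_inj {n : ℕ} {w w' : Equiv.Perm ℕ} (hw : SuppIn n w) (hw' : SuppIn n w')
    (hP : Ptab n w = Ptab n w') (hQ : Qtab n w = Qtab n w') : w = w' := by
  have hcc : ∀ k < n, cc n w k = cc n w' k := by
    intro k hk
    have h1 := Qtab_cc hw hk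
    have h2 := Qtab_cc hw' hk
    rw [hQ] at h1
    apply (Qtab_std hw').1.unique ((mem_RSshape hw' _).2 ⟨k, hk, rfl⟩)
    rw [h1, h2]
  have hPn : PtabListPart n w n = PtabListPart n w' n :=
    (PP_good hw le_rfl).ext (PP_good hw' le_rfl) (fun c => congrFun hP c)
  have key : ∀ d ≤ n, PtabListPart n w (n - d) = PtabListPart n w' (n - d) ∧
      ∀ k < n, n - d ≤ k → w (k + 1) = w' (k + 1) := by
    intro d
    induction d with
    | zero => intro _; exact ⟨by simpa using hPn, fun k hk hk' => by omega⟩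
    | succ d ih =>
      intro hd
      obtain ⟨h1, h2⟩ := ih (by omega)
      have e : n - d = (n - (d + 1)) + 1 := by omega
      rw [e, PP_succ w (by omega), PP_succ w' (by omega)] at h1
      have h3 := tabInsert_inj (PP_good hw (by omega)) (PP_good hw' (by omega)) h1
        (hcc (n - (d + 1)) (by omega))
      refine ⟨h3.1, fun k hk hk' => ?_⟩
      by_cases hkd : k = n - (d + 1)
      · rw [hkd]; exact h3.2
      · exact h2 k hk (by omega)
  ext k
  by_cases hk : k = 0 ∨ n < k
  · rw [hw k hk, hw' k hk]
  · have := (key n le_rfl).2 (k - 1) (by omega) (by omega)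
    rwa [show k - 1 + 1 = k by omega] at this

/-! ### Evacuation -/

/-- One slide step on pairs (tableau, hole). -/
def sf (x : Tab × (ℕ × ℕ)) : Tab × (ℕ × ℕ) := slideOnce x.1 x.2

theorem upd_swap {T : Tab} {c d : ℕ × ℕ} (h : T c = 0) (hne : c ≠ d) :
    Function.update (Function.update T c (T d)) d 0 = T ∘ Equiv.swap c d := by
  funext e
  by_cases h1 : e = d
  · subst h1; simp [h]
  · by_cases h2 : e = c
    · subst h2; simp [h1]
    · simp [h1, h2, Equiv.swap_apply_of_ne_of_ne h2 h1]

theorem sf_cases (T : Tab) (a b : ℕ) (h : T (a, b) = 0) :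
    (T (a, b + 1) = 0 ∧ T (a + 1, b) = 0 ∧ sf (T, (a, b)) = (T, (a, b))) ∨
    (T (a, b + 1) ≠ 0 ∧ (T (a + 1, b) = 0 ∨ T (a, b + 1) < T (a + 1, b)) ∧
      sf (T, (a, b)) = (T ∘ Equiv.swap (a, b) (a, b + 1), (a, b + 1))) ∨
    (T (a + 1, b) ≠ 0 ∧ (T (a, b + 1) = 0 ∨ T (a + 1, b) ≤ T (a, b + 1)) ∧
      sf (T, (a, b)) = (T ∘ Equiv.swap (a, b) (a + 1, b), (a + 1, b))) := by
  unfold sf slideOnce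
  have e1 := upd_swap (d := (a, b + 1)) h (by simp)
  have e2 := upd_swap (d := (a + 1, b)) h (by simp)
  simp only [e1, e2]
  by_cases h1 : T (a, b + 1) = 0 <;> by_cases h2 : T (a + 1, b) = 0
  · simp [h1, h2]
  · simp [h1, h2]
  · simp [h1, h2]
  · by_cases h3 : T (a, b + 1) < T (a + 1, b)
    · simp [h1, h2, h3]
    · simp [h1, h2, h3]; omega

/-- Intermediate states of a slide. -/
structure HS (μ : YoungDiagram) (T : Tab) (c : ℕ × ℕ) : Prop where
  mem : c ∈ μ
  supp : ∀ d, T d ≠ 0 ↔ d ∈ μ ∧ d ≠ c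
  inj : ∀ d d', T d ≠ 0 → T d = T d' → d = d'
  ord : ∀ d d', T d ≠ 0 → T d' ≠ 0 → d.1 ≤ d'.1 → d.2 ≤ d'.2 → T d ≤ T d'
  rng : ∀ d, T d ≠ 0 → 1 < T d ∧ T d ≤ μ.cells.card

theorem HS.hole {μ : YoungDiagram} {T : Tab} {c : ℕ × ℕ} (h : HS μ T c) : T c = 0 := by
  by_contra h0
  exact ((h.supp c).1 h0).2 rfl

theorem HS.lt {μ : YoungDiagram} {T : Tab} {c : ℕ × ℕ} (h : HS μ T c) {d d' : ℕ × ℕ}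
    (h1 : T d ≠ 0) (h2 : T d' ≠ 0) (h3 : d.1 ≤ d'.1) (h4 : d.2 ≤ d'.2) (h5 : d ≠ d') : T d < T d' :=
  lt_of_le_of_ne (h.ord d d' h1 h2 h3 h4) fun e => h5 (h.inj d d' h1 e)

theorem mem_of_le {μ : YoungDiagram} {d e : ℕ × ℕ} (h : e ∈ μ) (h1 : d.1 ≤ e.1) (h2 : d.2 ≤ e.2) :
    d ∈ μ := μ.up_left_mem h1 h2 h

theorem HS.move {μ : YoungDiagram} {T : Tab} {c c' : ℕ × ℕ} (h : HS μ T c) (h1 : c.1 ≤ c'.1)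
    (h2 : c.2 ≤ c'.2) (h3 : T c' ≠ 0)
    (hmin : ∀ e, T e ≠ 0 → c.1 ≤ e.1 → c.2 ≤ e.2 → T c' ≤ T e) :
    HS μ (T ∘ Equiv.swap c c') c' := by
  have hc' := (h.supp c').1 h3
  have key : ∀ e, (T ∘ Equiv.swap c c') e = if e = c then T c' else if e = c' then 0 else T e := by
    intro e
    simp only [Function.comp]
    split_ifs with h5 h6
    · subst h5; simp
    · subst h6; simp [h.hole]
    · rw [Equiv.swap_apply_of_ne_of_ne h5 h6]
  refine ⟨hc'.1, ?_, ?_, ?_, ?_⟩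
  · intro d
    rw [key]
    have := h.supp d
    split_ifs with h5 h6
    · subst h5; simp [h3, h.mem, Ne.symm hc'.2]
    · simp [h6]
    · rw [this]; simp [h5, h6]
  · intro d d' hd e
    have := h.inj _ _ hd e
    exact (Equiv.swap c c').injective this
  · intro d d' hd hd' l1 l2
    rw [key] at hd hd' ⊢
    rw [key]
    by_cases a1 : d = c
    · subst a1
      by_cases a2 : d' = d
      · simp [a2]
      · by_cases a3 : d' = c'
        · simp [a2, a3] at hd'
          exact absurd hd' (by subst a3; simp [a2] at *)
        · simp only [a2, a3, if_true, if_false] at hd' ⊢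
          exact hmin d' hd' l1 l2
    · by_cases a0 : d = c'
      · simp [a0, hc'.2] at hd
      · simp only [a0, a1, if_false] at hd ⊢
        by_cases a2 : d' = c
        · subst a2
          simp only [if_true]
          exact h.ord _ _ hd h3 (l1.trans h1) (l2.trans h2)
        · by_cases a3 : d' = c'
          · subst a3; simp [a2] at hd'
          · simp only [a2, a3, if_false] at hd' ⊢
            exact h.ord _ _ hd hd' l1 l2
  · intro d hd
    exact h.rng _ hd

/-- The three cases with their minimality. -/
theorem HS.sf {μ : YoungDiagram} {T : Tab} {c : ℕ × ℕ} (h : HS μ T c) :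
    HS μ (sf (T, c)).1 (sf (T, c)).2 := by
  obtain ⟨a, b⟩ := c
  have key : ∀ e : ℕ × ℕ, T e ≠ 0 → a ≤ e.1 → b ≤ e.2 →
      (T (a, b + 1) ≠ 0 ∧ T (a, b + 1) ≤ T e) ∨ (T (a + 1, b) ≠ 0 ∧ T (a + 1, b) ≤ T e) := by
    rintro ⟨e1, e2⟩ he h1 h2
    have hm := (h.supp _).1 he
    simp only at h1 h2
    by_cases hb : b + 1 ≤ e2
    · left
      have : T (a, b + 1) ≠ 0 := (h.supp _).2 ⟨mem_of_le hm.1 h1 hb, by simp⟩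
      exact ⟨this, h.ord _ _ this he h1 hb⟩
    · right
      have hb' : e2 = b := by omega
      subst hb'
      have ha : a + 1 ≤ e1 := by
        rcases Nat.lt_or_ge a e1 with q | q
        · exact q
        · exact absurd (by simp; omega : (e1, e2) = (a, e2)) hm.2
      have : T (a + 1, e2) ≠ 0 := (h.supp _).2 ⟨mem_of_le hm.1 ha le_rfl, by simp⟩
      exact ⟨this, h.ord _ _ this he ha le_rfl⟩
  rcases sf_cases T a b h.hole with ⟨-, -, e⟩ | ⟨h1, h2, e⟩ | ⟨h1, h2, e⟩
  · rw [e]; exact h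
  · rw [e]
    refine h.move le_rfl (by simp) h1 ?_
    intro e he l1 l2
    rcases key e he l1 l2 with q | q <;> omega
  · rw [e]
    refine h.move (by simp) le_rfl h1 ?_
    intro e he l1 l2
    rcases key e he l1 l2 with q | q <;> omega

theorem HS.iter {μ : YoungDiagram} (k : ℕ) {x : Tab × (ℕ × ℕ)} (h : HS μ x.1 x.2) :
    HS μ (HigherSpecht.sf^[k] x).1 (HigherSpecht.sf^[k] x).2 := by
  induction k generalizing x with
  | zero => exact h
  | succ k ih =>
    rw [Function.iterate_succ_apply]
    exact ih (HS.sf h)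

theorem slide_eq (k : ℕ) : ∀ (T : Tab) (c : ℕ × ℕ), T c = 0 → slide k T c = sf^[k] (T, c) := by
  induction k with
  | zero => intro T c _; rfl
  | succ k ih =>
    rintro T ⟨a, b⟩ h
    rw [Function.iterate_succ_apply]
    have e0 : slideOnce T (a, b) = sf (T, (a, b)) := rfl
    simp only [slide, e0]
    rcases sf_cases T a b h with ⟨-, -, e⟩ | ⟨h1, h2, e⟩ | ⟨h1, h2, e⟩
    · rw [e]
      simp only [if_true]
      rw [Function.iterate_fixed e]
    · rw [e]; simp only [Prod.mk.injEq, true_and, Nat.add_eq_left, one_ne_zero, if_false]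
      exact ih _ _ (by simp [h])
    · rw [e]; simp only [Prod.mk.injEq, and_true, Nat.add_eq_left, one_ne_zero, if_false]
      exact ih _ _ (by simp [h])

/-- coordinate sum of the hole -/
def hsum (x : Tab × (ℕ × ℕ)) : ℕ := x.2.1 + x.2.2

theorem hsum_sf {x : Tab × (ℕ × ℕ)} (h : x.1 x.2 = 0) :
    (sf x = x ∧ x.1 (x.2.1, x.2.2 + 1) = 0 ∧ x.1 (x.2.1 + 1, x.2.2) = 0) ∨ hsum (sf x) = hsum x + 1 := by
  obtain ⟨T, a, b⟩ := x
  rcases sf_cases T a b h with ⟨q1, q2, e⟩ | ⟨h1, h2, e⟩ | ⟨h1, h2, e⟩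
  · exact Or.inl ⟨e, q1, q2⟩
  · right; rw [e]; simp [hsum]; omega
  · right; rw [e]; simp [hsum]; omega

theorem hsum_lt {μ : YoungDiagram} {c : ℕ × ℕ} (h : c ∈ μ) : c.1 + c.2 < μ.cells.card := by
  have : ((Finset.range (c.1 + 1)).image (fun i => (i, 0)) ∪
      (Finset.range (c.2)).image (fun j => (c.1, j + 1))) ⊆ μ.cells := by
    intro e he
    simp only [Finset.mem_union, Finset.mem_image, Finset.mem_range] at he
    rcases he with ⟨i, hi, rfl⟩ | ⟨i, hi, rfl⟩
    · exact mem_of_le h (by simp; omega) (by simp)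
    · exact mem_of_le h (by simp) (by simp; omega)
  have h2 := Finset.card_le_card this
  rw [Finset.card_union_of_disjoint, Finset.card_image_of_injective _ (fun a b e => by simpa using e),
    Finset.card_image_of_injective _ (fun a b e => by simpa using e), Finset.card_range,
    Finset.card_range] at h2
  · omega
  · rw [Finset.disjoint_left]
    intro e he he'
    simp only [Finset.mem_image, Finset.mem_range] at he he'
    obtain ⟨i, hi, rfl⟩ := he
    obtain ⟨j, hj, e⟩ := he'
    simp at e

/-- With enough fuel the slide ends. -/
theorem iter_end {μ : YoungDiagram} (k : ℕ) : ∀ {x : Tab × (ℕ × ℕ)} (_ : HS μ x.1 x.2),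
    μ.cells.card ≤ k + hsum x → sf (sf^[k] x) = sf^[k] x ∧
      (sf^[k] x).1 ((sf^[k] x).2.1, (sf^[k] x).2.2 + 1) = 0 ∧
      (sf^[k] x).1 ((sf^[k] x).2.1 + 1, (sf^[k] x).2.2) = 0 := by
  induction k with
  | zero =>
    intro x h hk
    have := hsum_lt h.mem
    simp only [hsum] at hk
    omega
  | succ k ih =>
    intro x h hk
    rw [Function.iterate_succ_apply]
    rcases hsum_sf h.hole with ⟨q, q'⟩ | q
    · rw [q, Function.iterate_fixed q]
      exact ⟨q, q'⟩
    · exact ih h.sf (by omega)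

/-- inner corners -/
def IsEnd (μ : YoungDiagram) (v : ℕ × ℕ) : Prop :=
  v ∈ μ ∧ ∀ d ∈ μ, v.1 ≤ d.1 → v.2 ≤ d.2 → d = v

theorem HS.isEnd {μ : YoungDiagram} {T : Tab} {c : ℕ × ℕ} (h : HS μ T c) (h1 : T (c.1, c.2 + 1) = 0)
    (h2 : T (c.1 + 1, c.2) = 0) : IsEnd μ c := by
  refine ⟨h.mem, ?_⟩
  rintro ⟨d1, d2⟩ hd l1 l2
  by_contra hne
  simp only at l1 l2
  by_cases hb : c.2 + 1 ≤ d2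
  · exact (h.supp (c.1, c.2 + 1)).2 ⟨mem_of_le hd l1 hb, by intro e; simpa using congrArg Prod.snd e⟩ h1
  · have ha : c.1 + 1 ≤ d1 := by
      by_contra hh
      exact hne (Prod.ext (by simp; omega) (by simp; omega))
    exact (h.supp (c.1 + 1, c.2)).2 ⟨mem_of_le hd ha l2, by intro e; simpa using congrArg Prod.fst e⟩ h2

/-- Reverse determinism. -/
theorem sf_inj {μ : YoungDiagram} {x y : Tab × (ℕ × ℕ)} (hx : HS μ x.1 x.2) (hy : HS μ y.1 y.2)
    (hs : hsum x = hsum y) (e : sf x = sf y) : x = y := by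
  have comm : ∀ {T U : Tab} {c : ℕ × ℕ} {d}, T ∘ Equiv.swap c d = U ∘ Equiv.swap c d → T = U := by
    intro T U c d h
    funext z
    have := congrFun h (Equiv.swap c d z)
    simpa using this
  have aux : ∀ {T U : Tab} {a b a' b'}, HS μ T (a, b) → HS μ U (a', b') →
      T (a, b + 1) ≠ 0 → U (a' + 1, b') ≠ 0 →
      (T ∘ Equiv.swap (a, b) (a, b + 1), ((a, b + 1) : ℕ × ℕ)) =
        (U ∘ Equiv.swap (a', b') (a' + 1, b'), ((a' + 1, b') : ℕ × ℕ)) → False := by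
    intro T U a b a' b' hT hU h1 h2 e
    simp only [Prod.mk.injEq] at e
    obtain ⟨e, rfl, rfl⟩ := e
    have m1 := ((hT.supp _).1 h1).1
    have m2 := ((hU.supp _).1 h2).1
    have n1 : T (a', b + 1) ≠ 0 := (hT.supp _).2 ⟨mem_of_le m1 (by simp) (by simp), by simp⟩
    have n2 : U (a' + 1, b) ≠ 0 := (hU.supp _).2 ⟨mem_of_le m2 (by simp) (by simp), by simp⟩
    have l1 := hT.lt n1 h1 (by simp) (by simp) (by simp)
    have l2 := hU.lt n2 h2 (by simp) (by simp) (by simp)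
    have c1 := congrFun e (a', b + 1)
    have c2 := congrFun e (a' + 1, b)
    simp only [Function.comp, Equiv.swap_apply_left] at c1 c2
    rw [Equiv.swap_apply_of_ne_of_ne (by simp) (by simp)] at c1 c2
    omega
  have hfx := hsum_sf hx.hole
  have hfy := hsum_sf hy.hole
  rcases hfx with ⟨q, -⟩ | q
  · rcases hfy with ⟨q', -⟩ | q'
    · rw [← q, e, q']
    · rw [← e, q] at q'; omega
  · rcases hfy with ⟨q', -⟩ | q'
    · rw [e, q'] at q; omega
    · obtain ⟨T, a, b⟩ := x
      obtain ⟨U, a', b'⟩ := y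
      rcases sf_cases T a b hx.hole with ⟨-, -, f⟩ | ⟨h1, h2, f⟩ | ⟨h1, h2, f⟩
      · rw [f] at q; omega
      · rcases sf_cases U a' b' hy.hole with ⟨-, -, g⟩ | ⟨h1', h2', g⟩ | ⟨h1', h2', g⟩
        · rw [g] at q'; omega
        · rw [f, g] at e
          simp only [Prod.mk.injEq, Nat.add_right_cancel_iff] at e
          obtain ⟨e, rfl, rfl⟩ := e
          rw [comm e]
        · rw [f, g] at e
          exact (aux hx hy h1 h1' e).elim
      · rcases sf_cases U a' b' hy.hole with ⟨-, -, g⟩ | ⟨h1', h2', g⟩ | ⟨h1', h2', g⟩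
        · rw [g] at q'; omega
        · rw [f, g] at e
          exact (aux hy hx h1' h1 e.symm).elim
        · rw [f, g] at e
          simp only [Prod.mk.injEq, Nat.add_right_cancel_iff] at e
          obtain ⟨e, rfl, rfl⟩ := e
          rw [comm e]

theorem hsum_iter_le {μ : YoungDiagram} (k : ℕ) : ∀ {x : Tab × (ℕ × ℕ)} (_ : HS μ x.1 x.2),
    hsum x ≤ hsum (sf^[k] x) := by
  induction k with
  | zero => intro x h; exact le_rfl
  | succ k ih =>
    intro x h
    rw [Function.iterate_succ_apply]
    have := ih h.sf
    rcases hsum_sf h.hole with ⟨q, q'⟩ | q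
    · rw [q] at this ⊢; exact this
    · have : hsum (sf x) ≤ hsum (sf^[k] (sf x)) := this
      omega

theorem iter_inj {μ : YoungDiagram} (k : ℕ) : ∀ {x y : Tab × (ℕ × ℕ)} (_ : HS μ x.1 x.2)
    (_ : HS μ y.1 y.2), hsum x = hsum y → sf^[k] x = sf^[k] y → x = y := by
  induction k with
  | zero => intro x y _ _ _ e; exact e
  | succ k ih =>
    intro x y hx hy hs e
    rw [Function.iterate_succ_apply, Function.iterate_succ_apply] at e
    have lx : hsum (sf x) ≤ hsum (sf^[k] (sf x)) := hsum_iter_le k hx.sf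
    have ly : hsum (sf y) ≤ hsum (sf^[k] (sf y)) := hsum_iter_le k hy.sf
    have hs' : hsum (sf x) = hsum (sf y) := by
      rcases hsum_sf hx.hole with ⟨q, -⟩ | q <;> rcases hsum_sf hy.hole with ⟨q', -⟩ | q'
      · rw [q, q', hs]
      · rw [q, Function.iterate_fixed q] at e
        rw [← e] at ly
        omega
      · rw [q', Function.iterate_fixed q'] at e
        rw [e] at lx
        omega
      · omega
    exact sf_inj hx hy hs (ih hx.sf hy.sf hs' e)

/-- Descents are preserved by one step. -/
theorem sf_des {μ : YoungDiagram} {T : Tab} {c : ℕ × ℕ} (h : HS μ T c) (i : ℕ) (d d' : ℕ × ℕ)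
    (hi : i ≠ 0) (hd : T d = i) (hd' : T d' = i + 1) :
    ∃ e e', (sf (T, c)).1 e = i ∧ (sf (T, c)).1 e' = i + 1 ∧ (d.1 < d'.1 ↔ e.1 < e'.1) := by
  obtain ⟨a, b⟩ := c
  have md := (h.supp d).1 (by omega)
  have md' := (h.supp d').1 (by omega)
  rcases sf_cases T a b h.hole with ⟨-, -, e⟩ | ⟨h1, h2, e⟩ | ⟨h1, h2, e⟩
  · rw [e]; exact ⟨d, d', hd, hd', Iff.rfl⟩
  · rw [e]
    refine ⟨Equiv.swap (a, b) (a, b + 1) d, Equiv.swap (a, b) (a, b + 1) d', by simp [hd], by simp [hd'], ?_⟩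
    have : ∀ z : ℕ × ℕ, (Equiv.swap (a, b) (a, b + 1) z).1 = z.1 := by
      intro z
      rw [Equiv.swap_apply_def]
      split_ifs with q1 q2 <;> simp [*]
    rw [this, this]
  · rw [e]
    refine ⟨Equiv.swap (a, b) (a + 1, b) d, Equiv.swap (a, b) (a + 1, b) d', by simp [hd], by simp [hd'], ?_⟩
    have hne : d ≠ d' := by rintro rfl; omega
    by_cases q : d = (a + 1, b)
    · subst q
      rw [Equiv.swap_apply_right, Equiv.swap_apply_of_ne_of_ne md'.2 hne.symm]
      obtain ⟨p, r⟩ := d'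
      simp only
      constructor
      · omega
      · intro hlt
        by_contra hcon
        have hp : p = a + 1 := by omega
        subst hp
        have hr : b < r := by
          by_contra hr
          have := h.ord (a + 1, r) (a + 1, b) (by omega) (by omega) le_rfl (by simp; omega)
          omega
        have n1 : T (a, b + 1) ≠ 0 := (h.supp _).2 ⟨mem_of_le md'.1 (by simp) (by simp; omega), by simp⟩
        have := h.lt n1 (by omega : T (a + 1, r) ≠ 0) (by simp) (by simp; omega) (by simp)
        have n3 : T (a, b + 1) ≠ T (a + 1, b) := fun q => by
          have := h.inj _ _ n1 q
          simp at this
        omega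
    · rw [Equiv.swap_apply_of_ne_of_ne md.2 q]
      by_cases q' : d' = (a + 1, b)
      · subst q'
        rw [Equiv.swap_apply_right]
        obtain ⟨p, r⟩ := d
        simp only
        constructor
        · intro hlt
          by_contra hcon
          have hp : p = a := by omega
          subst hp
          rcases lt_trichotomy r b with hr | hr | hr
          · have n1 : T (p + 1, r) ≠ 0 := (h.supp _).2 ⟨mem_of_le md'.1 (by simp) (by simp; omega), by simp⟩
            have l1 := h.lt (by omega : T (p, r) ≠ 0) n1 (by simp) (by simp) (by simp)
            have l2 := h.lt n1 (by omega : T (p + 1, b) ≠ 0) (by simp) (by simp; omega) (by simp; omega)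
            omega
          · subst hr; exact md.2 rfl
          · have n1 : T (p, b + 1) ≠ 0 := (h.supp _).2 ⟨mem_of_le md.1 (by simp) (by simp; omega), by simp⟩
            have := h.ord _ _ n1 (by omega : T (p, r) ≠ 0) (by simp) (by simp; omega)
            omega
        · omega
      · rw [Equiv.swap_apply_of_ne_of_ne md'.2 q']

theorem iter_des {μ : YoungDiagram} (k : ℕ) : ∀ {x : Tab × (ℕ × ℕ)} (_ : HS μ x.1 x.2) (i : ℕ)
    (d d' : ℕ × ℕ) (_ : i ≠ 0) (_ : x.1 d = i) (_ : x.1 d' = i + 1),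
    ∃ e e', (sf^[k] x).1 e = i ∧ (sf^[k] x).1 e' = i + 1 ∧ (d.1 < d'.1 ↔ e.1 < e'.1) := by
  induction k with
  | zero => intro x h i d d' _ h1 h2; exact ⟨d, d', h1, h2, Iff.rfl⟩
  | succ k ih =>
    intro x h i d d' hi h1 h2
    rw [Function.iterate_succ_apply]
    obtain ⟨e, e', a1, a2, a3⟩ := sf_des h i d d' hi h1 h2
    obtain ⟨f, f', b1, b2, b3⟩ := ih h.sf i e e' hi a1 a2
    exact ⟨f, f', b1, b2, a3.trans b3⟩

/-- The wall left behind by the first slide. -/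
theorem path_wall {μ : YoungDiagram} (k : ℕ) {x : Tab × (ℕ × ℕ)} (h : HS μ x.1 x.2) :
    ∃ ρ : ℕ → ℕ, x.2.2 ≤ (sf^[k] x).2.2 ∧ x.2.1 ≤ (sf^[k] x).2.1 ∧
      (∀ j, x.2.2 ≤ j → j < (sf^[k] x).2.2 → x.2.1 ≤ ρ j ∧ ρ j ≤ (sf^[k] x).2.1 ∧
        ∀ r, ρ j = r + 1 → (sf^[k] x).1 (r, j + 1) ≠ 0 ∧
          (sf^[k] x).1 (r, j + 1) < (sf^[k] x).1 (r + 1, j)) ∧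
      (∀ j, x.2.2 ≤ j → j + 1 < (sf^[k] x).2.2 → ρ j ≤ ρ (j + 1)) := by
  induction k with
  | zero => exact ⟨fun _ => 0, le_rfl, le_rfl, fun j h1 h2 => by simp at h2; omega,
      fun j h1 h2 => by simp at h2; omega⟩
  | succ k ih =>
    obtain ⟨ρ, i1, i0, i2, i3⟩ := ih
    have hk := HS.iter k h
    rw [Function.iterate_succ_apply']
    generalize sf^[k] x = y at *
    obtain ⟨T, a, b⟩ := y
    simp only at *
    rcases sf_cases T a b hk.hole with ⟨-, -, e⟩ | ⟨h1, h2, e⟩ | ⟨h1, h2, e⟩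
    · rw [e]; exact ⟨ρ, i1, i0, i2, i3⟩
    · rw [e]
      refine ⟨Function.update ρ b a, by simp only; omega, i0, ?_, ?_⟩
      · intro j l1 l2
        simp only at l2 ⊢
        by_cases hj : j = b
        · subst hj
          simp only [Function.update_self]
          refine ⟨i0, le_rfl, ?_⟩
          rintro r rfl
          have m1 := ((hk.supp _).1 h1).1
          have n1 : T (r, j + 1) ≠ 0 := (hk.supp _).2 ⟨mem_of_le m1 (by simp) (by simp), by simp⟩
          simp only [Function.comp, Equiv.swap_apply_left]
          rw [Equiv.swap_apply_of_ne_of_ne (by simp) (by simp)]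
          exact ⟨n1, hk.lt n1 h1 (by simp) (by simp) (by simp)⟩
        · rw [Function.update_of_ne hj]
          obtain ⟨a1, a2, a3⟩ := i2 j l1 (by omega)
          refine ⟨a1, a2, ?_⟩
          intro r hr
          have := a3 r hr
          simp only [Function.comp]
          rw [Equiv.swap_apply_of_ne_of_ne (by simp; omega) (by simp; omega),
            Equiv.swap_apply_of_ne_of_ne (by simp; omega) (by simp; omega)]
          exact this
      · intro j l1 l2
        simp only at l2
        rw [Function.update_of_ne (by omega : j ≠ b)]
        by_cases hj : j + 1 = b
        · rw [hj, Function.update_self]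
          exact (i2 j l1 (by omega)).2.1
        · rw [Function.update_of_ne hj]
          exact i3 j l1 (by omega)
    · rw [e]
      refine ⟨ρ, i1, by simp only; omega, ?_, i3⟩
      intro j l1 l2
      simp only at l2 ⊢
      obtain ⟨a1, a2, a3⟩ := i2 j l1 l2
      refine ⟨a1, by omega, ?_⟩
      intro r hr
      have := a3 r hr
      simp only [Function.comp]
      rw [Equiv.swap_apply_of_ne_of_ne (by simp; omega) (by simp; omega),
        Equiv.swap_apply_of_ne_of_ne (by simp; omega) (by simp; omega)]
      exact this

/-- The second slide stays above the wall. -/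
theorem path_above {ν : YoungDiagram} (l : ℕ) {x : Tab × (ℕ × ℕ)} (h : HS ν x.1 x.2)
    (hx : x.2 = (0, 0)) (v : ℕ × ℕ) (hv : ∀ d ∈ ν, v.1 ≤ d.1 → v.2 ≤ d.2 → False) (hv1 : 0 < v.1)
    (ρ : ℕ → ℕ) (hρ : ∀ j < v.2, 1 ≤ ρ j ∧ ρ j ≤ v.1 ∧
      ∀ r, ρ j = r + 1 → x.1 (r, j + 1) ≠ 0 ∧ x.1 (r, j + 1) < x.1 (r + 1, j))
    (hm : ∀ j, j + 1 < v.2 → ρ j ≤ ρ (j + 1)) :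
    ((sf^[l] x).2.2 < v.2 → (sf^[l] x).2.1 < ρ (sf^[l] x).2.2) ∧ (sf^[l] x).2.1 < v.1 ∧
    ∀ e : ℕ × ℕ, ¬ (e.1 ≤ (sf^[l] x).2.1 ∧ e.2 ≤ (sf^[l] x).2.2) → (sf^[l] x).1 e = x.1 e := by
  induction l with
  | zero =>
    simp only [Function.iterate_zero, id, hx]
    exact ⟨fun q => (hρ 0 q).1, hv1, fun _ _ => trivial⟩
  | succ l ih =>
    obtain ⟨i1, i2, i3⟩ := ih
    have hk := HS.iter l h
    rw [Function.iterate_succ_apply']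
    generalize sf^[l] x = y at *
    obtain ⟨T, a, b⟩ := y
    simp only at *
    rcases sf_cases T a b hk.hole with ⟨-, -, e⟩ | ⟨h1, h2, e⟩ | ⟨h1, h2, e⟩
    · rw [e]; exact ⟨i1, i2, i3⟩
    · rw [e]
      refine ⟨?_, i2, ?_⟩
      · simp only
        intro q
        exact lt_of_lt_of_le (i1 (by omega)) (hm b q)
      · simp only
        rintro ⟨e1, e2⟩ he
        simp only at he
        simp only [Function.comp]
        rw [Equiv.swap_apply_of_ne_of_ne (by simp; omega) (by simp; omega)]
        exact i3 (e1, e2) (by simp only; omega)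
    · rw [e]
      have d1 : b < v.2 → a + 1 < ρ b := by
        intro q
        by_contra hcon
        have hr : ρ b = a + 1 := by have := i1 q; omega
        have := (hρ b q).2.2 a hr
        rw [← i3 (a, b + 1) (by simp), ← i3 (a + 1, b) (by simp)] at this
        omega
      refine ⟨d1, ?_, ?_⟩
      · simp only
        by_cases q : b < v.2
        · exact lt_of_lt_of_le (d1 q) (hρ b q).2.1
        · by_contra hcon
          exact hv _ ((hk.supp _).1 h1).1 (by simp only; omega) (by simp only; omega)
      · simp only
        rintro ⟨e1, e2⟩ he
        simp only at he
        simp only [Function.comp]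
        rw [Equiv.swap_apply_of_ne_of_ne (by simp; omega) (by simp; omega)]
        exact i3 (e1, e2) (by simp only; omega)

/-- First slide starts down: the second vacated cell is strictly above. -/
theorem key_down {μ ν : YoungDiagram} (k l : ℕ) {T T2 : Tab} (h : HS μ T (0, 0))
    (hdown : (sf (T, (0, 0))).2 = (1, 0))
    (h2 : HS ν T2 (0, 0))
    (hT2 : ∀ e, e ≠ (0, 0) → T2 e = (sf^[k + 1] (T, (0, 0))).1 e - 1)
    (hpos : ∀ e, e ≠ (0, 0) → (sf^[k + 1] (T, (0, 0))).1 e ≠ 1)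
    (hv : ∀ d ∈ ν, (sf^[k + 1] (T, (0, 0))).2.1 ≤ d.1 → (sf^[k + 1] (T, (0, 0))).2.2 ≤ d.2 → False) :
    (sf^[l] (T2, (0, 0))).2.1 < (sf^[k + 1] (T, (0, 0))).2.1 := by
  rw [Function.iterate_succ_apply] at *
  have h' : HS μ (sf (T, (0, 0))).1 (sf (T, (0, 0))).2 := h.sf
  obtain ⟨ρ, w1, w0, w2, w3⟩ := path_wall k h'
  rw [hdown] at w1 w0 w2 w3
  refine (path_above l (x := (T2, (0, 0))) h2 rfl _ hv w0 ρ ?_ (fun j hj => w3 j (Nat.zero_le _) hj)).2.1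
  intro j hj
  obtain ⟨a1, a2, a3⟩ := w2 j (Nat.zero_le _) hj
  refine ⟨a1, a2, ?_⟩
  intro r hr
  have := a3 r hr
  simp only
  rw [hT2 _ (by simp), hT2 _ (by simp)]
  have := hpos (r, j + 1) (by simp)
  omega

/-! transposition -/

theorem swap_comp_swap (c d : ℕ × ℕ) (T : Tab) :
    (T ∘ Equiv.swap c d) ∘ Prod.swap = (T ∘ Prod.swap) ∘ Equiv.swap c.swap d.swap := by
  funext e
  simp only [Function.comp]
  congr 1
  rw [Equiv.swap_apply_def, Equiv.swap_apply_def]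
  have : ∀ z : ℕ × ℕ, e = z.swap ↔ e.swap = z := fun z => by
    constructor
    · rintro rfl; simp
    · rintro rfl; simp
  simp only [this]
  split_ifs <;> simp

/-- transpose of a state -/
def tr (x : Tab × (ℕ × ℕ)) : Tab × (ℕ × ℕ) := (x.1 ∘ Prod.swap, x.2.swap)

theorem sf_tr {μ : YoungDiagram} {x : Tab × (ℕ × ℕ)} (h : HS μ x.1 x.2) : sf (tr x) = tr (sf x) := by
  obtain ⟨T, a, b⟩ := x
  have ne : T (a, b + 1) ≠ 0 → T (a, b + 1) ≠ T (a + 1, b) := fun q q' => by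
    have := h.inj _ _ q q'
    simp at this
  have hh := h.hole
  simp only at hh
  have e0 : tr (T, (a, b)) = (T ∘ Prod.swap, (b, a)) := rfl
  rw [e0]
  have t1 : (T ∘ Prod.swap) (b, a + 1) = T (a + 1, b) := rfl
  have t2 : (T ∘ Prod.swap) (b + 1, a) = T (a, b + 1) := rfl
  rcases sf_cases T a b hh with ⟨q1, q2, e⟩ | ⟨h1, h2, e⟩ | ⟨h1, h2, e⟩ <;>
  rcases sf_cases (T ∘ Prod.swap) b a hh with ⟨q1', q2', e'⟩ | ⟨h1', h2', e'⟩ | ⟨h1', h2', e'⟩ <;>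
  rw [e, e'] <;> simp only [t1, t2] at *
  · rfl
  · omega
  · omega
  · omega
  · have := ne h1; omega
  · simp only [tr, swap_comp_swap]; rfl
  · omega
  · simp only [tr, swap_comp_swap]; rfl
  · have := ne h1'; omega

theorem iter_tr {μ : YoungDiagram} (k : ℕ) : ∀ {x : Tab × (ℕ × ℕ)} (_ : HS μ x.1 x.2),
    sf^[k] (tr x) = tr (sf^[k] x) := by
  induction k with
  | zero => intro x _; rfl
  | succ k ih =>
    intro x h
    rw [Function.iterate_succ_apply, Function.iterate_succ_apply, sf_tr h, ih h.sf]

theorem HS.tr {μ : YoungDiagram} {T : Tab} {c : ℕ × ℕ} (h : HS μ T c) :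
    HS μ.transpose (T ∘ Prod.swap) c.swap := by
  refine ⟨?_, ?_, ?_, ?_, ?_⟩
  · simpa using h.mem
  · intro d
    have := h.supp d.swap
    rw [YoungDiagram.mem_transpose]
    simp only [Function.comp]
    rw [this]
    refine and_congr Iff.rfl (not_congr ?_)
    constructor
    · rintro rfl; simp
    · rintro rfl; simp
  · intro d d' h1 h2
    exact Prod.swap_injective (h.inj _ _ h1 h2)
  · intro d d' h1 h2 h3 h4
    exact h.ord _ _ h1 h2 h4 h3
  · intro d hd
    have := h.rng _ hd
    have e : μ.transpose.cells.card = μ.cells.card := by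
      have : μ.transpose.cells = μ.cells.map (Equiv.prodComm ℕ ℕ).toEmbedding := by
        ext e
        simp only [YoungDiagram.mem_cells, YoungDiagram.mem_transpose, Finset.mem_map_equiv]
        rfl
      rw [this, Finset.card_map]
    rw [e]; exact this

theorem key_right {μ ν : YoungDiagram} (k l : ℕ) {T T2 : Tab} (h : HS μ T (0, 0))
    (hr : (sf (T, (0, 0))).2 = (0, 1))
    (h2 : HS ν T2 (0, 0))
    (hT2 : ∀ e, e ≠ (0, 0) → T2 e = (sf^[k + 1] (T, (0, 0))).1 e - 1)
    (hpos : ∀ e, e ≠ (0, 0) → (sf^[k + 1] (T, (0, 0))).1 e ≠ 1)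
    (hv : ∀ d ∈ ν, (sf^[k + 1] (T, (0, 0))).2.1 ≤ d.1 → (sf^[k + 1] (T, (0, 0))).2.2 ≤ d.2 → False) :
    (sf^[l] (T2, (0, 0))).2.2 < (sf^[k + 1] (T, (0, 0))).2.2 := by
  have e1 : sf^[k + 1] (T ∘ Prod.swap, (0, 0)) = tr (sf^[k + 1] (T, (0, 0))) := iter_tr (k + 1) (x := (T, (0, 0))) h
  have e2 : sf^[l] (T2 ∘ Prod.swap, (0, 0)) = tr (sf^[l] (T2, (0, 0))) := iter_tr l (x := (T2, (0, 0))) h2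
  have e3 : sf (T ∘ Prod.swap, (0, 0)) = tr (sf (T, (0, 0))) := sf_tr (x := (T, (0, 0))) h
  have sw : ∀ e : ℕ × ℕ, e ≠ (0, 0) → e.swap ≠ (0, 0) := by
    rintro ⟨a, b⟩ h1 h2
    simp only [Prod.swap_prod_mk, Prod.mk.injEq] at h1 h2
    exact h1 (by simp [h2])
  have := key_down (μ := μ.transpose) (ν := ν.transpose) k l (T := T ∘ Prod.swap) (T2 := T2 ∘ Prod.swap)
    h.tr (by rw [e3]; simp [tr, hr]) h2.tr
    (by rw [e1]; intro e he; exact hT2 _ (sw e he))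
    (by rw [e1]; intro e he; exact hpos _ (sw e he))
    (by
      rw [e1]; intro d hd l1 l2
      exact hv d.swap (by simpa using hd) l2 l1)
  rw [e1, e2] at this
  exact this

/-- Removing an inner corner. -/
def delC (μ : YoungDiagram) (v : ℕ × ℕ) (h : IsEnd μ v) : YoungDiagram where
  cells := μ.cells.erase v
  isLowerSet := by
    intro a b hab ha
    simp only [Finset.coe_erase, Set.mem_sdiff, Set.mem_singleton_iff, Finset.mem_coe,
      YoungDiagram.mem_cells] at ha ⊢
    refine ⟨mem_of_le ha.1 hab.1 hab.2, ?_⟩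
    rintro rfl
    exact ha.2 (h.2 a ha.1 hab.1 hab.2)

theorem mem_delC {μ : YoungDiagram} {v : ℕ × ℕ} (h : IsEnd μ v) {d : ℕ × ℕ} :
    d ∈ delC μ v h ↔ d ∈ μ ∧ d ≠ v := by
  rw [← YoungDiagram.mem_cells]
  show d ∈ μ.cells.erase v ↔ _
  rw [Finset.mem_erase, YoungDiagram.mem_cells, and_comm]

theorem card_delC {μ : YoungDiagram} {v : ℕ × ℕ} (h : IsEnd μ v) {m : ℕ} (hm : μ.cells.card = m + 1) :
    (delC μ v h).cells.card = m := by
  show (μ.cells.erase v).card = m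
  rw [Finset.card_erase_of_mem ((YoungDiagram.mem_cells _).2 h.1), hm]; rfl

theorem std_of {μ : YoungDiagram} {T : Tab} (supp : ∀ c, T c ≠ 0 ↔ c ∈ μ)
    (inj : ∀ d d', T d ≠ 0 → T d = T d' → d = d')
    (ord : ∀ d d', T d ≠ 0 → T d' ≠ 0 → d.1 ≤ d'.1 → d.2 ≤ d'.2 → T d ≤ T d')
    (bd : ∀ d, T d ≤ μ.cells.card) : IsStandard μ T := by
  have s : ∀ c ∈ μ.cells, T c ≠ 0 := fun c hc => (supp c).2 ((YoungDiagram.mem_cells _).1 hc)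
  refine ⟨⟨?_, ?_, ?_, ?_⟩, ?_⟩
  · intro c hc
    by_contra h
    exact hc ((YoungDiagram.mem_cells _).2 ((supp c).1 h))
  · intro c hc
    exact ⟨Nat.pos_of_ne_zero (s c hc), bd c⟩
  · intro c hc d hd e
    exact inj c d (s c hc) e
  · have := Finset.surjOn_of_injOn_of_card_le (s := μ.cells) (t := Finset.Icc 1 μ.cells.card) T
      (by
        intro c hc
        simp only [Finset.coe_Icc]
        exact ⟨Nat.pos_of_ne_zero (s c hc), bd c⟩)
      (fun c hc d hd e => inj c d (s c hc) e) (by simp)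
    simpa using this
  · intro c hc d hd hne h1 h2
    exact lt_of_le_of_ne (ord c d (s c hc) (s d hd) h1 h2) fun e => hne (inj c d (s c hc) e)

theorem IsStandard.supp {μ : YoungDiagram} {T : Tab} (h : IsStandard μ T) (c : ℕ × ℕ) :
    T c ≠ 0 ↔ c ∈ μ := by
  rw [← YoungDiagram.mem_cells]
  constructor
  · intro hc; by_contra h'; exact hc (h.1.1 c h')
  · intro hc; have := (h.1.2.mapsTo hc).1; omega

theorem IsStandard.inj {μ : YoungDiagram} {T : Tab} (h : IsStandard μ T) (d d' : ℕ × ℕ)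
    (h1 : T d ≠ 0) (h2 : T d = T d') : d = d' :=
  h.1.2.injOn ((YoungDiagram.mem_cells _).2 ((h.supp d).1 h1))
    ((YoungDiagram.mem_cells _).2 ((h.supp d').1 (by omega))) h2

theorem IsStandard.ord {μ : YoungDiagram} {T : Tab} (h : IsStandard μ T) (d d' : ℕ × ℕ)
    (h1 : T d ≠ 0) (h2 : T d' ≠ 0) (h3 : d.1 ≤ d'.1) (h4 : d.2 ≤ d'.2) : T d ≤ T d' := by
  by_cases e : d = d'
  · rw [e]
  · exact (h.2 d ((YoungDiagram.mem_cells _).2 ((h.supp d).1 h1)) d'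
      ((YoungDiagram.mem_cells _).2 ((h.supp d').1 h2)) e h3 h4).le

theorem IsStandard.bd {μ : YoungDiagram} {T : Tab} (h : IsStandard μ T) (d : ℕ × ℕ) :
    T d ≤ μ.cells.card := by
  by_cases hd : T d = 0
  · omega
  · exact (h.1.2.mapsTo ((YoungDiagram.mem_cells _).2 ((h.supp d).1 hd))).2

theorem IsStandard.surj {μ : YoungDiagram} {T : Tab} (h : IsStandard μ T) {i : ℕ} (h1 : 1 ≤ i)
    (h2 : i ≤ μ.cells.card) : ∃ c, T c = i := by
  obtain ⟨c, -, hc⟩ := h.1.2.surjOn ⟨h1, h2⟩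
  exact ⟨c, hc⟩

theorem IsStandard.row {μ : YoungDiagram} {T : Tab} (h : IsStandard μ T) {c : ℕ × ℕ} (hc : T c ≠ 0) :
    posOf T (T c) = c := posOf_of_unique fun c' e => (h.inj c c' hc e.symm).symm

theorem IsStandard.row' {μ : YoungDiagram} {T : Tab} (h : IsStandard μ T) {c : ℕ × ℕ} {i : ℕ}
    (hc : T c = i) (hi : i ≠ 0) : rowIdx T i = c.1 := by
  subst hc
  exact congrArg Prod.fst (h.row hi)

theorem IsStandard.one {μ : YoungDiagram} {T : Tab} (h : IsStandard μ T) (hc : 0 < μ.cells.card) :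
    T (0, 0) = 1 := by
  obtain ⟨c, hc⟩ := h.surj le_rfl hc
  have h0 : T (0, 0) ≠ 0 := (h.supp _).2 (mem_of_le ((h.supp c).1 (by omega)) (Nat.zero_le _) (Nat.zero_le _))
  have := h.ord (0, 0) c h0 (by omega) (Nat.zero_le _) (Nat.zero_le _)
  omega

theorem IsStandard.hs {μ : YoungDiagram} {T : Tab} (h : IsStandard μ T) (hc : 0 < μ.cells.card) :
    HS μ (Function.update T (0, 0) 0) (0, 0) := by
  have h1 := h.one hc
  have key : ∀ d, Function.update T (0, 0) 0 d ≠ 0 ↔ T d ≠ 0 ∧ d ≠ (0, 0) := by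
    intro d
    by_cases e : d = (0, 0)
    · subst e; simp
    · simp [Function.update_of_ne e, e]
  have val : ∀ d, Function.update T (0, 0) 0 d ≠ 0 → Function.update T (0, 0) 0 d = T d := fun d hd =>
    Function.update_of_ne ((key d).1 hd).2 _ _
  refine ⟨(h.supp _).1 (by omega), ?_, ?_, ?_, ?_⟩
  · intro d; rw [key, h.supp]
  · intro d d' hd e
    have hd' : Function.update T (0, 0) 0 d' ≠ 0 := by rw [← e]; exact hd
    exact h.inj _ _ ((key d).1 hd).1 ((val d hd).symm.trans (e.trans (val d' hd')))
  · intro d d' hd hd' l1 l2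
    rw [val d hd, val d' hd']
    exact h.ord _ _ ((key d).1 hd).1 ((key d').1 hd').1 l1 l2
  · intro d hd
    rw [val d hd]
    have := (key d).1 hd
    have h3 : T d ≠ T (0, 0) := fun e => this.2 (h.inj _ _ this.1 e)
    exact ⟨by omega, h.bd d⟩

/-- the first slide of the evacuation -/
def fs (m : ℕ) (T : Tab) : Tab × (ℕ × ℕ) := sf^[m + 1] (Function.update T (0, 0) 0, (0, 0))

theorem evac_step {μ : YoungDiagram} {T : Tab} {m : ℕ} (hm : μ.cells.card = m + 1) (h : IsStandard μ T) :
    evacAux (m + 1) T = Function.update (evacAux m fun c => (fs m T).1 c - 1) (fs m T).2 (m + 1) ∧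
    HS μ (fs m T).1 (fs m T).2 ∧
    ∃ hv : IsEnd μ (fs m T).2, IsStandard (delC μ _ hv) (fun c => (fs m T).1 c - 1) := by
  have h0 := h.hs (by omega)
  have hp : posOf T 1 = (0, 0) := by
    have := h.one (by omega)
    rw [← this]; exact h.row (by omega)
  have h1 : HS μ (fs m T).1 (fs m T).2 := HS.iter (m + 1) (x := (Function.update T (0, 0) 0, (0, 0))) h0
  have h2 := iter_end (m + 1) (x := (Function.update T (0, 0) 0, (0, 0))) h0 (by simp [hsum]; omega)
  have hv : IsEnd μ (fs m T).2 := h1.isEnd h2.2.1 h2.2.2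
  refine ⟨?_, h1, hv, ?_⟩
  · have e : slide (m + 1) (Function.update T (posOf T 1) 0) (posOf T 1) = fs m T := by
      rw [hp, slide_eq _ _ _ (by simp)]; rfl
    simp only [evacAux]
    rw [e]
  · have ne : ∀ d, (fs m T).1 d - 1 ≠ 0 ↔ (fs m T).1 d ≠ 0 := by
      intro d
      have := h1.rng d
      omega
    refine std_of ?_ ?_ ?_ ?_
    · intro c
      rw [ne, h1.supp, mem_delC]
    · intro d d' hd e
      refine h1.inj d d' ((ne d).1 hd) ?_
      omega
    · intro d d' hd hd' l1 l2
      have := h1.ord d d' ((ne d).1 hd) ((ne d').1 hd') l1 l2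
      omega
    · intro d
      rw [card_delC hv hm]
      by_cases hd : (fs m T).1 d = 0
      · simp [hd]
      · have := h1.rng d hd
        omega

theorem evac_std : ∀ (m : ℕ) {μ : YoungDiagram} {T : Tab}, μ.cells.card = m → IsStandard μ T →
    IsStandard μ (evacAux m T) := by
  intro m
  induction m with
  | zero =>
    intro μ T hm h
    have : ∀ c, c ∉ μ := by
      intro c hc
      rw [Finset.card_eq_zero] at hm
      rw [← YoungDiagram.mem_cells, hm] at hc
      simp at hc
    refine std_of ?_ ?_ ?_ ?_ <;> simp [evacAux, this]
  | succ m ih =>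
    intro μ T hm h
    obtain ⟨e, h1, hv, h2⟩ := evac_step hm h
    have h3 := ih (card_delC hv hm) h2
    rw [e]
    generalize (evacAux m fun c => (fs m T).1 c - 1) = E at *
    generalize (fs m T).2 = v at *
    have bd := h3.bd
    rw [card_delC hv hm] at bd
    have Ev : E v = 0 := by
      by_contra q
      exact ((mem_delC hv).1 ((h3.supp v).1 q)).2 rfl
    refine std_of ?_ ?_ ?_ ?_
    · intro c
      by_cases q : c = v
      · subst q; simp [hv.1]
      · rw [Function.update_of_ne q, h3.supp, mem_delC]; simp [q]
    · intro d d' hd e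
      by_cases q : d = v <;> by_cases q' : d' = v
      · rw [q, q']
      · subst q
        rw [Function.update_self, Function.update_of_ne q'] at e
        have := bd d'; omega
      · subst q'
        rw [Function.update_self, Function.update_of_ne q] at e
        have := bd d; omega
      · rw [Function.update_of_ne q] at e hd
        rw [Function.update_of_ne q'] at e
        exact h3.inj _ _ hd e
    · intro d d' hd hd' l1 l2
      by_cases q : d = v <;> by_cases q' : d' = v
      · rw [q, q']
      · subst q
        rw [Function.update_of_ne q'] at hd'
        exact absurd (hv.2 d' ((mem_delC hv).1 ((h3.supp d').1 hd')).1 l1 l2) q'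
      · subst q'
        rw [Function.update_self, Function.update_of_ne q]
        have := bd d; omega
      · rw [Function.update_of_ne q] at hd ⊢
        rw [Function.update_of_ne q'] at hd' ⊢
        exact h3.ord _ _ hd hd' l1 l2
    · intro d
      by_cases q : d = v
      · subst q; simp [hm]
      · rw [Function.update_of_ne q]; have := bd d; omega

theorem evac_inj : ∀ (m : ℕ) {μ : YoungDiagram} {T U : Tab}, μ.cells.card = m → IsStandard μ T →
    IsStandard μ U → evacAux m T = evacAux m U → T = U := by
  intro m
  induction m with
  | zero =>
    intro μ T U hm h h' _
    have : ∀ c, c ∉ μ := by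
      intro c hc
      rw [Finset.card_eq_zero] at hm
      rw [← YoungDiagram.mem_cells, hm] at hc
      simp at hc
    funext c
    have a1 := h.supp c
    have a2 := h'.supp c
    simp only [this, iff_false, not_not] at a1 a2
    rw [a1, a2]
  | succ m ih =>
    intro μ T U hm h h' e
    have sT := evac_std (m + 1) hm h
    obtain ⟨e1, h1, hv, h2⟩ := evac_step hm h
    obtain ⟨e1', h1', hv', h2'⟩ := evac_step hm h'
    have hvv : (fs m T).2 = (fs m U).2 := by
      refine sT.inj _ _ ?_ ?_
      · rw [e1]; simp
      · nth_rw 2 [e]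
        rw [e1, e1']; simp
    have s2 := evac_std m (card_delC hv hm) h2
    have s2' := evac_std m (card_delC hv' hm) h2'
    have hE : evacAux m (fun c => (fs m T).1 c - 1) = evacAux m (fun c => (fs m U).1 c - 1) := by
      funext d
      by_cases q : d = (fs m T).2
      · have a1 : ¬ _ := fun z => ((mem_delC hv).1 ((s2.supp d).1 z)).2 q
        have a2 : ¬ _ := fun z => ((mem_delC hv').1 ((s2'.supp d).1 z)).2 (q.trans hvv)
        rw [not_not.1 a1, not_not.1 a2]
      · have := congrFun e d
        rw [e1, e1', Function.update_of_ne q, Function.update_of_ne (hvv ▸ q)] at this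
        exact this
    have hd : delC μ _ hv = delC μ _ hv' := by
      congr 1
    have h3 := ih (card_delC hv hm) h2 (hd ▸ h2') hE
    have h4 : fs m T = fs m U := by
      refine Prod.ext ?_ hvv
      funext d
      have := congrFun h3 d
      have a1 := h1.supp d
      have a2 := h1'.supp d
      have a3 := h1.rng d
      have a4 := h1'.rng d
      rw [hvv] at a1
      have a5 := a1.trans a2.symm
      by_cases z : (fs m T).1 d = 0
      · simp only [z, ne_eq, not_true, false_iff, not_not] at a5
        rw [z, a5]
      · have := a5.1 z
        omega
    have h5 := iter_inj (m + 1) (x := (Function.update T (0, 0) 0, (0, 0)))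
      (y := (Function.update U (0, 0) 0, (0, 0))) (h.hs (by omega)) (h'.hs (by omega)) rfl h4
    have h6 := congrArg Prod.fst h5
    simp only at h6
    funext d
    by_cases q : d = (0, 0)
    · rw [q, h.one (by omega), h'.one (by omega)]
    · have := congrFun h6 d
      rwa [Function.update_of_ne q, Function.update_of_ne q] at this

/-- The comparison of the first two vacated cells. -/
theorem evac_base {μ : YoungDiagram} {T : Tab} {m : ℕ} (hm : μ.cells.card = m + 2) (h : IsStandard μ T)
    (T' : Tab) (hT' : T' = fun c => (fs (m + 1) T).1 c - 1) :
    (fs m T').2.1 < (fs (m + 1) T).2.1 ↔ rowIdx T 1 < rowIdx T 2 := by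
  obtain ⟨-, h1, hv, h2⟩ := evac_step hm h
  rw [← hT'] at h2
  have hc2 := card_delC hv hm
  obtain ⟨-, h3, hv2, -⟩ := evac_step hc2 h2
  have h0 := h.hs (by omega)
  have h20 := h2.hs (by omega)
  have h11 := h.one (by omega)
  obtain ⟨c, hc⟩ := h.surj (i := 2) (by omega) (by omega)
  rw [h.row' h11 (by omega), h.row' hc (by omega)]
  have hT2 : ∀ e, e ≠ (0, 0) → Function.update T' (0, 0) 0 e = (fs (m + 1) T).1 e - 1 := by
    intro e he
    rw [Function.update_of_ne he, hT']
  have hpos : ∀ e, e ≠ (0, 0) → (fs (m + 1) T).1 e ≠ 1 := fun e _ q => by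
    have := h1.rng e (by omega)
    omega
  have hvv : ∀ d ∈ delC μ _ hv, (fs (m + 1) T).2.1 ≤ d.1 → (fs (m + 1) T).2.2 ≤ d.2 → False := by
    intro d hd l1 l2
    have := (mem_delC hv).1 hd
    exact this.2 (hv.2 d this.1 l1 l2)
  have cne : c ≠ (0, 0) := by rintro rfl; omega
  have hcm := (h.supp c).1 (by omega)
  rcases sf_cases (Function.update T (0, 0) 0) 0 0 (by simp) with ⟨q1, q2, -⟩ | ⟨q1, q2, e⟩ | ⟨q1, q2, e⟩
  · exfalso
    have := h0.isEnd q1 q2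
    exact cne (this.2 c hcm (Nat.zero_le _) (Nat.zero_le _))
  · have := key_right (m + 1) (m + 1) h0 (by rw [e]) h20 hT2 hpos hvv
    have this : (fs m T').2.2 < (fs (m + 1) T).2.2 := this
    simp only [zero_add] at q1 q2
    rw [Function.update_of_ne (by simp)] at q1 q2
    rw [Function.update_of_ne (by simp)] at q2
    constructor
    · intro hlt
      exfalso
      -- strictly north-west
      have m1 : ((fs m T').2.1, (fs m T').2.2 + 1) ∈ delC μ _ hv := by
        rw [mem_delC]
        refine ⟨mem_of_le hv.1 hlt.le this, ?_⟩
        intro z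
        have := congrArg Prod.fst z
        simp only at this
        omega
      have := hv2.2 _ m1 le_rfl (by simp)
      have := congrArg Prod.snd this
      simp at this
    · intro hlt
      exfalso
      have q3 : T (1, 0) ≠ 0 := (h.supp _).2 (mem_of_le hcm hlt (Nat.zero_le _))
      have := h.ord (1, 0) c q3 (by omega) hlt (Nat.zero_le _)
      have q4 : T (0, 1) ≠ T (0, 0) := fun z => by
        have := h.inj _ _ q1 z
        simp at this
      omega
  · have := key_down (m + 1) (m + 1) h0 (by rw [e]) h20 hT2 hpos hvv
    have this : (fs m T').2.1 < (fs (m + 1) T).2.1 := this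
    simp only [this, true_iff]
    simp only [zero_add] at q1 q2
    rw [Function.update_of_ne (by simp)] at q1 q2
    rw [Function.update_of_ne (by simp)] at q2
    by_contra hcon
    have hc1 : c.1 = 0 := by omega
    have hc2 : 1 ≤ c.2 := by
      by_contra z
      exact cne (Prod.ext hc1 (by simp; omega))
    have q3 : T (0, 1) ≠ 0 := (h.supp _).2 (mem_of_le hcm (Nat.zero_le _) hc2)
    have := h.ord (0, 1) c q3 (by omega) (Nat.zero_le _) hc2
    have q4 : T (1, 0) ≠ T (0, 0) := fun z => by
      have := h.inj _ _ q1 z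
      simp at this
    have q5 : T (1, 0) ≠ T (0, 1) := fun z => by
      have := h.inj _ _ q1 z
      simp at this
    omega

theorem evac_des : ∀ (m : ℕ) {μ : YoungDiagram} {T : Tab}, μ.cells.card = m → IsStandard μ T →
    ∀ i j, 1 ≤ i → 1 ≤ j → i + j = m →
    (rowIdx (evacAux m T) i < rowIdx (evacAux m T) (i + 1) ↔ rowIdx T j < rowIdx T (j + 1)) := by
  intro m
  induction m with
  | zero => intro μ T hm h i j; omega
  | succ m ih =>
    intro μ T hm h i j hi hj hij
    have sT := evac_std (m + 1) hm h
    obtain ⟨e1, h1, hv, h2⟩ := evac_step hm h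
    have hc := card_delC hv hm
    have s2 := evac_std m hc h2
    have up : ∀ d, (evacAux m fun c => (fs m T).1 c - 1) d ≠ 0 →
        evacAux (m + 1) T d = (evacAux m fun c => (fs m T).1 c - 1) d := by
      intro d hd
      have := ((mem_delC hv).1 ((s2.supp d).1 hd)).2
      rw [e1, Function.update_of_ne this]
    have rw1 : ∀ i, 1 ≤ i → i ≤ m → rowIdx (evacAux (m + 1) T) i =
        rowIdx (evacAux m fun c => (fs m T).1 c - 1) i := by
      intro i hi him
      obtain ⟨c, hc'⟩ := s2.surj hi (by omega)
      rw [s2.row' hc' (by omega), sT.row' (c := c) (by rw [up c (by omega), hc']) (by omega)]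
    by_cases hj1 : j = 1
    · subst hj1
      have him : i = m := by omega
      subst him
      obtain ⟨m', rfl⟩ : ∃ m', i = m' + 1 := ⟨i - 1, by omega⟩
      rw [rw1 _ hi le_rfl]
      obtain ⟨e3, -, -, -⟩ := evac_step hc h2
      have a1 : rowIdx (evacAux (m' + 1) fun c => (fs (m' + 1) T).1 c - 1) (m' + 1) =
          (fs m' fun c => (fs (m' + 1) T).1 c - 1).2.1 :=
        s2.row' (by rw [e3]; simp) (by omega)
      have a2 : rowIdx (evacAux (m' + 1 + 1) T) (m' + 1 + 1) = (fs (m' + 1) T).2.1 :=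
        sT.row' (by rw [e1]; simp) (by omega)
      rw [a1, a2]
      exact evac_base hm h _ rfl
    · rw [rw1 i hi (by omega), rw1 (i + 1) (by omega) (by omega)]
      rw [ih hc h2 i (j - 1) hi (by omega) (by omega)]
      obtain ⟨c, hc1⟩ := h.surj hj (by omega)
      obtain ⟨d, hd1⟩ := h.surj (i := j + 1) (by omega) (by omega)
      rw [h.row' hc1 (by omega), h.row' hd1 (by omega)]
      have h00 := h.one (by omega)
      have cn : c ≠ (0, 0) := by rintro rfl; omega
      have dn : d ≠ (0, 0) := by rintro rfl; omega
      obtain ⟨e, e', b1, b2, b3⟩ := iter_des (m + 1) (x := (Function.update T (0, 0) 0, (0, 0)))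
        (h.hs (by omega)) j c d (by omega) (by simp [Function.update_of_ne cn, hc1])
        (by simp [Function.update_of_ne dn, hd1])
      have b1 : (fs m T).1 e = j := b1
      have b2 : (fs m T).1 e' = j + 1 := b2
      rw [b3, h2.row' (c := e) (by simp only [b1]) (by omega),
        h2.row' (c := e') (by simp only [b2]; omega) (by omega)]

theorem mem_DsiSet {n : ℕ} {T : Tab} {i : ℕ} :
    i ∈ DsiSet n T ↔ (0 < i ∧ i < n) ∧ rowIdx T i < rowIdx T (i + 1) := by
  unfold DsiSet
  rw [Finset.mem_filter, Finset.mem_Ioo]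

theorem Dsic_evac {n : ℕ} {μ : YoungDiagram} {T : Tab} (hn : μ.cells.card = n) (h : IsStandard μ T) :
    Dsic n (evac n T) = DsiSet n T := by
  ext j
  rw [Dsic, Finset.mem_image, mem_DsiSet]
  simp only [mem_DsiSet, evac]
  constructor
  · rintro ⟨i, ⟨hi, hr⟩, rfl⟩
    exact ⟨by omega, (evac_des n hn h i (n - i) (by omega) (by omega) (by omega)).1 hr⟩
  · rintro ⟨hj, hr⟩
    exact ⟨n - j, ⟨by omega, (evac_des n hn h (n - j) j (by omega) (by omega) (by omega)).2 hr⟩, by omega⟩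

theorem Qt_std {n : ℕ} {w : Equiv.Perm ℕ} (hw : SuppIn n w) :
    IsStandard (RSshape n w hw) (Qt n w) := evac_std n (RSshape_card hw) (Qtab_std hw)

theorem Dsic_Qt {n : ℕ} {w : Equiv.Perm ℕ} (hw : SuppIn n w) : Dsic n (Qt n w) = DslSet n w := by
  rw [Qt, Dsic_evac (RSshape_card hw) (Qtab_std hw), Qtab_des hw]

theorem IsStandard.shape {μ ν : YoungDiagram} {T : Tab} (h : IsStandard μ T) (h' : IsStandard ν T) :
    μ = ν := by
  refine SetLike.ext fun c => ?_
  rw [← h.supp, ← h'.supp]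

theorem RS_inj' {n : ℕ} {w w' : Equiv.Perm ℕ} (hw : SuppIn n w) (hw' : SuppIn n w')
    (hP : Ptab n w = Ptab n w') (hQ : Qt n w = Qt n w') : w = w' := by
  have hs : RSshape n w hw = RSshape n w' hw' := (Ptab_std hw).shape (hP ▸ Ptab_std hw')
  refine RS_inj hw hw' hP ?_
  exact evac_inj n (RSshape_card hw) (Qtab_std hw) (hs ▸ Qtab_std hw') hQ

/-! ### Ordered set partitions -/

def cI (I : Finset ℕ) (p : ℕ) : ℕ := (I.filter fun d => d ≤ p).card

theorem cI_le (I : Finset ℕ) (p : ℕ) : cI I p ≤ I.card := Finset.card_filter_le _ _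

theorem jval_emb {n : ℕ} {I : Finset ℕ} {h : ℕ} (hh : h < I.card) :
    jval n I (h + 1) = I.orderEmbOfFin rfl ⟨h, hh⟩ := by
  rw [jval, if_neg (by omega), if_pos (by omega), Finset.orderEmbOfFin_apply]
  simp [hh]

theorem jval_mem {n : ℕ} {I : Finset ℕ} {h : ℕ} (hh : h < I.card) : jval n I (h + 1) ∈ I := by
  rw [jval_emb hh]; exact Finset.orderEmbOfFin_mem _ _ _

theorem jval_last {n : ℕ} {I : Finset ℕ} : jval n I (I.card + 1) = n := by
  rw [jval, if_neg (by omega), if_neg (by omega)]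

theorem jval_le {n : ℕ} {I : Finset ℕ} (hI : I ⊆ Finset.Ioo 0 n) {h : ℕ} (hh : h ≤ I.card) :
    jval n I (h + 1) ≤ n := by
  rcases hh.lt_or_eq with q | rfl
  · have := Finset.mem_Ioo.1 (hI (jval_mem (n := n) q)); omega
  · rw [jval_last]

theorem jv_key {n : ℕ} {I : Finset ℕ} {h p : ℕ} (hh : h ≤ I.card) (hp : p < n) :
    cI I p ≤ h ↔ p < jval n I (h + 1) := by
  rcases hh.lt_or_eq with q | rfl
  · rw [jval_emb q]
    set s := I.orderEmbOfFin rfl with hs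
    have hc : cI I p = (Finset.univ.filter fun k : Fin I.card => s k ≤ p).card := by
      rw [cI]
      symm
      refine Finset.card_bij (fun k _ => s k) ?_ ?_ ?_
      · intro k hk
        rw [Finset.mem_filter] at hk ⊢
        exact ⟨Finset.orderEmbOfFin_mem _ _ _, hk.2⟩
      · intro a _ b _ e; exact s.injective e
      · intro d hd
        rw [Finset.mem_filter] at hd
        have : d ∈ Set.range s := by
          rw [hs, Finset.range_orderEmbOfFin]; exact hd.1
        obtain ⟨k, rfl⟩ := this
        exact ⟨k, by rw [Finset.mem_filter]; exact ⟨Finset.mem_univ _, hd.2⟩, rfl⟩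
    rw [hc]
    constructor
    · intro hle
      by_contra hcon
      have : Finset.Iic (⟨h, q⟩ : Fin I.card) ⊆ Finset.univ.filter fun k : Fin I.card => s k ≤ p := by
        intro k hk
        rw [Finset.mem_Iic] at hk
        rw [Finset.mem_filter]
        exact ⟨Finset.mem_univ _, (s.monotone hk).trans (not_lt.1 hcon)⟩
      have := Finset.card_le_card this
      rw [Fin.card_Iic] at this
      simp only at this
      omega
    · intro hlt
      have : (Finset.univ.filter fun k : Fin I.card => s k ≤ p) ⊆ Finset.Iio (⟨h, q⟩ : Fin I.card) := by
        intro k hk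
        rw [Finset.mem_filter] at hk
        rw [Finset.mem_Iio]
        exact s.lt_iff_lt.1 (lt_of_le_of_lt hk.2 hlt)
      have := Finset.card_le_card this
      rwa [Fin.card_Iio] at this
  · rw [jval_last]
    exact ⟨fun _ => hp, fun _ => cI_le _ _⟩

theorem jval_eq {n : ℕ} {I : Finset ℕ} (hI : I ⊆ Finset.Ioo 0 n) {h : ℕ} (hh : h ≤ I.card) :
    ((Finset.range n).filter fun p => cI I p ≤ h).card = jval n I (h + 1) := by
  have : ((Finset.range n).filter fun p => cI I p ≤ h) = Finset.range (jval n I (h + 1)) := by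
    ext p
    rw [Finset.mem_filter, Finset.mem_range, Finset.mem_range]
    have := jval_le hI hh
    constructor
    · intro q; exact (jv_key hh q.1).1 q.2
    · intro q; exact ⟨by omega, (jv_key hh (by omega)).2 q⟩
  rw [this, Finset.card_range]

theorem jval_mono {n : ℕ} {I : Finset ℕ} (hI : I ⊆ Finset.Ioo 0 n) {h : ℕ} (hh : h ≤ I.card) :
    jval n I h ≤ jval n I (h + 1) := by
  rcases h with _ | h
  · simp [jval]
  · rw [← jval_eq hI hh, ← jval_eq hI (show h ≤ I.card by omega)]
    apply Finset.card_le_card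
    intro p
    rw [Finset.mem_filter, Finset.mem_filter]
    intro q; exact ⟨q.1, by omega⟩

def GoodF (n : ℕ) (I : Finset ℕ) (f : Fin n → ℕ) : Prop :=
  (∀ i, f i ≤ I.card) ∧ ∀ h ≤ I.card, (Finset.univ.filter fun i => f i = h).card = compFun n I h

theorem card_step {n : ℕ} (f : Fin n → ℕ) (h : ℕ) :
    (Finset.univ.filter fun i => f i ≤ h + 1).card =
      (Finset.univ.filter fun i => f i ≤ h).card + (Finset.univ.filter fun i => f i = h + 1).card := by
  rw [← Finset.card_union_of_disjoint]
  · congr 1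
    ext i
    simp only [Finset.mem_filter, Finset.mem_univ, true_and, Finset.mem_union]
    omega
  · rw [Finset.disjoint_left]
    intro i
    simp only [Finset.mem_filter, Finset.mem_univ, true_and]
    omega

theorem GoodF.le {n : ℕ} {I : Finset ℕ} (hI : I ⊆ Finset.Ioo 0 n) {f : Fin n → ℕ} (hf : GoodF n I f)
    {h : ℕ} (hh : h ≤ I.card) : (Finset.univ.filter fun i => f i ≤ h).card = jval n I (h + 1) := by
  induction h with
  | zero =>
    have := hf.2 0 hh
    simp only [nonpos_iff_eq_zero]
    rw [this, compFun]
    simp [jval]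
  | succ h ih =>
    rw [card_step, ih (by omega), hf.2 _ hh, compFun]
    have := jval_mono hI hh
    omega

theorem GoodF.of_le {n : ℕ} {I : Finset ℕ} {f : Fin n → ℕ} (h1 : ∀ i, f i ≤ I.card)
    (h2 : ∀ h ≤ I.card, (Finset.univ.filter fun i => f i ≤ h).card = jval n I (h + 1)) : GoodF n I f := by
  refine ⟨h1, ?_⟩
  intro h hh
  rcases h with _ | h
  · have := h2 0 hh
    simp only [nonpos_iff_eq_zero] at this
    rw [this, compFun]
    simp [jval]
  · have := card_step f h
    rw [h2 _ hh, h2 h (by omega)] at this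
    rw [compFun]
    omega

def Bf {n : ℕ} (f : Fin n → ℕ) : ℕ → Finset ℕ := fun h =>
  (Finset.univ.filter fun i => f i = h).image fun i : Fin n => (i : ℕ) + 1

theorem mem_Bf {n : ℕ} {f : Fin n → ℕ} {h k : ℕ} : k ∈ Bf f h ↔ ∃ i : Fin n, f i = h ∧ (i : ℕ) + 1 = k := by
  rw [Bf, Finset.mem_image]
  simp only [Finset.mem_filter, Finset.mem_univ, true_and]

theorem Bf_inj {n : ℕ} {f g : Fin n → ℕ} (h : Bf f = Bf g) : f = g := by
  funext i
  have : (i : ℕ) + 1 ∈ Bf f (f i) := mem_Bf.2 ⟨i, rfl, rfl⟩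
  rw [h, mem_Bf] at this
  obtain ⟨j, hj, e⟩ := this
  have : j = i := by apply Fin.ext; omega
  rw [← hj, this]

theorem Bf_card {n : ℕ} (f : Fin n → ℕ) (h : ℕ) :
    (Bf f h).card = (Finset.univ.filter fun i => f i = h).card := by
  rw [Bf, Finset.card_image_of_injective]
  intro a b e
  apply Fin.ext; simpa using e

theorem GoodF.mem {n : ℕ} {I : Finset ℕ} {f : Fin n → ℕ} (hf : GoodF n I f) : Bf f ∈ OPset n I := by
  refine ⟨?_, ?_, ?_, ?_⟩
  · intro h hh
    rw [Finset.eq_empty_iff_forall_notMem]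
    intro k hk
    obtain ⟨i, hi, -⟩ := mem_Bf.1 hk
    have := hf.1 i
    omega
  · intro h1 h2 hne
    rw [Finset.disjoint_left]
    intro k hk hk'
    obtain ⟨i, hi, rfl⟩ := mem_Bf.1 hk
    obtain ⟨j, hj, e⟩ := mem_Bf.1 hk'
    have : j = i := by apply Fin.ext; omega
    subst this
    exact hne (hi.symm.trans hj)
  · intro h hh
    rw [Bf_card]; exact hf.2 h hh
  · ext k
    rw [Finset.mem_biUnion, Finset.mem_Icc]
    constructor
    · intro hk
      refine ⟨f ⟨k - 1, by omega⟩, ?_, mem_Bf.2 ⟨⟨k - 1, by omega⟩, rfl, by simp; omega⟩⟩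
      rw [Finset.mem_range]
      have := hf.1 ⟨k - 1, by omega⟩
      omega
    · rintro ⟨h, -, hk⟩
      obtain ⟨i, -, rfl⟩ := mem_Bf.1 hk
      omega

theorem OP_exists {n : ℕ} {I : Finset ℕ} {B : ℕ → Finset ℕ} (hB : B ∈ OPset n I) :
    ∃ f : Fin n → ℕ, GoodF n I f ∧ B = Bf f := by
  obtain ⟨b1, b2, b3, b4⟩ := hB
  have : ∀ i : Fin n, ∃ h ∈ Finset.range (I.card + 1), (i : ℕ) + 1 ∈ B h := by
    intro i
    have : (i : ℕ) + 1 ∈ Finset.Icc 1 n := by rw [Finset.mem_Icc]; omega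
    rw [b4, Finset.mem_biUnion] at this
    exact this
  choose f hf1 hf2 using this
  have e : B = Bf f := by
    funext h
    ext k
    rw [mem_Bf]
    constructor
    · intro hk
      have hh : h < I.card + 1 := by
        by_contra q
        rw [b1 h (by omega)] at hk
        simp at hk
      have : k ∈ Finset.Icc 1 n := by
        rw [b4, Finset.mem_biUnion]; exact ⟨h, Finset.mem_range.2 hh, hk⟩
      rw [Finset.mem_Icc] at this
      refine ⟨⟨k - 1, by omega⟩, ?_, by simp; omega⟩
      by_contra hne
      have h3 := hf2 ⟨k - 1, by omega⟩
      have h4 : k - 1 + 1 = k := by omega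
      simp only [h4] at h3
      exact Finset.disjoint_left.1 (b2 _ _ hne) h3 hk
    · rintro ⟨i, rfl, rfl⟩
      exact hf2 i
  refine ⟨f, ⟨fun i => ?_, fun h hh => ?_⟩, e⟩
  · have := Finset.mem_range.1 (hf1 i); omega
  · rw [← Bf_card, ← e]; exact b3 h hh

theorem mono_card {n : ℕ} {g : Fin n → ℕ} (hg : Monotone g) (h : ℕ) (k : Fin n) :
    g k ≤ h ↔ (k : ℕ) < (Finset.univ.filter fun i => g i ≤ h).card := by
  constructor
  · intro hk
    have : Finset.Iic k ⊆ Finset.univ.filter fun i => g i ≤ h := by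
      intro i hi
      rw [Finset.mem_Iic] at hi
      rw [Finset.mem_filter]
      exact ⟨Finset.mem_univ _, (hg hi).trans hk⟩
    have := Finset.card_le_card this
    rw [Fin.card_Iic] at this
    omega
  · intro hk
    by_contra hcon
    have : (Finset.univ.filter fun i => g i ≤ h) ⊆ Finset.Iio k := by
      intro i hi
      rw [Finset.mem_filter] at hi
      rw [Finset.mem_Iio]
      by_contra q
      have := hg (not_lt.1 q)
      omega
    have := Finset.card_le_card this
    rw [Fin.card_Iio] at this
    omega

theorem GoodF.sort_key {n : ℕ} {I : Finset ℕ} (hI : I ⊆ Finset.Ioo 0 n) {f : Fin n → ℕ}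
    (hf : GoodF n I f) {h : ℕ} (hh : h ≤ I.card) (k : Fin n) :
    f (Tuple.sort f k) ≤ h ↔ (k : ℕ) < jval n I (h + 1) := by
  have h1 := mono_card (Tuple.monotone_sort f) h k
  have h2 : (Finset.univ.filter fun i => (f ∘ Tuple.sort f) i ≤ h).card =
      (Finset.univ.filter fun i => f i ≤ h).card := by
    refine Finset.card_bij (fun i _ => Tuple.sort f i) ?_ ?_ ?_
    · intro i hi
      rw [Finset.mem_filter] at hi ⊢
      exact ⟨Finset.mem_univ _, hi.2⟩
    · intro a _ b _ e; exact (Tuple.sort f).injective e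
    · intro i hi
      rw [Finset.mem_filter] at hi
      refine ⟨(Tuple.sort f).symm i, ?_, by simp⟩
      rw [Finset.mem_filter]
      exact ⟨Finset.mem_univ _, by simpa using hi.2⟩
  rw [h2, hf.le hI hh] at h1
  exact h1

theorem GoodF.sort_inj {n : ℕ} {I : Finset ℕ} (hI : I ⊆ Finset.Ioo 0 n) {f g : Fin n → ℕ}
    (hf : GoodF n I f) (hg : GoodF n I g) (e : Tuple.sort f = Tuple.sort g) : f = g := by
  have : ∀ k, f (Tuple.sort f k) = g (Tuple.sort f k) := by
    intro k
    apply le_antisymm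
    · rw [hf.sort_key hI (hg.1 _), ← hg.sort_key hI (hg.1 _), e]
    · rw [e, hg.sort_key hI (hf.1 _), ← hf.sort_key hI (hf.1 _), e]
  funext i
  have := this ((Tuple.sort f).symm i)
  simpa using this

theorem GoodF.des {n : ℕ} {I : Finset ℕ} (hI : I ⊆ Finset.Ioo 0 n) {f : Fin n → ℕ}
    (hf : GoodF n I f) : DslSet n (embedPerm n (Tuple.sort f)) ⊆ I := by
  intro i hi
  unfold DslSet at hi
  rw [Finset.mem_filter, Finset.mem_Ioo] at hi
  obtain ⟨⟨hi0, hin⟩, hlt⟩ := hi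
  obtain ⟨k, rfl⟩ : ∃ k, i = k + 1 := ⟨i - 1, by omega⟩
  have a1 := embedPerm_fin (Tuple.sort f) ⟨k, by omega⟩
  have a2 := embedPerm_fin (Tuple.sort f) ⟨k + 1, hin⟩
  simp only at a1 a2
  rw [a1, a2] at hlt
  have hst := (Tuple.eq_sort_iff (f := f) (σ := Tuple.sort f)).1 rfl
  have hkk : (⟨k, by omega⟩ : Fin n) < ⟨k + 1, hin⟩ := by simp [Fin.lt_def]
  have hle : f (Tuple.sort f ⟨k, by omega⟩) ≤ f (Tuple.sort f ⟨k + 1, hin⟩) := hst.1 hkk.le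
  have hne : f (Tuple.sort f ⟨k, by omega⟩) ≠ f (Tuple.sort f ⟨k + 1, hin⟩) := by
    intro q
    have := hst.2 _ _ hkk q
    rw [Fin.lt_def] at this
    omega
  have hb := hf.1 (Tuple.sort f ⟨k + 1, hin⟩)
  have hk1 := (hf.sort_key hI (hf.1 (Tuple.sort f ⟨k, by omega⟩)) ⟨k, by omega⟩).1 le_rfl
  have hk2 := (hf.sort_key hI (hf.1 (Tuple.sort f ⟨k, by omega⟩)) ⟨k + 1, hin⟩).not.1 (by omega)
  simp only at hk1 hk2
  have hm := jval_mem (n := n) (I := I) (h := f (Tuple.sort f ⟨k, by omega⟩)) (by omega)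
  have : k + 1 = jval n I (f (Tuple.sort f ⟨k, by omega⟩) + 1) := by omega
  rw [this]; exact hm

theorem permOP_mem {n : ℕ} {I : Finset ℕ} {w : Equiv.Perm ℕ} (hw : SuppIn n w) {B : ℕ → Finset ℕ}
    (hB : B ∈ OPset n I) : permOP w B ∈ OPset n I := by
  obtain ⟨b1, b2, b3, b4⟩ := hB
  refine ⟨?_, ?_, ?_, ?_⟩
  · intro h hh
    rw [permOP, b1 h hh, Finset.image_empty]
  · intro h1 h2 hne
    exact (Finset.disjoint_image w.injective).2 (b2 h1 h2 hne)
  · intro h hh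
    rw [permOP, Finset.card_image_of_injective _ w.injective]
    exact b3 h hh
  · have : (Finset.range (I.card + 1)).biUnion (permOP w B) = (Finset.Icc 1 n).image w := by
      rw [b4, Finset.biUnion_image]; rfl
    rw [this]
    symm
    apply Finset.eq_of_subset_of_card_le
    · intro k hk
      obtain ⟨i, hi, rfl⟩ := Finset.mem_image.1 hk
      rw [Finset.mem_Icc] at hi ⊢
      exact hw.mem hi
    · rw [Finset.card_image_of_injective _ w.injective]

/-- The exponent attached to an ordered set partition. -/
def exB (I : Finset ℕ) (B : ℕ → Finset ℕ) : ℕ →₀ ℕ :=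
  ∑ h ∈ Finset.range (I.card + 1), ∑ i ∈ B h, Finsupp.single i (I.card - h)

theorem exB_perm (I : Finset ℕ) (w : Equiv.Perm ℕ) (B : ℕ → Finset ℕ) :
    exB I (permOP w B) = Finsupp.mapDomain w (exB I B) := by
  rw [exB, exB, Finsupp.mapDomain_finset_sum]
  refine Finset.sum_congr rfl fun h _ => ?_
  rw [Finsupp.mapDomain_finset_sum, permOP, Finset.sum_image (fun a _ b _ e => w.injective e)]
  refine Finset.sum_congr rfl fun i _ => ?_
  rw [Finsupp.mapDomain_single]

theorem exB_Bf {n : ℕ} {I : Finset ℕ} {f : Fin n → ℕ} (hf : ∀ i, f i ≤ I.card) (k : ℕ) :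
    exB I (Bf f) k = ∑ i : Fin n, if (i : ℕ) + 1 = k then I.card - f i else 0 := by
  have : exB I (Bf f) = ∑ i : Fin n, Finsupp.single ((i : ℕ) + 1) (I.card - f i) := by
    rw [exB, ← Finset.sum_fiberwise_of_maps_to (s := Finset.univ) (t := Finset.range (I.card + 1)) (g := f)
      (fun i _ => Finset.mem_range.2 (by have := hf i; omega))]
    refine Finset.sum_congr rfl fun h _ => ?_
    rw [Bf, Finset.sum_image (fun a _ b _ e => Fin.ext (by simpa using e))]
    refine Finset.sum_congr rfl fun i hi => ?_
    rw [(Finset.mem_filter.1 hi).2]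
  rw [this, Finsupp.finsetSum_apply]
  refine Finset.sum_congr rfl fun i _ => ?_
  rw [Finsupp.single_apply]

/-- Every exponent `xe n I z` comes from an ordered set partition. -/
theorem exists_OP {n : ℕ} {I : Finset ℕ} (hI : I ⊆ Finset.Ioo 0 n) (z : Equiv.Perm (Fin n)) :
    ∃ B ∈ OPset n I, exB I B = xe n I z := by
  set f : Fin n → ℕ := fun i => cI I (n - 1 - z i) with hfdef
  have hf1 : ∀ i, f i ≤ I.card := fun i => cI_le _ _
  have hf : GoodF n I f := by
    refine GoodF.of_le hf1 fun h hh => ?_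
    rw [← jval_eq hI hh]
    refine Finset.card_bij (fun i _ => n - 1 - (z i : ℕ)) ?_ ?_ ?_
    · intro i hi
      rw [Finset.mem_filter] at hi ⊢
      rw [Finset.mem_range]
      exact ⟨by have := (z i).2; omega, hi.2⟩
    · intro a _ b _ e
      apply z.injective
      apply Fin.ext
      have := (z a).2
      have := (z b).2
      omega
    · intro p hp
      rw [Finset.mem_filter, Finset.mem_range] at hp
      refine ⟨z.symm ⟨n - 1 - p, by omega⟩, ?_, ?_⟩
      · rw [Finset.mem_filter]
        refine ⟨Finset.mem_univ _, ?_⟩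
        rw [hfdef]
        simp only [Equiv.apply_symm_apply]
        have : n - 1 - (n - 1 - p) = p := by omega
        rw [this]; exact hp.2
      · simp only [Equiv.apply_symm_apply]
        omega
  refine ⟨Bf f, hf.mem, ?_⟩
  refine finsupp_ext_fin (n := n) ?_ ?_ ?_
  · intro k hk
    rw [exB_Bf hf1]
    refine Finset.sum_eq_zero fun i _ => ?_
    rw [if_neg]
    have := i.2
    omega
  · intro k hk; exact xe_out I z hk
  · intro k
    rw [exB_Bf hf1, xe_fin, Finset.sum_eq_single k]
    · rw [if_pos rfl]
      have e : I.card = cI I (n - 1 - z k) + (I.filter fun d => n ≤ d + z k).card := by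
        rw [cI, ← Finset.card_union_of_disjoint]
        · congr 1
          ext d
          simp only [Finset.mem_union, Finset.mem_filter]
          have := (z k).2
          constructor
          · intro hd
            rcases Nat.lt_or_ge (d + z k) n with q | q
            · left; exact ⟨hd, by omega⟩
            · right; exact ⟨hd, q⟩
          · rintro (q | q) <;> exact q.1
        · rw [Finset.disjoint_left]
          intro d
          simp only [Finset.mem_filter]
          have := (z k).2
          omega
      rw [hfdef]
      simp only
      omega
    · intro j _ hj
      rw [if_neg]
      intro q
      exact hj (Fin.ext (by omega))
    · intro q; exact absurd (Finset.mem_univ _) q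

abbrev VQ (n : ℕ) (I : Finset ℕ) (q : SIdx n I) : Submodule ℚ (MvPolynomial ℕ ℚ) :=
  VSh n q.1.1.cells q.1.2 (hInd n I q.1.2)

theorem SIdx_eq {n : ℕ} {I : Finset ℕ} {q q' : SIdx n I} (h1 : q.1.1 = q'.1.1)
    (h2 : ∀ c ∈ q.1.1, q.1.2 c = q'.1.2 c) : q = q' := by
  apply Subtype.ext
  refine Prod.ext h1 ?_
  funext c
  by_cases hc : c ∈ q.1.1
  · exact h2 c hc
  · rw [q.2.2.1.1.1 c (fun h => hc ((YoungDiagram.mem_cells _).1 h)),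
      q'.2.2.1.1.1 c (fun h => hc (h1 ▸ (YoungDiagram.mem_cells _).1 h))]

theorem VQ_fin {n : ℕ} {I : Finset ℕ} (hI : I ⊆ Finset.Ioo 0 n) (F : Finset (SIdx n I))
    (v : SIdx n I → MvPolynomial ℕ ℚ) (hv : ∀ q ∈ F, v q ∈ VQ n I q)
    (h : phi n I (∑ q ∈ F, v q) = 0) : ∀ q ∈ F, v q = 0 := by
  rw [map_sum] at h
  intro q hq
  refine VSh_inj q.2.1 q.2.2.1 hI q.2.2.2 (hv q hq) ?_
  exact VV_indep F (fun q => q.1.1) (fun q => q.1.2) (fun q => DsiSet n q.1.2)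
    (fun q _ => q.2.2.1.stdOn q.2.1) (fun q _ q' _ h1 h2 => SIdx_eq h1 h2)
    (fun q => phi n I (v q)) (fun q hq => (VSh_spec q.2.1 q.2.2.1 hI q.2.2.2 (hv q hq)).1) h q hq

theorem VQ_indep {n : ℕ} {I : Finset ℕ} (hI : I ⊆ Finset.Ioo 0 n) : iSupIndep (VQ n I) := by
  apply iSupIndep_of_dfinsupp_lsum_injective
  rw [injective_iff_map_eq_zero]
  intro m hm
  rw [DFinsupp.lsum_apply_apply, DFinsupp.sumAddHom_apply, DFinsupp.sum] at hm
  ext1 q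
  by_cases hq : q ∈ m.support
  · have := VQ_fin hI m.support (fun q => (m q : MvPolynomial ℕ ℚ)) (fun q _ => (m q).2)
      (by
        have e : ∑ q ∈ m.support, (m q : MvPolynomial ℕ ℚ) = 0 := hm
        rw [e, map_zero]) q hq
    exact Subtype.ext this
  · simpa using hq

theorem VQ_phi {n : ℕ} {I : Finset ℕ} (hI : I ⊆ Finset.Ioo 0 n) {p : MvPolynomial ℕ ℚ}
    (hp : p ∈ ⨆ q, VQ n I q) (h0 : phi n I p = 0) : p = 0 := by
  obtain ⟨f, hf, rfl⟩ := (Submodule.mem_iSup_iff_exists_finsupp _ _).1 hp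
  refine Finset.sum_eq_zero fun q hq => ?_
  exact VQ_fin hI f.support f (fun q _ => hf q) h0 q hq

theorem VQ_hom {n : ℕ} {I : Finset ℕ} (hI : I ⊆ Finset.Ioo 0 n) {p : MvPolynomial ℕ ℚ}
    (hp : p ∈ ⨆ q, VQ n I q) : p.IsHomogeneous (∑ i ∈ I, i) := by
  have : ⨆ q, VQ n I q ≤ homogeneousSubmodule ℕ ℚ (∑ i ∈ I, i) := iSup_le fun q p hp =>
    (mem_homogeneousSubmodule _ _).2 (VSh_spec q.2.1 q.2.2.1 hI q.2.2.2 hp).2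
  exact (mem_homogeneousSubmodule _ _).1 (this hp)

theorem VQ_rename {n : ℕ} {I : Finset ℕ} {w : Equiv.Perm ℕ} (hw : SuppIn n w)
    {p : MvPolynomial ℕ ℚ} (hp : p ∈ ⨆ q, VQ n I q) : rename (⇑w) p ∈ ⨆ q, VQ n I q := by
  obtain ⟨g, rfl⟩ := hw.exists_embed
  have : ⨆ q, VQ n I q ≤ (⨆ q, VQ n I q).comap (rename (R := ℚ) (⇑(embedPerm n g))).toLinearMap :=
    iSup_le fun q p hp => Submodule.mem_comap.2
      ((le_iSup (VQ n I) q) (rename_VSh q.2.1 _ g hp))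
  exact this hp

abbrev GG (n : ℕ) (I : Finset ℕ) : Type :=
  {g : Equiv.Perm (Fin n) // DslSet n (embedPerm n g) ⊆ I}

def qof {n : ℕ} {I : Finset ℕ} (w : Equiv.Perm ℕ) (hw : SuppIn n w) (hD : DslSet n w ⊆ I) :
    SIdx n I :=
  ⟨(RSshape n w hw, Qt n w), RSshape_card hw, Qt_std hw, by
    rw [show ((RSshape n w hw, Qt n w) : YoungDiagram × Tab).2 = Qt n w from rfl, Dsic_Qt hw]
    exact hD⟩

theorem FwIhom_eq {n : ℕ} {I : Finset ℕ} {w : Equiv.Perm ℕ} (hw : SuppIn n w) :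
    FwIhom n I w = FTS n (Ptab n w) (Qt n w) * ∏ i ∈ I \ Dsic n (Qt n w), esym n i := by
  rw [FwIhom, Fw, Dsic_Qt hw]

theorem FwIhom_mem {n : ℕ} {I : Finset ℕ} (hI : I ⊆ Finset.Ioo 0 n) {w : Equiv.Perm ℕ}
    (hw : SuppIn n w) (hD : DslSet n w ⊆ I) : FwIhom n I w ∈ VQ n I (qof w hw hD) := by
  rw [FwIhom_eq hw, VQ, VSh, eProd_hInd hI, polyMul, Submodule.mem_map]
  refine ⟨FTS n (Ptab n w) (Qt n w), Submodule.subset_span ⟨_, (Ptab_std hw).1, rfl⟩, ?_⟩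
  rw [LinearMap.mulLeft_apply, mul_comm]
  rfl

theorem RnIhom_le {n : ℕ} {I : Finset ℕ} (hI : I ⊆ Finset.Ioo 0 n) :
    RnIhom n I ≤ ⨆ q, VQ n I q := by
  rw [RnIhom, Submodule.span_le]
  rintro p ⟨w, hw, hD, rfl⟩
  exact (le_iSup (VQ n I) _) (FwIhom_mem hI hw hD)

theorem tT_inj {μ : YoungDiagram} {n : ℕ} (hn : μ.cells.card = n) {T T' : Tab}
    (h : IsFilling μ T) (h' : IsFilling μ T') (e : tT n T = tT n T') : T = T' := by
  funext c
  by_cases hc : c ∈ μ.cells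
  · obtain ⟨i, hi⟩ : ∃ i, tT n T i = c := by
      have h1 := h.2.mapsTo (Finset.mem_coe.2 hc)
      rw [Set.mem_Icc] at h1
      refine ⟨⟨T c - 1, by omega⟩, ?_⟩
      have h2 := IsFillingF.apply_tT hn h ⟨T c - 1, by omega⟩
      refine h.2.injOn h2.2 hc ?_
      rw [h2.1]
      show T c - 1 + 1 = _
      omega
    have h1 := (IsFillingF.apply_tT hn h i).1
    have h2 := (IsFillingF.apply_tT hn h' i).1
    rw [← e] at h2
    rw [← hi, h1, h2]
  · rw [h.1 c hc, h'.1 c hc]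

theorem FwIhom_indep {n : ℕ} {I : Finset ℕ} (hI : I ⊆ Finset.Ioo 0 n) :
    LinearIndependent ℚ (fun g : GG n I => FwIhom n I (embedPerm n g.1)) := by
  rw [Fintype.linearIndependent_iff]
  intro c hc g0
  let Q : GG n I → SIdx n I := fun g => qof _ (suppIn_embedPerm g.1) g.2
  have hmem : ∀ g : GG n I, FwIhom n I (embedPerm n g.1) ∈ VQ n I (Q g) := fun g =>
    FwIhom_mem hI _ _
  let v : SIdx n I → MvPolynomial ℕ ℚ := fun q =>
    ∑ g ∈ Finset.univ.filter (fun g => Q g = q), c g • FwIhom n I (embedPerm n g.1)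
  have hsum : ∑ q ∈ Finset.univ.image Q, v q = 0 := by
    rw [← hc]
    exact Finset.sum_fiberwise_of_maps_to (fun g _ => Finset.mem_image_of_mem _ (Finset.mem_univ _)) _
  have hv0 := VQ_fin hI (Finset.univ.image Q) v (fun q _ => Submodule.sum_mem _ fun g hg =>
    Submodule.smul_mem _ _ ((Finset.mem_filter.1 hg).2 ▸ hmem g)) (by rw [hsum, map_zero]) (Q g0)
    (Finset.mem_image_of_mem _ (Finset.mem_univ _))
  have hw0 := suppIn_embedPerm g0.1
  have hQ : ∀ g ∈ Finset.univ.filter (fun g => Q g = Q g0),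
      RSshape n (embedPerm n g.1) (suppIn_embedPerm g.1) = RSshape n (embedPerm n g0.1) hw0 ∧
      Qt n (embedPerm n g.1) = Qt n (embedPerm n g0.1) := by
    intro g hg
    have := congrArg Subtype.val (Finset.mem_filter.1 hg).2
    exact ⟨congrArg Prod.fst this, congrArg Prod.snd this⟩
  have hn := RSshape_card hw0
  have hP : ∀ g ∈ Finset.univ.filter (fun g => Q g = Q g0),
      IsStandard (RSshape n (embedPerm n g0.1) hw0) (Ptab n (embedPerm n g.1)) := by
    intro g hg
    rw [← (hQ g hg).1]
    exact Ptab_std _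
  have key := std_indep ((Qt_std hw0).stdOn hn)
    (Finset.univ.filter (fun g => Q g = Q g0)) (fun g => tT n (Ptab n (embedPerm n g.1)))
    (fun g hg => (hP g hg).isStd hn)
    (fun a ha b hb e => by
      have e1 := tT_inj hn (hP a ha).1 (hP b hb).1 e
      have e2 := RS_inj' (suppIn_embedPerm a.1) (suppIn_embedPerm b.1) e1
        ((hQ a ha).2.trans (hQ b hb).2.symm)
      exact Subtype.ext (embedPerm_injective e2))
    (fun g => c g * (sTS n (Ptab n (embedPerm n g.1)) (Qt n (embedPerm n g0.1)) : ℚ)⁻¹)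
    (by
      have h1 : phi n I (v (Q g0)) = 0 := by rw [hv0, map_zero]
      rw [← h1, map_sum]
      refine Finset.sum_congr rfl fun g hg => ?_
      rw [map_smul, FwIhom_eq (suppIn_embedPerm _), (hQ g hg).2,
        phi_FTS_mul hn (hP g hg).1 (Qt_std hw0) hI (by rw [Dsic_Qt hw0]; exact g0.2), smul_smul])
    g0 (Finset.mem_filter.2 ⟨Finset.mem_univ _, rfl⟩)
  exact (mul_eq_zero.1 key).resolve_right (inv_ne_zero (sTS_ne _ _ _))

theorem exists_OPmap {n : ℕ} {I : Finset ℕ} (hI : I ⊆ Finset.Ioo 0 n) :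
    ∃ s : ↥(OPset n I) → GG n I, Function.Injective s := by
  choose f hf1 hf2 using fun B : ↥(OPset n I) => OP_exists B.2
  refine ⟨fun B => ⟨Tuple.sort (f B), (hf1 B).des hI⟩, fun B B' e => ?_⟩
  have e1 : Tuple.sort (f B) = Tuple.sort (f B') := congrArg Subtype.val e
  have e2 := (hf1 B).sort_inj hI (hf1 B') e1
  exact Subtype.ext (by rw [hf2 B, hf2 B', e2])

def cfB (n : ℕ) (I : Finset ℕ) : MvPolynomial ℕ ℚ →ₗ[ℚ] (↥(OPset n I) → ℚ) where
  toFun p := fun B => coeff (exB I B.1) p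
  map_add' p q := by funext z; simp
  map_smul' c p := by funext z; simp

theorem cfB_inj {n : ℕ} {I : Finset ℕ} (hI : I ⊆ Finset.Ioo 0 n) {p : MvPolynomial ℕ ℚ}
    (hp : p ∈ ⨆ q, VQ n I q) (h0 : cfB n I p = 0) : p = 0 := by
  refine VQ_phi hI hp ?_
  funext z
  obtain ⟨B, hB, e⟩ := exists_OP hI z
  rw [phi_apply, ← e]
  exact congrFun h0 ⟨B, hB⟩

theorem RnIhom_main {n : ℕ} {I : Finset ℕ} (hI : I ⊆ Finset.Ioo 0 n) :
    RnIhom n I = (⨆ q, VQ n I q) ∧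
      Function.Bijective ((cfB n I).domRestrict (RnIhom n I)) := by
  obtain ⟨s, hs⟩ := exists_OPmap (n := n) hI
  haveI : Finite ↥(OPset n I) := Finite.of_injective s hs
  haveI : Fintype ↥(OPset n I) := Fintype.ofFinite _
  set M := ⨆ q, VQ n I q with hM
  have hinjM : Function.Injective ((cfB n I).domRestrict M) := by
    rw [← LinearMap.ker_eq_bot, LinearMap.ker_eq_bot']
    intro p hp
    exact Subtype.ext (cfB_inj hI p.2 hp)
  haveI : FiniteDimensional ℚ M := FiniteDimensional.of_injective _ hinjM
  have hle : RnIhom n I ≤ M := RnIhom_le hI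
  haveI : FiniteDimensional ℚ (RnIhom n I) := Submodule.finiteDimensional_of_le hle
  have h1 : Module.finrank ℚ M ≤ Fintype.card ↥(OPset n I) := by
    have := LinearMap.finrank_le_finrank_of_injective hinjM
    rwa [Module.finrank_fintype_fun_eq_card] at this
  have h2 : Fintype.card ↥(OPset n I) ≤ Fintype.card (GG n I) := Fintype.card_le_of_injective s hs
  have h3 : Fintype.card (GG n I) ≤ Module.finrank ℚ (RnIhom n I) := by
    have hl : LinearIndependent ℚ (fun g : GG n I =>
        (⟨FwIhom n I (embedPerm n g.1), Submodule.subset_span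
          ⟨_, suppIn_embedPerm _, g.2, rfl⟩⟩ : RnIhom n I)) :=
      LinearIndependent.of_comp (RnIhom n I).subtype (FwIhom_indep hI)
    exact hl.fintype_card_le_finrank
  have hinj : Function.Injective ((cfB n I).domRestrict (RnIhom n I)) := by
    rw [← LinearMap.ker_eq_bot, LinearMap.ker_eq_bot']
    intro p hp
    exact Subtype.ext (cfB_inj hI (hle p.2) hp)
  have h4 := LinearMap.finrank_le_finrank_of_injective hinj
  rw [Module.finrank_fintype_fun_eq_card] at h4
  refine ⟨Submodule.eq_of_le_of_finrank_le hle (by omega), hinj, ?_⟩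
  refine (LinearMap.injective_iff_surjective_of_finrank_eq_finrank ?_).1 hinj
  rw [Module.finrank_fintype_fun_eq_card]
  omega

/-- (i) `R^hom_{n,I}` is an `Sₙ`-subrepresentation and equals the direct
sum, over partitions `λ ⊢ n` and standard Young tableaux `S` of shape `λ` with
`Dsi^c(S) ⊆ I`, of the spaces `V^S_{h(I,S)}` (indicator vectors of `I \ Dsi^c(S)`);
(ii) `R^hom_{n,I} ≅ ℚ[OP_{n,I}]` as representations of `Sₙ`; (iii) every polynomial in
`R^hom_{n,I}` is homogeneous of degree `Σ_{i ∈ I} i`. -/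
theorem statement_2 (n : ℕ) (I : Finset ℕ) (hI : I ⊆ Finset.Ioo 0 n) :
    -- (i)
    ((∀ w : Equiv.Perm ℕ, SuppIn n w → ∀ p ∈ RnIhom n I, rename (⇑w) p ∈ RnIhom n I) ∧
     RnIhom n I = (⨆ q : SIdx n I, VSh n q.1.1.cells q.1.2 (hInd n I q.1.2)) ∧
     iSupIndep fun q : SIdx n I => VSh n q.1.1.cells q.1.2 (hInd n I q.1.2)) ∧
    -- (ii)
    ((∀ w : Equiv.Perm ℕ, SuppIn n w → ∀ B ∈ OPset n I, permOP w B ∈ OPset n I) ∧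
     ∃ φ : ↥(RnIhom n I) ≃ₗ[ℚ] (↥(OPset n I) → ℚ),
       ∀ w : Equiv.Perm ℕ, SuppIn n w → ∀ p : ↥(RnIhom n I),
         ∀ hp : rename (⇑w) (p : MvPolynomial ℕ ℚ) ∈ RnIhom n I,
         ∀ B B' : ↥(OPset n I), permOP w B.1 = B'.1 →
           φ ⟨rename (⇑w) (p : MvPolynomial ℕ ℚ), hp⟩ B' = φ p B) ∧
    -- (iii)
    (∀ p ∈ RnIhom n I, p.IsHomogeneous (∑ i ∈ I, i)) := by
  obtain ⟨hM, hb⟩ := RnIhom_main hI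
  refine ⟨⟨fun w hw p hp => ?_, hM, VQ_indep hI⟩, ⟨fun w hw B hB => permOP_mem hw hB, ?_⟩,
    fun p hp => VQ_hom hI (hM ▸ hp)⟩
  · rw [hM] at hp ⊢
    exact VQ_rename hw hp
  · refine ⟨LinearEquiv.ofBijective _ hb, fun w hw p hp B B' e => ?_⟩
    show coeff (exB I B'.1) (rename (⇑w) (p : MvPolynomial ℕ ℚ)) = coeff (exB I B.1) p.1
    rw [← e, exB_perm, coeff_rename_mapDomain _ w.injective]

end HigherSpecht
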